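/- arXiv:1906.05263 — 6 statements merged into one kernel-verified Lean document; each statement's English description precedes it below -/
import Mathlib

section
/- For all integers k ≥ 2, the Gallai-Ramsey number of the 4-cycle satisfies GR_k(C_4) = k + 4. -/
/-- The successor of an index on a cycle with `m` vertices. -/
def nextFin {m : ℕ} (j : Fin m) : Fin m :=
  ⟨(j.val + 1) % m, Nat.mod_lt _ (Nat.lt_of_le_of_lt (Nat.zero_le _) j.isLt)⟩

/-- A symmetric edge coloring of the complete graph on `V`. -/
def ColorSymm {V γ : Type*} (c : V → V → γ) : Prop := ∀ u v, c u v = c v u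

/-- A Gallai coloring: no triangle receives three distinct colors. -/
def IsGallai {V γ : Type*} (c : V → V → γ) : Prop :=
  ∀ u v w : V, u ≠ v → v ≠ w → u ≠ w →
    c u v = c v w ∨ c u v = c u w ∨ c v w = c u w

/-- A monochromatic cycle on `m` vertices in color `i`. -/
def MonoCycle {V γ : Type*} (c : V → V → γ) (m : ℕ) (i : γ) : Prop :=
  ∃ f : Fin m → V, Function.Injective f ∧ ∀ j : Fin m, c (f j) (f (nextFin j)) = i

/-- A monochromatic copy of `Θ_m` in color `i`: a cycle on `m` vertices together with
a chord joining two non-consecutive vertices, all edges in color `i`. -/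
def MonoTheta {V γ : Type*} (c : V → V → γ) (m : ℕ) (i : γ) : Prop :=
  ∃ f : Fin m → V, Function.Injective f ∧
    (∀ j : Fin m, c (f j) (f (nextFin j)) = i) ∧
    ∃ a b : Fin m, a ≠ b ∧ b ≠ nextFin a ∧ a ≠ nextFin b ∧ c (f a) (f b) = i

/-- A monochromatic path on `m` vertices in color `i`. -/
def MonoPath {V γ : Type*} (c : V → V → γ) (m : ℕ) (i : γ) : Prop :=
  ∃ f : Fin m → V, Function.Injective f ∧
    ∀ (j : ℕ) (h : j + 1 < m), c (f ⟨j, by omega⟩) (f ⟨j + 1, h⟩) = i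

/-- No two distinct vertices have two distinct common neighbors in the same color. -/
def NoFourCycle {V γ : Type*} (c : V → V → γ) : Prop :=
  ∀ (i : γ) (a b p q : V), a ≠ b → p ≠ q → a ≠ p → a ≠ q → b ≠ p → b ≠ q →
    c a p = i → c a q = i → c b p = i → c b q = i → False

lemma noFourCycle_of_not_monoCycle {V γ : Type*} {c : V → V → γ} (hs : ColorSymm c)
    (h : ¬ ∃ i, MonoCycle c 4 i) : NoFourCycle c := by
  intro i a b p q hab hpq hap haq hbp hbq h₁ h₂ h₃ h₄
  refine h ⟨i, ![a, p, b, q], ?_, ?_⟩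
  · intro x y hxy
    fin_cases x <;> fin_cases y <;> simp_all [eq_comm]
  · intro j
    have := hs p b
    have := hs q a
    fin_cases j <;> simp_all [nextFin]

/-- In a Gallai coloring without a monochromatic 4-cycle, every finite vertex set either has a
vertex joined to all the others in one color, or sees at most two colors. -/
lemma exists_spanning_or_two_colors {V γ : Type*} [Nonempty γ] {c : V → V → γ}
    (hs : ColorSymm c) (hg : IsGallai c) (hc : NoFourCycle c) (S : Finset V) :
    (∃ v ∈ S, ∃ i, ∀ w ∈ S, w ≠ v → c v w = i) ∨
      ∃ a b, ∀ u ∈ S, ∀ w ∈ S, u ≠ w → c u w = a ∨ c u w = b := by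
  classical
  induction S using Finset.induction_on with
  | empty =>
    right
    obtain ⟨a⟩ := ‹Nonempty γ›
    exact ⟨a, a, by simp⟩
  | insert x S hx ih =>
    rcases ih with ⟨v, hv, i, hi⟩ | ⟨a, b, hab⟩
    · have hxv : x ≠ v := fun h => hx (h ▸ hv)
      by_cases hj : c x v = i
      · left
        refine ⟨v, by simp [hv], i, fun w hw hwv => ?_⟩
        rcases Finset.mem_insert.1 hw with rfl | hw
        · rw [hs]; exact hj
        · exact hi w hw hwv
      have hxS : ∀ w ∈ S, x ≠ w := fun w hw h => hx (h ▸ hw)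
      have hxc : ∀ w ∈ S, c x w = i ∨ c x w = c x v := by
        intro w hw
        by_cases hwv : w = v
        · right; rw [hwv]
        have := hg x v w hxv (Ne.symm hwv) (hxS w hw)
        have := hi w hw hwv
        grind
      by_cases hw : ∃ w ∈ S, c x w = i
      · obtain ⟨w, hw, hxw⟩ := hw
        have hwv : w ≠ v := by rintro rfl; exact hj hxw
        right
        refine ⟨i, c x v, ?_⟩
        have hxy : ∀ y ∈ S, y ≠ w → c x y = c x v := by
          intro y hy hyw
          rcases hxc y hy with h | h
          · by_cases hyv : y = v
            · rw [hyv]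
            exact (hc i x v w y hxv hyw.symm (hxS w hw) (hxS y hy) hwv.symm (Ne.symm hyv)
              hxw h (hi w hw hwv) (hi y hy hyv)).elim
          · exact h
        have hwy : ∀ y ∈ S, y ≠ w → c w y = i ∨ c w y = c x v := by
          intro y hy hyw
          have := hg x w y (hxS w hw) hyw.symm (hxS y hy)
          have := hxy y hy hyw
          grind
        have hyy : ∀ y ∈ S, ∀ z ∈ S, y ≠ z → y ≠ w → z ≠ w → y ≠ v → z ≠ v →
            c y z = i ∨ c y z = c x v := by
          intro y hy z hz hyz hyw hzw hyv hzv
          by_cases h : c w y = c w z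
          · exfalso
            rcases hwy y hy hyw with h' | h'
            · exact hc i w v y z hwv hyz hyw.symm hzw.symm hyv.symm hzv.symm h'
                (h ▸ h') (hi y hy hyv) (hi z hz hzv)
            · exact hc (c x v) w x y z (hxS w hw).symm hyz hyw.symm hzw.symm (hxS y hy)
                (hxS z hz) h' (h ▸ h') (hxy y hy hyw) (hxy z hz hzw)
          · have := hg w y z hyw.symm hyz hzw.symm
            have := hwy y hy hyw
            have := hwy z hz hzw
            grind
        have hSS : ∀ y ∈ S, ∀ z ∈ S, y ≠ z → c y z = i ∨ c y z = c x v := by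
          intro y hy z hz hyz
          by_cases hyv : y = v
          · subst hyv; exact Or.inl (hi z hz hyz.symm)
          by_cases hzv : z = v
          · subst hzv; rw [hs]; exact Or.inl (hi y hy hyz)
          by_cases hyw : y = w
          · subst hyw; exact hwy z hz hyz.symm
          by_cases hzw : z = w
          · subst hzw; rw [hs]; exact hwy y hy hyz
          exact hyy y hy z hz hyz hyw hzw hyv hzv
        intro u hu z hz huz
        rcases Finset.mem_insert.1 hu with rfl | huS <;>
          rcases Finset.mem_insert.1 hz with rfl | hzS
        · exact (huz rfl).elim
        · exact hxc z hzS
        · rw [hs]; exact hxc u huS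
        · exact hSS u huS z hzS huz
      · left
        push Not at hw
        refine ⟨x, by simp, c x v, fun w hwS hwx => ?_⟩
        rcases Finset.mem_insert.1 hwS with rfl | hwS
        · exact (hwx rfl).elim
        · exact (hxc w hwS).resolve_left (hw w hwS)
    · have hxS : ∀ w ∈ S, x ≠ w := fun w hw h => hx (h ▸ hw)
      by_cases hthird : ∃ v ∈ S, c x v ≠ a ∧ c x v ≠ b
      · left
        obtain ⟨v, hv, hva, hvb⟩ := hthird
        have hout : ∀ w ∈ S, c x w ≠ c x v → ∀ u ∈ S, c x u = c x v → c w u = c x w := by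
          intro w hw hwv u hu huv
          have hwu : w ≠ u := by rintro rfl; exact hwv huv
          have := hg x w u (hxS w hw) hwu (hxS u hu)
          have := hab w hw u hu hwu
          grind
        have hcol : ∀ w ∈ S, c x w ≠ c x v → c x w = a ∨ c x w = b := by
          intro w hw hwv
          rw [← hout w hw hwv v hv rfl]
          exact hab w hw v hv (by rintro rfl; exact hwv rfl)
        have hinj : ∀ w ∈ S, c x w ≠ c x v → ∀ z ∈ S, c x z = c x w → z = w := by
          intro w hw hwv z hz hzw
          by_contra hne
          exact hc (c x w) x v w z (hxS v hv) (Ne.symm hne) (hxS w hw) (hxS z hz)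
            (by rintro rfl; exact hwv rfl) (by rintro rfl; exact hwv hzw.symm) rfl hzw
            (by rw [hs]; exact hout w hw hwv v hv rfl)
            (by rw [hs, hout z hz (hzw ▸ hwv) v hv rfl, hzw])
        have hspan : ∀ w ∈ S, c x w ≠ c x v →
            (∀ z ∈ S, z ≠ w → c x z ≠ c x v → c w z = c x w) →
            ∃ v ∈ insert x S, ∃ i, ∀ w ∈ insert x S, w ≠ v → c v w = i := by
          intro w hw hwv h
          refine ⟨w, by simp [hw], c x w, fun z hz hzw => ?_⟩
          rcases Finset.mem_insert.1 hz with rfl | hz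
          · exact hs _ _
          · by_cases hzv : c x z = c x v
            · exact hout w hw hwv z hz hzv
            · exact h z hz hzw hzv
        by_cases hw : ∃ w ∈ S, c x w ≠ c x v
        · obtain ⟨w, hw, hwv⟩ := hw
          by_cases hz : ∃ z ∈ S, z ≠ w ∧ c x z ≠ c x v
          · obtain ⟨z, hz, hzw, hzv⟩ := hz
            have hne : c x z ≠ c x w := fun h => hzw (hinj w hw hwv z hz h)
            have hwc := hcol w hw hwv
            have hzc := hcol z hz hzv
            have honly : ∀ y ∈ S, c x y ≠ c x v → y = w ∨ y = z := by
              intro y hy hyv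
              have := hcol y hy hyv
              have := hinj w hw hwv y hy
              have := hinj z hz hzv y hy
              grind
            have hwz := hab w hw z hz hzw.symm
            have hcase : c w z = c x w ∨ c w z = c x z := by grind
            rcases hcase with h | h
            · refine hspan w hw hwv fun y hy hyw hyv => ?_
              rcases honly y hy hyv with rfl | rfl
              · exact (hyw rfl).elim
              · exact h
            · refine hspan z hz hzv fun y hy hyz hyv => ?_
              rcases honly y hy hyv with rfl | rfl
              · rw [hs]; exact h
              · exact (hyz rfl).elim
          · push Not at hz
            exact hspan w hw hwv fun z hzS hzw hzv => (hzv (hz z hzS hzw)).elim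
        · push Not at hw
          refine ⟨x, by simp, c x v, fun w hwS hwx => ?_⟩
          rcases Finset.mem_insert.1 hwS with rfl | hwS
          · exact (hwx rfl).elim
          · exact hw w hwS
      · right
        have hxab : ∀ w ∈ S, c x w = a ∨ c x w = b := by
          intro w hw
          by_contra h
          push Not at h
          exact hthird ⟨w, hw, h⟩
        refine ⟨a, b, fun u hu z hz huz => ?_⟩
        rcases Finset.mem_insert.1 hu with rfl | huS <;>
          rcases Finset.mem_insert.1 hz with rfl | hzS
        · exact (huz rfl).elim
        · exact hxab z hzS
        · rw [hs]; exact hxab u huS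
        · exact hab u huS z hzS huz

/-- In a two-colored set of six vertices without a monochromatic 4-cycle, no vertex has three
neighbors in the same color. -/
lemma card_color_neighbors_lt_three {V γ : Type*} [DecidableEq V] [DecidableEq γ] {c : V → V → γ}
    (hs : ColorSymm c) (hc : NoFourCycle c) {S : Finset V} (hS : S.card = 6) {a b : γ}
    (hab : ∀ u ∈ S, ∀ w ∈ S, u ≠ w → c u w = a ∨ c u w = b) {x : V} (hx : x ∈ S) :
    ((S.erase x).filter (fun w => c x w = a)).card < 3 := by
  by_contra! h
  obtain ⟨T, hT, hT3⟩ := Finset.exists_subset_card_eq h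
  have hTS : T ⊆ S.erase x := hT.trans (Finset.filter_subset _ _)
  have hU : ((S.erase x) \ T).card = 2 := by
    rw [Finset.card_sdiff_of_subset hTS, Finset.card_erase_of_mem hx]; omega
  obtain ⟨p, q, r, hpq, hpr, hqr, rfl⟩ := Finset.card_eq_three.1 hT3
  obtain ⟨s, t, hst, hU⟩ := Finset.card_eq_two.1 hU
  have hp := Finset.mem_filter.1 (hT (show p ∈ _ by simp))
  have hq := Finset.mem_filter.1 (hT (show q ∈ _ by simp))
  have hr := Finset.mem_filter.1 (hT (show r ∈ _ by simp))
  have hs' : s ∈ S.erase x \ {p, q, r} := hU ▸ by simp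
  have ht' : t ∈ S.erase x \ {p, q, r} := hU ▸ by simp
  simp only [Finset.mem_sdiff, Finset.mem_erase, Finset.mem_insert, Finset.mem_singleton,
    not_or] at hs' ht' hp hq hr
  obtain ⟨⟨hsx, hsS⟩, hsp, hsq, hsr⟩ := hs'
  obtain ⟨⟨htx, htS⟩, htp, htq, htr⟩ := ht'
  obtain ⟨⟨hpx, hpS⟩, hxpa⟩ := hp
  obtain ⟨⟨hqx, hqS⟩, hxqa⟩ := hq
  obtain ⟨⟨hrx, hrS⟩, hxra⟩ := hr
  have key : ∀ p ∈ S, ∀ q ∈ S, ∀ r ∈ S, p ≠ q → p ≠ r → q ≠ r → p ≠ x → q ≠ x → r ≠ x →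
      s ≠ p → s ≠ q → s ≠ r → t ≠ p → t ≠ q → t ≠ r → c x p = a → c x q = a → c x r = a →
      c s p = b → c s q = b → c t q = b → c t r = b → False := by
    clear hpq hpr hqr hsp hsq hsr htp htq htr hpx hqx hrx hxpa hxqa hxra hpS hqS hrS
    intro p hp q hq r hr hpq hpr hqr hpx hqx hrx hsp hsq hsr htp htq htr hxp hxq hxr
      h₁ h₂ h₃ h₄
    have hpra : c p r = a := by
      refine (hab p hp r hr hpr).resolve_right fun h => ?_
      have hqra := (hab q hq r hr hqr).resolve_right fun h' =>
        hc b r s p q hsr.symm hpq hpr.symm hqr.symm hsp hsq (hs r p ▸ h) (hs r q ▸ h') h₁ h₂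
      have hpqa := (hab p hp q hq hpq).resolve_right fun h' =>
        hc b p t q r htp.symm hqr hpq hpr htq htr h' h h₃ h₄
      exact hc a x q p r hqx.symm hpr hpx.symm hrx.symm hpq.symm hqr hxp hxr
        (hs q p ▸ hpqa) hqra
    have hpqb := (hab p hp q hq hpq).resolve_left fun h =>
      hc a x p q r hpx.symm hqr hqx.symm hrx.symm hpq hpr hxq hxr h hpra
    have hsra := (hab s hsS r hr hsr).resolve_right fun h =>
      hc b s t q r hst hqr hsq hsr htq htr h₂ h h₃ h₄
    have htpa := (hab t htS p hp htp).resolve_right fun h =>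
      hc b s t p q hst hpq hsp hsq htp htq h₁ h₂ h h₃
    rcases hab s hsS t htS hst with h | h
    · exact hc a s p r t hsp htr.symm hsr hst hpr htp.symm hsra h hpra (hs p t ▸ htpa)
    · exact hc b s q p t hsq htp.symm hsp hst hpq.symm htq.symm h₁ h (hs q p ▸ hpqb)
        (hs q t ▸ h₃)
  have htwo : ∀ y ∈ S, y ≠ x → y ≠ p → y ≠ q → y ≠ r →
      c y p = b ∧ c y q = b ∨ c y p = b ∧ c y r = b ∨ c y q = b ∧ c y r = b := by
    intro y hy hyx hyp hyq hyr
    have h₁ := hc a x y p q hyx.symm hpq hpx.symm hqx.symm hyp hyq hxpa hxqa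
    have h₂ := hc a x y p r hyx.symm hpr hpx.symm hrx.symm hyp hyr hxpa hxra
    have h₃ := hc a x y q r hyx.symm hqr hqx.symm hrx.symm hyq hyr hxqa hxra
    have h₄ := hab y hy p hpS hyp
    have h₅ := hab y hy q hqS hyq
    have h₆ := hab y hy r hrS hyr
    tauto
  rcases htwo s hsS hsx hsp hsq hsr with ⟨h₁, h₂⟩ | ⟨h₁, h₂⟩ | ⟨h₁, h₂⟩ <;>
    rcases htwo t htS htx htp htq htr with ⟨h₃, h₄⟩ | ⟨h₃, h₄⟩ | ⟨h₃, h₄⟩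
  · exact hc b s t p q hst hpq hsp hsq htp htq h₁ h₂ h₃ h₄
  · exact key q hqS p hpS r hrS hpq.symm hqr hpr hqx hpx hrx hsq hsp hsr htq htp htr
      hxqa hxpa hxra h₂ h₁ h₃ h₄
  · exact key p hpS q hqS r hrS hpq hpr hqr hpx hqx hrx hsp hsq hsr htp htq htr
      hxpa hxqa hxra h₁ h₂ h₃ h₄
  · exact key r hrS p hpS q hqS hpr.symm hqr.symm hpq hrx hpx hqx hsr hsp hsq htr htp htq
      hxra hxpa hxqa h₂ h₁ h₃ h₄
  · exact hc b s t p r hst hpr hsp hsr htp htr h₁ h₂ h₃ h₄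
  · exact key p hpS r hrS q hqS hpr hpq hqr.symm hpx hrx hqx hsp hsr hsq htp htr htq
      hxpa hxra hxqa h₁ h₂ h₄ h₃
  · exact key r hrS q hqS p hpS hqr.symm hpr.symm hpq.symm hrx hqx hpx hsr hsq hsp htr htq htp
      hxra hxqa hxpa h₂ h₁ h₄ h₃
  · exact key q hqS r hrS p hpS hqr hpq.symm hpr.symm hqx hrx hpx hsq hsr hsp htq htr htp
      hxqa hxra hxpa h₁ h₂ h₄ h₃
  · exact hc b s t q r hst hqr hsq hsr htq htr h₁ h₂ h₃ h₄

lemma card_le_five_of_two_colors {V γ : Type*} {c : V → V → γ}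
    (hs : ColorSymm c) (hc : NoFourCycle c) {S : Finset V} {a b : γ}
    (hab : ∀ u ∈ S, ∀ w ∈ S, u ≠ w → c u w = a ∨ c u w = b) : S.card ≤ 5 := by
  classical
  by_contra! h
  obtain ⟨T, hTS, hT⟩ := Finset.exists_subset_card_eq (show 6 ≤ S.card by omega)
  have hab' : ∀ u ∈ T, ∀ w ∈ T, u ≠ w → c u w = a ∨ c u w = b :=
    fun u hu w hw => hab u (hTS hu) w (hTS hw)
  obtain ⟨x, hx⟩ : T.Nonempty := Finset.card_pos.1 (by omega)
  have ha := card_color_neighbors_lt_three hs hc hT hab' hx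
  have hb := card_color_neighbors_lt_three hs hc hT
    (fun u hu w hw huw => (hab' u hu w hw huw).symm) hx
  have hunion : T.erase x ⊆ (T.erase x).filter (fun w => c x w = a) ∪
      (T.erase x).filter (fun w => c x w = b) := by
    intro w hw
    have hw' := Finset.mem_erase.1 hw
    rcases hab' x hx w hw'.2 hw'.1.symm with h | h <;> simp [hw', h]
  have h₁ := (Finset.card_le_card hunion).trans (Finset.card_union_le _ _)
  rw [Finset.card_erase_of_mem hx] at h₁
  omega

lemma card_le_of_colors_mem {V γ : Type*} [Nonempty γ] {c : V → V → γ}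
    (hs : ColorSymm c) (hg : IsGallai c) (hc : NoFourCycle c) (n : ℕ) (K : Finset γ)
    (S : Finset V) (hK : K.card ≤ n + 2)
    (hcK : ∀ u ∈ S, ∀ w ∈ S, u ≠ w → c u w ∈ K) : S.card ≤ n + 5 := by
  classical
  induction n generalizing K S with
  | zero =>
    obtain ⟨a, b, hab⟩ : ∃ a b, K ⊆ {a, b} := by
      obtain h | h | h : K.card = 0 ∨ K.card = 1 ∨ K.card = 2 := by omega
      · obtain ⟨a⟩ := ‹Nonempty γ›
        exact ⟨a, a, by simp [Finset.card_eq_zero.1 h]⟩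
      · obtain ⟨a, rfl⟩ := Finset.card_eq_one.1 h
        exact ⟨a, a, by simp⟩
      · obtain ⟨a, b, -, rfl⟩ := Finset.card_eq_two.1 h
        exact ⟨a, b, subset_rfl⟩
    exact card_le_five_of_two_colors hs hc (a := a) (b := b)
      fun u hu w hw huw => by simpa using hab (hcK u hu w hw huw)
  | succ n ih =>
    by_contra! hcard
    rcases exists_spanning_or_two_colors hs hg hc S with ⟨v, hv, i, hi⟩ | ⟨a, b, hab⟩
    · have hS' : (S.erase v).card + 1 = S.card := Finset.card_erase_add_one hv
      obtain ⟨v', hv'⟩ : (S.erase v).Nonempty := Finset.card_pos.1 (by omega)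
      have hv'' := Finset.mem_erase.1 hv'
      have hiK : i ∈ K := hi v' hv''.2 hv''.1 ▸ hcK v hv v' hv''.2 hv''.1.symm
      have hK' : (K.erase i).card + 1 = K.card := Finset.card_erase_add_one hiK
      by_cases huw : ∃ u ∈ S.erase v, ∃ w ∈ S.erase v, u ≠ w ∧ c u w = i
      · obtain ⟨u, hu, w, hw, hne, huw⟩ := huw
        have hu' := Finset.mem_erase.1 hu
        have hw' := Finset.mem_erase.1 hw
        have hwR : w ∈ (S.erase v).erase u := Finset.mem_erase.2 ⟨hne.symm, hw⟩
        have h₁ := Finset.card_erase_add_one hu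
        have h₂ := Finset.card_erase_add_one hwR
        have hR : ∀ y ∈ ((S.erase v).erase u).erase w, y ≠ w ∧ y ≠ u ∧ y ≠ v ∧ y ∈ S := by
          intro y hy; simpa using hy
        have htwin : ∀ y ∈ ((S.erase v).erase u).erase w, c u y ≠ i ∧ c w y = c u y := by
          intro y hy
          obtain ⟨hyw, hyu, hyv, hyS⟩ := hR y hy
          have h₃ : c u y ≠ i := fun h =>
            hc i v u w y hu'.1.symm hyw.symm hw'.1.symm hyv.symm hne hyu.symm
              (hi w hw'.2 hw'.1) (hi y hyS hyv) huw h
          have h₄ : c w y ≠ i := fun h =>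
            hc i v w u y hw'.1.symm hyu.symm hu'.1.symm hyv.symm hne.symm hyw.symm
              (hi u hu'.2 hu'.1) (hi y hyS hyv) (hs w u ▸ huw) h
          have := hg u w y hne hyw.symm hyu.symm
          grind
        have hle := Finset.card_le_card_of_injOn (s := ((S.erase v).erase u).erase w)
          (t := K.erase i) (fun y => c u y)
          (fun y hy => by
            obtain ⟨hyw, hyu, hyv, hyS⟩ := hR y hy
            exact Finset.mem_erase.2 ⟨(htwin y hy).1, hcK u hu'.2 y hyS hyu.symm⟩)
          (fun y hy z hz hyz => by
            obtain ⟨hyw, hyu, hyv, hyS⟩ := hR y hy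
            obtain ⟨hzw, hzu, hzv, hzS⟩ := hR z hz
            by_contra hne'
            exact hc (c u y) u w y z hne hne' hyu.symm hzu.symm hyw.symm hzw.symm rfl
              hyz.symm (htwin y hy).2 ((htwin z hz).2.trans hyz.symm))
        omega
      · have := ih (K.erase i) (S.erase v) (by omega) fun u hu w hw hne =>
          Finset.mem_erase.2 ⟨fun h => huw ⟨u, hu, w, hw, hne, h⟩,
            hcK u (Finset.mem_of_mem_erase hu) w (Finset.mem_of_mem_erase hw) hne⟩
        omega
    · have := card_le_five_of_two_colors hs hc hab
      omega

/-- Two edge-disjoint pentagons on `{0, …, 4}`, extended by joining each vertex `m ≥ 5` to all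
smaller vertices in the new color `m - 3`. -/
def pentagonColor (u v : ℕ) : ℕ :=
  if 5 ≤ max u v then max u v - 3
  else if v = u + 1 ∨ u = v + 1 ∨ u + 4 = v ∨ v + 4 = u then 0 else 1

lemma pentagonColor_spec (u v : ℕ) :
    5 ≤ max u v ∧ pentagonColor u v = max u v - 3 ∨
    max u v < 5 ∧ (v = u + 1 ∨ u = v + 1 ∨ u + 4 = v ∨ v + 4 = u) ∧ pentagonColor u v = 0 ∨
    max u v < 5 ∧ ¬ (v = u + 1 ∨ u = v + 1 ∨ u + 4 = v ∨ v + 4 = u) ∧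
      pentagonColor u v = 1 := by
  unfold pentagonColor
  grind

lemma pentagonColor_comm (u v : ℕ) : pentagonColor u v = pentagonColor v u := by
  unfold pentagonColor
  grind

lemma pentagonColor_gallai (u v w : ℕ) : pentagonColor u v = pentagonColor v w ∨
    pentagonColor u v = pentagonColor u w ∨ pentagonColor v w = pentagonColor u w := by
  unfold pentagonColor
  grind

lemma pentagonColor_no_fourCycle {p q r s : ℕ} (hpr : p ≠ r) (hqs : q ≠ s) (hpq : p ≠ q)
    (hqr : q ≠ r) (hrs : r ≠ s) (hsp : s ≠ p)
    (h₁ : pentagonColor p q = pentagonColor q r) (h₂ : pentagonColor q r = pentagonColor r s)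
    (h₃ : pentagonColor r s = pentagonColor s p) : False := by
  have h₄ := pentagonColor_spec p q
  have h₅ := pentagonColor_spec q r
  have h₆ := pentagonColor_spec r s
  have h₇ := pentagonColor_spec s p
  rcases h₄ with h₄ | h₄ | h₄ <;> omega

/-- Gallai-Ramsey number of the 4-cycle: for all $k ≥ 2$, $GR_k(C_4) = k + 4$. -/
theorem gallai_ramsey_C4 (k : ℕ) (hk : 2 ≤ k) :
    IsLeast {N : ℕ | 0 < N ∧ ∀ c : Fin N → Fin N → Fin k,
        ColorSymm c → IsGallai c → ∃ i : Fin k, MonoCycle c 4 i}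
      (k + 4) := by
  constructor
  · refine ⟨by omega, fun c hs hg => ?_⟩
    by_contra h
    have : Nonempty (Fin k) := ⟨⟨0, by omega⟩⟩
    have := card_le_of_colors_mem hs hg (noFourCycle_of_not_monoCycle hs h) (k - 2)
      Finset.univ Finset.univ (by simp; omega) (by simp)
    simp at this
    omega
  · rintro N ⟨-, hN⟩
    by_contra! hlt
    have hlt' : ∀ u v : Fin N, pentagonColor u v < k := by
      intro u v
      unfold pentagonColor
      grind
    obtain ⟨i, f, hf, hi⟩ := hN (fun u v => ⟨pentagonColor u v, hlt' u v⟩)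
      (fun u v => Fin.ext (pentagonColor_comm u v))
      (fun u v w _ _ _ => by simpa using pentagonColor_gallai u v w)
    have hne : ∀ a b : Fin 4, a ≠ b → (f a : ℕ) ≠ f b :=
      fun a b hab h => hab (hf (Fin.ext h))
    have hcol : ∀ j : Fin 4, pentagonColor (f j) (f (nextFin j)) = i :=
      fun j => congrArg Fin.val (hi j)
    exact pentagonColor_no_fourCycle (hne 0 2 (by decide)) (hne 1 3 (by decide))
      (hne 0 1 (by decide)) (hne 1 2 (by decide)) (hne 2 3 (by decide)) (hne 3 0 (by decide))
      ((hcol 0).trans (hcol 1).symm) ((hcol 1).trans (hcol 2).symm)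
      ((hcol 2).trans (hcol 3).symm)
end

section
/- For all integers k ≥ 2 and n ≥ 3, the Gallai-Ramsey number of the path on 2n+1 vertices satisfies GR_k(P_{2n+1}) = (n−1)k + n + 2. -/
namespace GallaiPath

variable {V γ : Type*}

/-- A list of distinct vertices all of whose consecutive pairs have color `i`. -/
def IsPathList (c : V → V → γ) (i : γ) (l : List V) : Prop :=
  l.Nodup ∧ l.IsChain (fun u v => c u v = i)

/-- The largest number of vertices on a path of color `i`. -/
noncomputable def pathNum (c : V → V → γ) (i : γ) : ℕ :=
  sSup {m | ∃ l, IsPathList c i l ∧ l.length = m}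

section Basic

variable [Fintype V] {c : V → V → γ} {i : γ}

lemma bddAbove_pathLengths (c : V → V → γ) (i : γ) :
    BddAbove {m | ∃ l, IsPathList c i l ∧ l.length = m} := by
  refine ⟨Fintype.card V, ?_⟩
  rintro m ⟨l, hl, rfl⟩
  exact hl.1.length_le_card

lemma IsPathList.length_le {l : List V} (hl : IsPathList c i l) : l.length ≤ pathNum c i :=
  le_csSup (bddAbove_pathLengths c i) ⟨l, hl, rfl⟩

lemma exists_longest (c : V → V → γ) (i : γ) :
    ∃ l, IsPathList c i l ∧ l.length = pathNum c i :=
  Nat.sSup_mem (s := {m | ∃ l, IsPathList c i l ∧ l.length = m})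
    ⟨0, [], ⟨List.nodup_nil, List.isChain_nil⟩, rfl⟩ (bddAbove_pathLengths c i)

lemma exists_pathList_length {m : ℕ} (hm : m ≤ pathNum c i) :
    ∃ l, IsPathList c i l ∧ l.length = m := by
  obtain ⟨l, hl, h⟩ := exists_longest c i
  exact ⟨l.take m, ⟨hl.1.sublist (List.take_sublist _ _), hl.2.take m⟩, by simp; omega⟩

lemma one_le_pathNum [Nonempty V] (c : V → V → γ) (i : γ) : 1 ≤ pathNum c i :=
  IsPathList.length_le (l := [Classical.arbitrary V]) ⟨by simp, by simp⟩

lemma pathNum_le_of_imp {δ : Type*} {c' : V → V → δ} {j : δ}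
    (h : ∀ u v, u ≠ v → c u v = i → c' u v = j) : pathNum c i ≤ pathNum c' j := by
  obtain ⟨l, hl, e⟩ := exists_longest c i
  rw [← e]
  refine IsPathList.length_le ⟨hl.1, ?_⟩
  have h1 : l.IsChain (fun u v => u ≠ v) := hl.1.isChain
  rw [List.isChain_iff_getElem] at h1 ⊢
  intro k hk
  exact h _ _ (h1 k hk) (hl.2.getElem k hk)

lemma exists_edge_of_two_le {i : γ} (h : 2 ≤ pathNum c i) : ∃ u v, u ≠ v ∧ c u v = i := by
  obtain ⟨l, hl, hlen⟩ := exists_pathList_length h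
  match l, hlen with
  | [u, v], _ => exact ⟨u, v, by simpa using hl.1, by simpa using hl.2⟩

lemma longest_not_insert {l₁ l₂ : List V} (hX : IsPathList c i (l₁ ++ l₂))
    (hlen : pathNum c i ≤ (l₁ ++ l₂).length) {y : V} (hy : y ∉ l₁ ++ l₂)
    (h₁ : ∀ u ∈ l₁.getLast?, c u y = i) (h₂ : ∀ v ∈ l₂.head?, c y v = i) : False := by
  have : IsPathList c i (l₁ ++ y :: l₂) := by
    refine ⟨(List.perm_middle.nodup_iff).2 (List.nodup_cons.2 ⟨hy, hX.1⟩), ?_⟩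
    have := List.isChain_append.1 hX.2
    refine this.1.append (List.isChain_cons.2 ⟨h₂, this.2.1⟩) ?_
    intro u hu v hv
    simp only [List.head?_cons, Option.mem_def, Option.some.injEq] at hv
    exact hv ▸ h₁ u hu
  have := this.length_le
  simp at this hlen
  omega

end Basic

/-- `Linked c i u w s`: some path of color `i` from `u` to `w` has vertex set `s`. -/
inductive Linked [DecidableEq V] (c : V → V → γ) (i : γ) : V → V → Finset V → Prop
  | single (v : V) : Linked c i v v {v}
  | cons {u v w : V} {s : Finset V} :
      c u v = i → u ∉ s → Linked c i v w s → Linked c i u w (insert u s)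

namespace Linked

variable [DecidableEq V] {c : V → V → γ} {i : γ}

lemma join {a b d e : V} {s t : Finset V} (h₁ : Linked c i a b s) (h₂ : Linked c i d e t)
    (hbd : c b d = i) (hst : Disjoint s t) : Linked c i a e (s ∪ t) := by
  induction h₁ with
  | single v => exact .cons hbd (by simpa using hst) h₂
  | @cons u v w s huv hu _ ih =>
    rw [Finset.disjoint_insert_left] at hst
    rw [Finset.insert_union]
    exact .cons huv (by simp [hu, hst.1]) (ih hbd hst.2)

lemma symm (hc : ColorSymm c) {a b : V} {s : Finset V} (h : Linked c i a b s) :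
    Linked c i b a s := by
  induction h with
  | single v => exact .single v
  | @cons u v w s huv hu _ ih =>
    have := ih.join (.single u) (by rw [hc, huv]) (by simpa using hu)
    rwa [Finset.union_comm, ← Finset.insert_eq] at this

lemma exists_list {a b : V} {s : Finset V} (h : Linked c i a b s) :
    ∃ l, IsPathList c i (a :: l) ∧ (a :: l).toFinset = s := by
  induction h with
  | single v => exact ⟨[], ⟨by simp, by simp⟩, by simp⟩
  | @cons u v w s huv hu _ ih =>
    obtain ⟨l, hl, rfl⟩ := ih
    refine ⟨v :: l, ⟨List.nodup_cons.2 ⟨by simpa using hu, hl.1⟩, ?_⟩, by simp⟩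
    exact List.isChain_cons_cons.2 ⟨huv, hl.2⟩

lemma card_le [Fintype V] {a b : V} {s : Finset V} (h : Linked c i a b s) :
    s.card ≤ pathNum c i := by
  obtain ⟨l, hl, rfl⟩ := h.exists_list
  rw [List.toFinset_card_of_nodup hl.1]
  exact hl.length_le

lemma of_list {a : V} {l : List V} (h : IsPathList c i (a :: l)) :
    ∃ b, Linked c i a b (a :: l).toFinset := by
  induction l generalizing a with
  | nil => exact ⟨a, by simpa using Linked.single a⟩
  | cons x l ih =>
    obtain ⟨h₁, h₂⟩ := h
    rw [List.nodup_cons] at h₁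
    rw [List.isChain_cons_cons] at h₂
    obtain ⟨b, hb⟩ := ih ⟨h₁.2, h₂.2⟩
    refine ⟨b, ?_⟩
    rw [List.toFinset_cons]
    exact .cons h₂.1 (by rw [List.mem_toFinset]; exact h₁.1) hb

end Linked

section Attach

variable [DecidableEq V] {c : V → V → γ} {i : γ}

/-- A path of color `i` starting in `M` absorbs every vertex joined to `M` in color `i`,
as long as `M` has enough vertices left over. -/
lemma Linked.absorb {M R s : Finset V} {a b : V} (hc : ColorSymm c)
    (hMR : ∀ r ∈ R, r ∉ M ∧ ∀ m ∈ M, c r m = i) (h : Linked c i a b s) (ha : a ∈ M)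
    (hRs : Disjoint R s) (hcard : R.card ≤ (M \ s).card) :
    ∃ a' t, Linked c i a' b t ∧ t.card = s.card + 2 * R.card := by
  induction R using Finset.induction_on generalizing a s with
  | empty => exact ⟨a, s, h, by simp⟩
  | @insert r R hr ih =>
    rw [Finset.card_insert_of_notMem hr] at hcard
    rw [Finset.disjoint_insert_left] at hRs
    have hr' := hMR r (by simp)
    obtain ⟨m, hm⟩ : (M \ s).Nonempty := Finset.card_pos.1 (by omega)
    have hm' := Finset.mem_sdiff.1 hm
    have hmr : m ≠ r := fun e => hr'.1 (e ▸ hm'.1)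
    have h' : Linked c i m b (insert m (insert r s)) :=
      .cons (by rw [hc]; exact hr'.2 m hm'.1) (by simp [hmr, hm'.2])
        (.cons (hr'.2 a ha) hRs.1 h)
    have hd : M \ insert m (insert r s) = (M \ s).erase m := by
      ext x
      simp only [Finset.mem_sdiff, Finset.mem_insert, Finset.mem_erase]
      have : x ∈ M → x ≠ r := fun h e => hr'.1 (e ▸ h)
      tauto
    obtain ⟨a', t, ht, hcd⟩ := ih (fun x hx => hMR x (by simp [hx])) h' hm'.1
      (by
        rw [Finset.disjoint_insert_right, Finset.disjoint_insert_right]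
        exact ⟨fun hmR => (hMR m (by simp [hmR])).1 hm'.1, hr, hRs.2⟩)
      (by rw [hd, Finset.card_erase_of_mem hm]; omega)
    refine ⟨a', t, ht, ?_⟩
    rw [hcd, Finset.card_insert_of_notMem (by simp [hmr, hm'.2]),
      Finset.card_insert_of_notMem hRs.1, Finset.card_insert_of_notMem hr]
    omega

lemma pathNum_ge_of_attached [Fintype V] {M R : Finset V} (hc : ColorSymm c)
    (hMR : ∀ r ∈ R, r ∉ M ∧ ∀ m ∈ M, c r m = i) {l : List V} (hl : IsPathList c i l)
    (hne : l ≠ []) (hlM : ∀ x ∈ l, x ∈ M) (hcard : l.length + R.card ≤ M.card) :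
    l.length + 2 * R.card ≤ pathNum c i := by
  obtain ⟨a, l, rfl⟩ := List.exists_cons_of_ne_nil hne
  obtain ⟨b, hb⟩ := Linked.of_list hl
  have hsub : (a :: l).toFinset ⊆ M := fun x hx => hlM x (by simpa using hx)
  have hlen := List.toFinset_card_of_nodup hl.1
  obtain ⟨a', t, ht, hcd⟩ := hb.absorb hc hMR (hlM a (by simp))
    (Finset.disjoint_left.2 fun x hx hx' => (hMR x hx).1 (hsub hx'))
    (by rw [Finset.card_sdiff_of_subset hsub, hlen]; omega)
  rw [← hlen, ← hcd]
  exact ht.card_le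

lemma pathNum_ge_of_card_lt [Fintype V] {M R : Finset V} (hc : ColorSymm c)
    (hMR : ∀ r ∈ R, r ∉ M ∧ ∀ m ∈ M, c r m = i) (hcard : R.card < M.card) :
    2 * R.card + 1 ≤ pathNum c i := by
  obtain ⟨m, hm⟩ : M.Nonempty := Finset.card_pos.1 (by omega)
  have := pathNum_ge_of_attached hc hMR (l := [m]) ⟨by simp, by simp⟩ (by simp)
    (by simpa using hm) (by simp; omega)
  simp at this
  omega

end Attach

section TwoColor

lemma two_of_three {p p' q q' r r' : Prop} (hp : p ∨ p') (hq : q ∨ q') (hr : r ∨ r') :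
    (p ∧ q ∨ p ∧ r ∨ q ∧ r) ∨ (p' ∧ q' ∨ p' ∧ r' ∨ q' ∧ r') := by
  tauto

variable [DecidableEq V] {c : V → V → γ} {b : γ}

lemma Linked.bridge {e f g h z : V} {s u : Finset V} (hc : ColorSymm c)
    (h₁ : Linked c b e f s) (h₂ : Linked c b g h u) (hsu : Disjoint s u)
    (hf : c f z = b) (hg : c g z = b) (hzs : z ∉ s) (hzu : z ∉ u) :
    Linked c b e h (s ∪ insert z u) :=
  h₁.join (.cons (by rw [hc, hg]) hzu h₂) hf
    (Finset.disjoint_insert_right.2 ⟨hzs, hsu⟩)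

lemma exists_two_linked (hc : ColorSymm c) (t : ℕ) : ∀ (Z : List V) (W : Finset V),
    Z.Nodup → (∀ z ∈ Z, z ∉ W) →
    Z.IsChain (fun a a' => ∀ y ∈ W, c y a = b ∨ c y a' = b) →
    2 * t ≤ Z.length → W.card = t + 2 →
    ∃ e ∈ W, ∃ f ∈ W, ∃ g ∈ W, ∃ h ∈ W, ∃ s u, Linked c b e f s ∧ Linked c b g h u ∧
      Disjoint s u ∧ s ∪ u ⊆ W ∪ Z.toFinset ∧ s.card + u.card = 2 * t + 2 := by
  induction t with
  | zero =>
    intro Z W _ _ _ _ hW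
    obtain ⟨x, y, hxy, rfl⟩ := Finset.card_eq_two.1 hW
    refine ⟨x, by simp, x, by simp, y, by simp, y, by simp, {x}, {y}, .single x, .single y,
      by simpa using hxy, ?_, by simp⟩
    intro z hz
    simp at hz ⊢
    tauto
  | succ t ih =>
    intro Z W hZ hZW hch hlen hW
    match Z, hlen with
    | [], h => simp at h
    | [_], h => simp at h; omega
    | a :: a' :: Z, hlen =>
    obtain ⟨w, hw⟩ : W.Nonempty := Finset.card_pos.1 (by omega)
    rw [List.isChain_cons_cons] at hch
    rw [List.nodup_cons, List.nodup_cons] at hZ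
    obtain ⟨e, he, f, hf, g, hg, h, hh, s, u, hs, hu, hsu, hsub, hcd⟩ :=
      ih Z (W.erase w) hZ.2.2 (fun z hz hz' => hZW z (by simp [hz]) (Finset.mem_of_mem_erase hz'))
        (hch.2.tail.imp fun x y hxy v hv => hxy v (Finset.mem_of_mem_erase hv))
        (by simp at hlen; omega) (by rw [Finset.card_erase_of_mem hw, hW]; rfl)
    have hW' : ∀ x ∈ W.erase w, x ∈ W := fun x hx => Finset.mem_of_mem_erase hx
    have hsub' : s ∪ u ⊆ W ∪ (a :: a' :: Z).toFinset :=
      hsub.trans (Finset.union_subset_union (Finset.erase_subset _ _) fun x hx => by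
        rw [List.mem_toFinset] at hx ⊢
        simp [hx])
    obtain ⟨hs', hu'⟩ := Finset.union_subset_iff.1 hsub'
    have hwZ : w ∉ a :: a' :: Z := fun h => hZW w h hw
    have hwsu : w ∉ s ∪ u := by
      intro hz
      have := hsub hz
      rw [Finset.mem_union, List.mem_toFinset] at this
      rcases this with h | h
      · exact Finset.notMem_erase w W h
      · exact hwZ (by simp [h])
    have hnot : ∀ z, (z = a ∨ z = a') → z ∉ s ∪ u ∧ z ≠ w := by
      intro z hz
      have h₁ : z ∈ a :: a' :: Z := by rcases hz with rfl | rfl <;> simp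
      refine ⟨fun h₂ => ?_, fun h₂ => hZW z h₁ (h₂ ▸ hw)⟩
      have h₃ := hsub h₂
      rw [Finset.mem_union, List.mem_toFinset] at h₃
      rcases h₃ with h₃ | h₃
      · exact hZW z h₁ (hW' z h₃)
      · have h₄ := hZ.1
        have h₅ := hZ.2.1
        simp at h₄
        rcases hz with rfl | rfl
        · exact h₄.2 h₃
        · exact h₅ h₃
    obtain ⟨z, hz, hzz⟩ : ∃ z, (z = a ∨ z = a') ∧
        ((c e z = b ∧ c g z = b) ∨ (c e z = b ∧ c w z = b) ∨ (c g z = b ∧ c w z = b)) := by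
      have h₁ := hch.1 e (hW' e he)
      have h₂ := hch.1 g (hW' g hg)
      have h₃ := hch.1 w hw
      rcases two_of_three h₁ h₂ h₃ with h | h
      · exact ⟨a, .inl rfl, h⟩
      · exact ⟨a', .inr rfl, h⟩
    have hzW : z ∈ W ∪ (a :: a' :: Z).toFinset := by
      rcases hz with rfl | rfl <;> simp
    have hwW : w ∈ W ∪ (a :: a' :: Z).toFinset := by simp [hw]
    obtain ⟨hzn, hzw⟩ := hnot z hz
    rw [Finset.mem_union, not_or] at hzn hwsu
    rcases hzz with ⟨k₁, k₂⟩ | ⟨k₁, k₂⟩ | ⟨k₁, k₂⟩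
    · refine ⟨f, hW' f hf, h, hW' h hh, w, hw, w, hw, s ∪ insert z u, {w},
        (hs.symm hc).bridge hc hu hsu k₁ k₂ hzn.1 hzn.2, .single w, ?_, ?_, ?_⟩
      · simp [hwsu.1, hwsu.2, hzw.symm]
      · exact Finset.union_subset (Finset.union_subset hs' (Finset.insert_subset hzW hu'))
          (Finset.singleton_subset_iff.2 hwW)
      · rw [Finset.card_union_of_disjoint (Finset.disjoint_insert_right.2 ⟨hzn.1, hsu⟩),
          Finset.card_insert_of_notMem hzn.2, Finset.card_singleton]
        omega
    · refine ⟨f, hW' f hf, w, hw, g, hW' g hg, h, hW' h hh, s ∪ insert z {w}, u,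
        (hs.symm hc).bridge hc (.single w) (by simpa using hwsu.1) k₁ k₂ hzn.1 (by simpa using hzw),
        hu, ?_, ?_, ?_⟩
      · simp [hwsu.2, hzn.2, hsu]
      · exact Finset.union_subset (Finset.union_subset hs'
          (Finset.insert_subset hzW (Finset.singleton_subset_iff.2 hwW))) hu'
      · rw [Finset.card_union_of_disjoint (by simp [hzn.1, hwsu.1]),
          Finset.card_insert_of_notMem (by simpa using hzw), Finset.card_singleton]
        omega
    · refine ⟨e, hW' e he, f, hW' f hf, h, hW' h hh, w, hw, s, u ∪ insert z {w}, hs,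
        (hu.symm hc).bridge hc (.single w) (by simpa using hwsu.2) k₁ k₂ hzn.2 (by simpa using hzw),
        ?_, ?_, ?_⟩
      · simp [hwsu.1, hzn.1, hsu]
      · exact Finset.union_subset hs' (Finset.union_subset hu'
          (Finset.insert_subset hzW (Finset.singleton_subset_iff.2 hwW)))
      · rw [Finset.card_union_of_disjoint (by simp [hzn.2, hwsu.2]) (s := u),
          Finset.card_insert_of_notMem (by simpa using hzw), Finset.card_singleton]
        omega

variable [Fintype V]

lemma pathNum_ge_even (hc : ColorSymm c) {t : ℕ} {x x' : V} {Z : List V} {W : Finset V}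
    (hnd : (x :: x' :: Z).Nodup) (hZW : ∀ z ∈ x :: x' :: Z, z ∉ W)
    (hch : Z.IsChain (fun a a' => ∀ y ∈ W, c y a = b ∨ c y a' = b))
    (hx : ∀ y ∈ W, c y x = b) (hx' : ∀ y ∈ W, c y x' = b)
    (hlen : 2 * t ≤ Z.length) (hW : W.card = t + 2) : 2 * (t + 2) ≤ pathNum c b := by
  simp only [List.nodup_cons, List.mem_cons, not_or] at hnd
  obtain ⟨e, he, f, hf, g, hg, h, hh, s, u, hs, hu, hsu, hsub, hcd⟩ :=
    exists_two_linked hc t Z W hnd.2.2 (fun z hz => hZW z (by simp [hz])) hch hlen hW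
  have hnot : ∀ z ∈ W ∪ Z.toFinset, z ≠ x ∧ z ≠ x' := by
    intro z hz
    rw [Finset.mem_union, List.mem_toFinset] at hz
    have h₁ := hZW x (by simp)
    have h₂ := hZW x' (by simp)
    constructor <;> rintro rfl <;> tauto
  have hxn : x ∉ s ∪ u := fun h => (hnot x (hsub h)).1 rfl
  have hxn' : x' ∉ s ∪ u := fun h => (hnot x' (hsub h)).2 rfl
  rw [Finset.mem_union, not_or] at hxn hxn'
  have := (Linked.cons (hc x' e ▸ hx' e he) (by simp [hxn', Ne.symm hnd.1.1])
    (hs.bridge hc hu hsu (hx f hf) (hx g hg) hxn.1 hxn.2)).card_le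
  rw [Finset.card_insert_of_notMem (by simp [hxn', Ne.symm hnd.1.1]),
    Finset.card_union_of_disjoint (Finset.disjoint_insert_right.2 ⟨hxn.1, hsu⟩),
    Finset.card_insert_of_notMem hxn.2] at this
  omega

lemma pathNum_ge_odd (hc : ColorSymm c) {t : ℕ} {x x' a a' : V} {Z : List V} {W : Finset V}
    (hnd : (x :: x' :: a :: a' :: Z).Nodup) (hZW : ∀ z ∈ x :: x' :: a :: a' :: Z, z ∉ W)
    (hch : Z.IsChain (fun a a' => ∀ y ∈ W, c y a = b ∨ c y a' = b))
    (haa : ∀ y ∈ W, c y a = b ∨ c y a' = b)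
    (hx : ∀ y ∈ W, c y x = b) (hx' : ∀ y ∈ W, c y x' = b)
    (hlen : 2 * t ≤ Z.length) (hW : W.card = t + 2) : 2 * (t + 2) + 1 ≤ pathNum c b := by
  have hZ : Z.Nodup := by
    simp only [List.nodup_cons] at hnd
    exact hnd.2.2.2.2
  obtain ⟨e, he, f, hf, g, hg, h, hh, s, u, hs, hu, hsu, hsub, hcd⟩ :=
    exists_two_linked hc t Z W hZ (fun z hz => hZW z (by simp [hz])) hch hlen hW
  have hnot : ∀ z ∈ [x, x', a, a'], z ∉ s ∧ z ∉ u := by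
    intro z hz
    rw [← not_or, ← Finset.mem_union]
    intro hz'
    have h₁ := hsub hz'
    rw [Finset.mem_union, List.mem_toFinset] at h₁
    rcases h₁ with h₁ | h₁
    · refine hZW z ?_ h₁
      simp at hz ⊢
      tauto
    · have : ([x, x', a, a'] ++ Z).Nodup := hnd
      exact (List.nodup_append'.1 this).2.2 hz h₁
  -- two paths whose adjacent ends share a neighbour `z`, closed up by `p` and `p'`
  have key : ∀ {e f g h : V} {s u : Finset V}, Linked c b e f s → Linked c b g h u →
      Disjoint s u → s.card + u.card = 2 * t + 2 → ∀ {p z p' : V}, [p, z, p'].Nodup →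
      (∀ y ∈ [p, z, p'], y ∉ s ∧ y ∉ u) → c e p = b → c f z = b → c g z = b → c h p' = b →
      2 * (t + 2) + 1 ≤ pathNum c b := by
    intro e f g h s u hs hu hsu hcd p z p' hn hns h₁ h₂ h₃ h₄
    simp only [List.nodup_cons, List.mem_cons, not_or, List.not_mem_nil, not_false_eq_true,
      and_true, List.nodup_nil] at hn
    simp only [List.mem_cons, List.not_mem_nil, or_false, forall_eq_or_imp, forall_eq] at hns
    have hlink := (Linked.cons (hc p' h ▸ h₄) (by
      simp [hns.2.2.1, hns.2.2.2, Ne.symm hn.2])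
      ((hs.bridge hc hu hsu h₂ h₃ hns.2.1.1 hns.2.1.2).symm hc)).symm hc
    have := (Linked.cons (hc p e ▸ h₁) (by simp [hns.1.1, hns.1.2, hn.1.1, hn.1.2]) hlink).card_le
    rw [Finset.card_insert_of_notMem (by simp [hns.1.1, hns.1.2, hn.1.1, hn.1.2]),
      Finset.card_insert_of_notMem (by simp [hns.2.2.1, hns.2.2.2, Ne.symm hn.2]),
      Finset.card_union_of_disjoint (Finset.disjoint_insert_right.2 ⟨hns.2.1.1, hsu⟩),
      Finset.card_insert_of_notMem hns.2.1.2] at this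
    omega
  have hnd' : [x, x', a, a'].Nodup := by
    have : ([x, x', a, a'] ++ Z).Nodup := hnd
    exact this.of_append_left
  have hN : [x, a, x'].Nodup ∧ [x, a', x'].Nodup ∧ [a, x, a'].Nodup ∧ [a', x, a].Nodup := by
    clear * - hnd'
    grind
  have hn : ∀ p z p', p ∈ [x, x', a, a'] → z ∈ [x, x', a, a'] → p' ∈ [x, x', a, a'] →
      ∀ y ∈ [p, z, p'], y ∉ s ∧ y ∉ u := by
    intro p z p' h₁ h₂ h₃ y hy
    simp only [List.mem_cons, List.not_mem_nil, or_false] at hy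
    rcases hy with rfl | rfl | rfl <;> exact hnot _ ‹_›
  by_cases hea : c e a = b ∧ c h a = b
  · exact key (hs.symm hc) (hu.symm hc) hsu hcd (p := x) (z := a) (p' := x') hN.1
      (hn _ _ _ (by simp) (by simp) (by simp)) (hx f hf) hea.1 hea.2 (hx' g hg)
  by_cases hea' : c e a' = b ∧ c h a' = b
  · exact key (hs.symm hc) (hu.symm hc) hsu hcd (p := x) (z := a') (p' := x') hN.2.1
      (hn _ _ _ (by simp) (by simp) (by simp)) (hx f hf) hea'.1 hea'.2 (hx' g hg)
  rcases haa e he with k | k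
  · exact key hs hu hsu hcd (p := a) (z := x) (p' := a') hN.2.2.1
      (hn _ _ _ (by simp) (by simp) (by simp)) k (hx f hf) (hx g hg)
      ((haa h hh).resolve_left fun k' => hea ⟨k, k'⟩)
  · exact key hs hu hsu hcd (p := a') (z := x) (p' := a) hN.2.2.2
      (hn _ _ _ (by simp) (by simp) (by simp)) k (hx f hf) (hx g hg)
      ((haa h hh).resolve_right fun k' => hea' ⟨k, k'⟩)

end TwoColor

section TwoColorBound

variable [DecidableEq V] [Fintype V] {c : V → V → γ}

lemma pathNum_ge_of_alternating {b : γ} (hc : ColorSymm c) {x x' : V} {Z : List V}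
    {W : Finset V} (hnd : (x :: (Z ++ [x'])).Nodup) (hW : ∀ z ∈ x :: (Z ++ [x']), z ∉ W)
    (hch : Z.IsChain (fun a a' => ∀ y ∈ W, c y a = b ∨ c y a' = b))
    (hx : ∀ y ∈ W, c y x = b) (hx' : ∀ y ∈ W, c y x' = b) (hne : W.Nonempty) :
    (2 * W.card ≤ Z.length + 2 → 2 * W.card + 1 ≤ pathNum c b) ∧
      (2 * W.card ≤ Z.length + 3 → 2 * W.card ≤ pathNum c b) := by
  have hperm : (x :: (Z ++ [x'])).Perm (x :: x' :: Z) :=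
    (List.perm_append_singleton x' Z).cons x
  have hnd' := hperm.nodup_iff.1 hnd
  have hW' : ∀ z ∈ x :: x' :: Z, z ∉ W := fun z hz => hW z (hperm.mem_iff.2 hz)
  obtain ht | ⟨t, ht⟩ : W.card = 1 ∨ ∃ t, W.card = t + 2 := by
    have := hne.card_pos
    rcases Nat.lt_or_ge W.card 2 with h | h
    · left; omega
    · exact .inr ⟨W.card - 2, by omega⟩
  · obtain ⟨y, rfl⟩ := Finset.card_eq_one.1 ht
    simp only [Finset.mem_singleton, forall_eq] at hx hx'
    have h₁ := hW' x (by simp)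
    have h₂ := hW' x' (by simp)
    simp only [Finset.mem_singleton] at h₁ h₂
    simp only [List.nodup_cons, List.mem_cons, not_or] at hnd'
    have := IsPathList.length_le (c := c) (i := b) (l := [x, y, x'])
      ⟨by simp [h₁, Ne.symm h₂, hnd'.1.1], by simp [hc x y, hx, hx']⟩
    simp at this ⊢
    omega
  · rw [ht]
    constructor
    · intro hlen
      match Z, hlen with
      | [], h => simp at h
      | [_], h => simp at h; omega
      | a :: a' :: Z, hlen =>
        rw [List.isChain_cons_cons] at hch
        exact pathNum_ge_odd hc hnd' hW' hch.2.tail hch.1 hx hx' (by simp at hlen; omega) ht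
    · intro hlen
      exact pathNum_ge_even hc hnd' hW' hch hx hx' (by omega) ht

/-- The Gerencsér–Gyárfás bound. -/
lemma bound_of_two_colors [Nonempty V] (hc : ColorSymm c) {r : γ}
    (hmax : ∀ i, pathNum c i ≤ pathNum c r)
    (htwo : ∀ b, b ≠ r → (∃ u v, u ≠ v ∧ c u v = b) → ∀ u v, u ≠ v → c u v = r ∨ c u v = b) :
    Fintype.card V ≤ pathNum c r ∨
      ∃ b, b ≠ r ∧ Fintype.card V ≤ pathNum c r + (pathNum c b - 1) / 2 := by
  obtain ⟨X, hX, hlen⟩ := exists_longest c r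
  have hpos := one_le_pathNum c r
  obtain ⟨x, X, rfl⟩ := List.exists_cons_of_ne_nil (l := X) (by rintro rfl; simp at hlen; omega)
  set Y : Finset V := Finset.univ \ (x :: X).toFinset with hY
  have hYcard : Y.card + pathNum c r = Fintype.card V := by
    rw [← hlen, ← List.toFinset_card_of_nodup hX.1, hY,
      Finset.card_sdiff_add_card_eq_card (Finset.subset_univ _), Finset.card_univ]
  have hYmem : ∀ y, y ∈ Y ↔ y ∉ x :: X := by simp [hY]
  rcases Y.eq_empty_or_nonempty with h0 | ⟨y₀, hy₀⟩
  · left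
    rw [h0] at hYcard
    simp at hYcard
    omega
  right
  have hins : ∀ l₁ l₂ y, x :: X = l₁ ++ l₂ → y ∈ Y → (∀ u ∈ l₁.getLast?, c u y = r) →
      ¬ ∀ v ∈ l₂.head?, c y v = r := by
    intro l₁ l₂ y e hy h₁ h₂
    rw [hYmem] at hy
    rw [e] at hX hlen hy
    exact longest_not_insert hX hlen.ge hy h₁ h₂
  have hxr : ∀ y ∈ Y, c y x ≠ r := fun y hy h => hins [] _ y rfl hy (by simp) (by simpa using h)
  have hne : ∀ y ∈ Y, ∀ z ∈ x :: X, y ≠ z := fun y hy z hz e => (hYmem y).1 hy (e ▸ hz)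
  refine ⟨c y₀ x, hxr y₀ hy₀, ?_⟩
  have hcol := htwo _ (hxr y₀ hy₀) ⟨y₀, x, hne y₀ hy₀ x (by simp), rfl⟩
  generalize c y₀ x = b at hcol
  have hxb : ∀ y ∈ Y, c y x = b := fun y hy =>
    (hcol y x (hne y hy x (by simp))).resolve_left (hxr y hy)
  have hch : (x :: X).IsChain (fun a a' => ∀ y ∈ Y, c y a = b ∨ c y a' = b) := by
    rw [List.isChain_iff_forall_rel_of_append_cons_cons]
    intro a a' l₁ l₂ e y hy
    by_contra! hno
    have ha := (hcol y a (hne y hy a (by simp [e]))).resolve_right hno.1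
    have ha' := (hcol y a' (hne y hy a' (by simp [e]))).resolve_right hno.2
    exact hins (l₁ ++ [a]) (a' :: l₂) y (by simp [e]) hy (by simpa [hc a y] using ha)
      (by simpa using ha')
  have key : ∀ q, 1 ≤ q → q ≤ Y.card →
      (2 * q ≤ pathNum c r → 2 * q + 1 ≤ pathNum c b) ∧
      (2 * q ≤ pathNum c r + 1 → 2 * q ≤ pathNum c b) := by
    intro q hq hqY
    obtain ⟨W, hWY, rfl⟩ := Finset.exists_subset_card_eq hqY
    have hWne : W.Nonempty := Finset.card_pos.1 hq
    rcases List.eq_nil_or_concat' X with rfl | ⟨Z, x', rfl⟩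
    · obtain ⟨y, hy⟩ := hWne
      have := IsPathList.length_le (c := c) (i := b) (l := [x, y])
        ⟨by simpa using (hne y (hWY hy) x (by simp)).symm, by simpa [hc x y] using hxb y (hWY hy)⟩
      simp at this hlen
      omega
    · have hx'b : ∀ y ∈ Y, c y x' = b := fun y hy =>
        (hcol y x' (hne y hy x' (by simp))).resolve_left fun h =>
          hins (x :: (Z ++ [x'])) [] y (by simp) hy
            (by
              have : (x :: (Z ++ [x'])).getLast? = some x' := by
                rw [← List.cons_append, List.getLast?_append]; simp
              simpa [this, hc x' y] using h) (by simp)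
      have := pathNum_ge_of_alternating hc hX.1
        (fun z hz hzW => (hYmem z).1 (hWY hzW) hz)
        (hch.tail.left_of_append.imp fun a a' h y hy => h y (hWY hy))
        (fun y hy => hxb y (hWY hy)) (fun y hy => hx'b y (hWY hy)) hWne
      simp at hlen
      rw [← hlen]
      exact this
  have hb := hmax b
  have hYpos : 1 ≤ Y.card := Finset.card_pos.2 ⟨y₀, hy₀⟩
  have hq : Y.card ≤ (pathNum c r - 1) / 2 := by
    by_contra! hq
    obtain ⟨h₁, h₂⟩ := key ((pathNum c r + 1) / 2) (by omega) (by omega)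
    omega
  have := (key Y.card hYpos le_rfl).1 (by omega)
  omega

end TwoColorBound

section Recolor

lemma countP_of_separated (p : V → Bool) : ∀ l : List V,
    (∀ l₁ l₂, l = l₁ ++ l₂ → (∀ u ∈ l₁.getLast?, p u) → l₁ ≠ [] → ¬ ∀ v ∈ l₂.head?, p v) →
    2 * l.countP p ≤ l.length ∧ ((∃ v ∈ l.head?, ¬ p v) → 2 * l.countP p + 1 ≤ l.length) := by
  intro l
  induction l with
  | nil => intro _; simp
  | cons a l ih =>
    intro h
    have ih' := ih fun l₁ l₂ e h₁ hne => h (a :: l₁) l₂ (by simp [e])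
      (by
        obtain ⟨x, l₁, rfl⟩ := List.exists_cons_of_ne_nil hne
        simpa [List.getLast?_cons_cons] using h₁) (by simp)
    by_cases ha : p a
    · have h₁ := h [a] l rfl (by simpa using ha) (by simp)
      push Not at h₁
      have h₂ := ih'.2 (by simpa using h₁)
      rw [List.countP_cons_of_pos ha, List.length_cons]
      refine ⟨by omega, ?_⟩
      rintro ⟨v, hv, hv'⟩
      simp only [List.head?_cons, Option.mem_def, Option.some.injEq] at hv
      exact absurd ha (hv ▸ hv')
    · rw [List.countP_cons_of_neg ha, List.length_cons]
      omega

variable [DecidableEq V] {c : V → V → γ} {i : γ}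

/-- Every vertex outside `M` sees all of `M` in a single color. -/
def IsModule (c : V → V → γ) (M : Finset V) : Prop :=
  ∀ v, v ∉ M → ∀ x ∈ M, ∀ y ∈ M, c v x = c v y

/-- Give all pairs inside `M` the color `i`. -/
def recolor (c : V → V → γ) (M : Finset V) (i : γ) (u v : V) : γ :=
  if u ∈ M ∧ v ∈ M then i else c u v

lemma recolor_symm (hc : ColorSymm c) (M : Finset V) (i : γ) : ColorSymm (recolor c M i) := by
  intro u v
  simp only [recolor, and_comm, hc u v]

lemma recolor_isGallai (hc : ColorSymm c) (hG : IsGallai c) {M : Finset V}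
    (hM : IsModule c M) (i : γ) : IsGallai (recolor c M i) := by
  intro u v w huv hvw huw
  have h₀ := hG u v w huv hvw huw
  by_cases hu : u ∈ M <;> by_cases hv : v ∈ M <;> by_cases hw : w ∈ M <;>
    simp only [recolor, hu, hv, hw, and_self, and_true, and_false, if_true, if_false, true_or]
  · right; right
    rw [hc v w, hc u w]; exact hM w hw v hv u hu
  · left
    rw [hc u v]; exact hM v hv u hu w hw
  · exact h₀
  · right; left; exact hM u hu v hv w hw
  · exact h₀
  · exact h₀
  · exact h₀

lemma collapse {M : Finset V} (hM : IsModule c M) : ∀ (l : List V) (x : V),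
    IsPathList (recolor c M i) i (x :: l) →
    ∃ l' x', IsPathList c i (x' :: l') ∧ x' :: l' ⊆ x :: l ∧ (x' = x ∨ x ∈ M ∧ x' ∈ M) ∧
      (∀ z ∈ x :: l, z ∉ x' :: l' → z ∈ M) ∧
      ((∃ z ∈ x :: l, z ∈ M) → ∃ z ∈ x' :: l', z ∈ M) := by
  intro l
  induction l with
  | nil =>
    intro x _
    exact ⟨[], x, ⟨by simp, by simp⟩, by simp, .inl rfl, fun z h h' => absurd h h', id⟩
  | cons y l ih =>
    intro x hx
    have hnd := List.nodup_cons.1 hx.1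
    have hch := List.isChain_cons_cons.1 hx.2
    obtain ⟨l', y', hp, hsub, hy, hrest, hex⟩ := ih y ⟨hnd.2, hch.2⟩
    by_cases hboth : x ∈ M ∧ y ∈ M
    · have hy'M : y' ∈ M := by rcases hy with rfl | h; exacts [hboth.2, h.2]
      refine ⟨l', y', hp, fun z hz => List.mem_cons_of_mem _ (hsub hz), .inr ⟨hboth.1, hy'M⟩,
        fun z hz hz' => ?_, fun _ => ⟨y', by simp, hy'M⟩⟩
      rcases List.mem_cons.1 hz with rfl | hz
      · exact hboth.1
      · exact hrest z hz hz'
    · have hxy : c x y = i := by simpa [recolor, hboth] using hch.1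
      have hxy' : c x y' = i := by
        rcases hy with rfl | h
        · exact hxy
        · rw [← hxy]
          exact hM x (fun hx => hboth ⟨hx, h.1⟩) _ h.2 _ h.1
      refine ⟨y' :: l', x, ⟨List.nodup_cons.2 ⟨fun h => hnd.1 (hsub h), hp.1⟩,
        List.isChain_cons_cons.2 ⟨hxy', hp.2⟩⟩, List.cons_subset_cons _ hsub, .inl rfl,
        fun z hz hz' => ?_, ?_⟩
      · rcases List.mem_cons.1 hz with rfl | hz
        · exact absurd (by simp) hz'
        · exact hrest z hz fun h => hz' (List.mem_cons_of_mem _ h)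
      · rintro ⟨z, hz, hzM⟩
        rcases List.mem_cons.1 hz with rfl | hz
        · exact ⟨z, by simp, hzM⟩
        · obtain ⟨z', hz', h⟩ := hex ⟨z, hz, hzM⟩
          exact ⟨z', List.mem_cons_of_mem _ hz', h⟩

lemma two_mul_card_lt_of_separated {R : Finset V} {l : List V} (hR : ∀ r ∈ R, r ∈ l)
    (h : ∀ l₁ l₂, l = l₁ ++ l₂ → (∀ u ∈ l₁.getLast?, u ∈ R) → ¬ ∀ v ∈ l₂.head?, v ∈ R) :
    2 * R.card + 1 ≤ l.length := by
  have h₁ := (countP_of_separated (fun v => decide (v ∈ R)) l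
    (fun l₁ l₂ e h₁ _ => by simpa using h l₁ l₂ e (by simpa using h₁))).2
    (by simpa using h [] l rfl (by simp))
  have h₂ : R.card ≤ l.countP (fun v => decide (v ∈ R)) := by
    rw [List.countP_eq_length_filter]
    refine le_trans (Finset.card_le_card fun r hr => ?_) (List.toFinset_card_le _)
    simp [hR r hr, hr]
  omega

variable [Fintype V]

lemma pathNum_ge_of_spare {M R : Finset V} (hc : ColorSymm c) (hM : IsModule c M)
    (hR : ∀ r ∈ R, r ∉ M ∧ ∀ m ∈ M, c r m = i) (D : Finset V) : ∀ l : List V,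
    IsPathList c i l → (∀ d ∈ D, d ∈ M ∧ d ∉ l) → (∃ m ∈ l, m ∈ M) →
    pathNum c i < l.length + D.card → 2 * R.card + 1 ≤ pathNum c i := by
  induction D using Finset.induction_on with
  | empty =>
    intro l hl _ _ h
    have := hl.length_le
    simp at h
    omega
  | @insert d D hd ih =>
    intro l hl hD hm hlt
    rw [Finset.card_insert_of_notMem hd] at hlt
    have hdM := hD d (by simp)
    have hD' : ∀ e ∈ D, e ∈ M ∧ e ∉ l := fun e he => hD e (by simp [he])
    have hRc : ∀ r ∈ R, ∀ m ∈ M, c m r = i := fun r hr m hm => by rw [hc]; exact (hR r hr).2 m hm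
    by_cases hall : ∀ r ∈ R, r ∈ l
    · by_cases hsep : ∀ l₁ l₂, l = l₁ ++ l₂ → (∀ u ∈ l₁.getLast?, u ∈ R) →
          ¬ ∀ v ∈ l₂.head?, v ∈ R
      · exact (two_mul_card_lt_of_separated hall hsep).trans hl.length_le
      · push Not at hsep
        obtain ⟨l₁, l₂, rfl, h₁, h₂⟩ := hsep
        have hp : (l₁ ++ d :: l₂).Perm (d :: (l₁ ++ l₂)) := List.perm_middle
        refine ih (l₁ ++ d :: l₂) ⟨hp.nodup_iff.2 (List.nodup_cons.2 ⟨hdM.2, hl.1⟩), ?_⟩ ?_ ?_ ?_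
        · have hch := List.isChain_append.1 hl.2
          refine hch.1.append (List.isChain_cons.2 ⟨fun v hv => hRc v (h₂ v hv) d hdM.1,
            hch.2.1⟩) fun u hu v hv => ?_
          simp only [List.head?_cons, Option.mem_def, Option.some.injEq] at hv
          exact hv ▸ (hR u (h₁ u hu)).2 d hdM.1
        · intro e he
          refine ⟨(hD' e he).1, fun h => ?_⟩
          rcases List.mem_cons.1 (hp.mem_iff.1 h) with rfl | h
          · exact hd he
          · exact (hD' e he).2 h
        · exact ⟨d, by simp, hdM.1⟩
        · rw [hp.length_eq, List.length_cons]
          omega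
    · push Not at hall
      obtain ⟨r, hr, hrl⟩ := hall
      obtain ⟨m, hml, hmM⟩ := hm
      obtain ⟨l₁, l₂, rfl⟩ := List.append_of_mem hml
      have hrM := (hR r hr).1
      have hDr : ∀ e ∈ D, e ≠ r := fun e he h => hrM (h ▸ (hD' e he).1)
      have hch := List.isChain_split.1 hl.2
      by_cases hy : ∀ y ∈ l₂.head?, y ∉ M
      · have hp : (l₁ ++ m :: r :: d :: l₂).Perm (r :: d :: (l₁ ++ m :: l₂)) := by
          have h₁ : (l₁ ++ m :: r :: d :: l₂).Perm (r :: (l₁ ++ m :: d :: l₂)) := by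
            simpa using List.perm_middle (l₁ := l₁ ++ [m]) (a := r) (l₂ := d :: l₂)
          have h₂ : (l₁ ++ m :: d :: l₂).Perm (d :: (l₁ ++ m :: l₂)) := by
            simpa using List.perm_middle (l₁ := l₁ ++ [m]) (a := d) (l₂ := l₂)
          exact h₁.trans (h₂.cons r)
        have hrd : r ≠ d := fun e => hrM (e ▸ hdM.1)
        refine ih (l₁ ++ m :: r :: d :: l₂) ⟨hp.nodup_iff.2 ?_, ?_⟩ ?_ ⟨m, by simp, hmM⟩ ?_
        · exact List.nodup_cons.2 ⟨by
            rw [List.mem_cons, not_or]; exact ⟨hrd, hrl⟩, List.nodup_cons.2 ⟨hdM.2, hl.1⟩⟩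
        · refine List.isChain_split.2 ⟨hch.1, List.isChain_cons_cons.2 ⟨hRc r hr m hmM,
            List.isChain_cons_cons.2 ⟨(hR r hr).2 d hdM.1, List.isChain_cons.2 ⟨?_, hch.2.tail⟩⟩⟩⟩
          intro y hy'
          have h₁ := (List.isChain_cons.1 hch.2).1 y hy'
          rw [hc] at h₁ ⊢
          rw [← h₁]
          exact hM y (hy y hy') _ hdM.1 _ hmM
        · intro e he
          refine ⟨(hD' e he).1, fun h => ?_⟩
          rcases List.mem_cons.1 (hp.mem_iff.1 h) with h | h
          · exact hDr e he h
          rcases List.mem_cons.1 h with rfl | h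
          · exact hd he
          · exact (hD' e he).2 h
        · rw [hp.length_eq, List.length_cons, List.length_cons]
          omega
      · push Not at hy
        obtain ⟨y, hyh, hyM⟩ := hy
        have hp : (l₁ ++ m :: r :: l₂).Perm (r :: (l₁ ++ m :: l₂)) := by
          simpa using List.perm_middle (l₁ := l₁ ++ [m]) (a := r) (l₂ := l₂)
        refine ih (l₁ ++ m :: r :: l₂) ⟨hp.nodup_iff.2 (List.nodup_cons.2 ⟨hrl, hl.1⟩), ?_⟩ ?_
          ⟨m, by simp, hmM⟩ ?_
        · refine List.isChain_split.2 ⟨hch.1, List.isChain_cons_cons.2 ⟨hRc r hr m hmM,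
            List.isChain_cons.2 ⟨fun y' hy' => ?_, hch.2.tail⟩⟩⟩
          have : y' = y := by
            rw [Option.mem_def] at hyh hy'
            exact Option.some.inj (hy'.symm.trans hyh)
          exact this ▸ (hR r hr).2 y hyM
        · intro e he
          refine ⟨(hD' e he).1, fun h => ?_⟩
          rcases List.mem_cons.1 (hp.mem_iff.1 h) with h | h
          · exact hDr e he h
          · exact (hD' e he).2 h
        · rw [hp.length_eq, List.length_cons]
          omega

lemma pathNum_recolor_le_or {M R : Finset V} (hc : ColorSymm c) (hM : IsModule c M)
    (hR : ∀ r ∈ R, r ∉ M ∧ ∀ m ∈ M, c r m = i) :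
    pathNum (recolor c M i) i ≤ pathNum c i ∨ 2 * R.card + 1 ≤ pathNum c i := by
  by_contra! hcon
  obtain ⟨X, hX, hlen⟩ := exists_longest (recolor c M i) i
  obtain ⟨x, X, rfl⟩ := List.exists_cons_of_ne_nil (l := X) (by
    rintro rfl
    simp at hlen
    omega)
  obtain ⟨l, y, hl, hsub, -, hrest, hex⟩ := collapse hM X x hX
  set D : Finset V := (x :: X).toFinset \ (y :: l).toFinset with hDdef
  have hcard : D.card + (y :: l).length = (x :: X).length := by
    rw [← List.toFinset_card_of_nodup hX.1, ← List.toFinset_card_of_nodup hl.1, hDdef]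
    refine Finset.card_sdiff_add_card_eq_card fun z hz => ?_
    rw [List.mem_toFinset] at hz ⊢
    exact hsub hz
  have hDmem : ∀ d ∈ D, d ∈ x :: X ∧ d ∉ y :: l := by
    intro d hd
    rwa [hDdef, Finset.mem_sdiff, List.mem_toFinset, List.mem_toFinset] at hd
  have hDM : ∀ d ∈ D, d ∈ M ∧ d ∉ y :: l := fun d hd =>
    ⟨hrest d (hDmem d hd).1 (hDmem d hd).2, (hDmem d hd).2⟩
  rcases D.eq_empty_or_nonempty with h0 | ⟨d, hd⟩
  · have := hl.length_le
    rw [h0] at hcard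
    simp only [Finset.card_empty] at hcard
    omega
  · have := pathNum_ge_of_spare hc hM hR D (y :: l) hl hDM
      (hex ⟨d, (hDmem d hd).1, (hDM d hd).1⟩) (by omega)
    omega

end Recolor

section Connectivity

variable {c : V → V → γ} {i : γ}

/-- Reachability inside `S` along edges of color `i`. -/
def Reach (c : V → V → γ) (i : γ) (S : Finset V) : V → V → Prop :=
  Relation.ReflTransGen fun u v => u ∈ S ∧ v ∈ S ∧ u ≠ v ∧ c u v = i

lemma Reach.symm (hc : ColorSymm c) {S : Finset V} {u v : V} (h : Reach c i S u v) :
    Reach c i S v u := by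
  induction h with
  | refl => exact .refl
  | tail _ h ih => exact .head ⟨h.2.1, h.1, h.2.2.1.symm, by rw [hc]; exact h.2.2.2⟩ ih

lemma Reach.trans {S : Finset V} {u v w : V} (h : Reach c i S u v) (h' : Reach c i S v w) :
    Reach c i S u w :=
  Relation.ReflTransGen.trans h h'

lemma Reach.color_eq (hG : IsGallai c) (hc : ColorSymm c) {S : Finset V} {u u' v : V}
    (h : Reach c i S u u') (hv : v ∈ S) (hn : ¬ Reach c i S u v) : c v u = c v u' := by
  induction h with
  | refl => rfl
  | @tail x y hx hxy ih =>
    have hvx : v ≠ x := by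
      rintro rfl
      exact hn hx
    have hvy : v ≠ y := by
      rintro rfl
      exact hn (hx.tail hxy)
    have h₁ : c v x ≠ i := fun h => hn (hx.tail ⟨hxy.1, hv, hvx.symm, by rw [hc, h]⟩)
    have h₂ : c v y ≠ i := fun h =>
      hn ((hx.tail hxy).tail ⟨hxy.2.1, hv, hvy.symm, by rw [hc, h]⟩)
    rcases hG v x y hvx hxy.2.2.1 hvy with h | h | h
    · exact absurd (h.trans hxy.2.2.2) h₁
    · exact ih.trans h
    · exact absurd (h.symm.trans hxy.2.2.2) h₂

variable [DecidableEq V]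

lemma Reach.exists_last {T : Finset V} {v w : V} (h : Reach c i (insert v T) w v) (hw : w ∈ T)
    (hv : v ∉ T) : ∃ y ∈ T, Reach c i T w y ∧ c y v = i := by
  induction h using Relation.ReflTransGen.head_induction_on with
  | refl => exact absurd hw hv
  | @head a b hab _ ih =>
    by_cases hb : b = v
    · exact ⟨a, hw, .refl, hb ▸ hab.2.2.2⟩
    · have hbT : b ∈ T := Finset.mem_of_mem_insert_of_ne hab.2.1 hb
      obtain ⟨y, hy, hby, hyv⟩ := ih hbT
      exact ⟨y, hy, Relation.ReflTransGen.head ⟨hw, hbT, hab.2.2⟩ hby, hyv⟩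

lemma false_of_connected_insert (hc : ColorSymm c) (hG : IsGallai c) {a b d : γ} (hab : a ≠ b)
    (had : a ≠ d) (hbd : b ≠ d) {T : Finset V} {v w w' : V} (hv : v ∉ T) (hw : w ∈ T)
    (hw' : w' ∈ T) (hn : ¬ Reach c a T w w')
    (ha : ∀ x ∈ T, Reach c a (insert v T) x v) (hb : Reach c b (insert v T) w v)
    (hd : Reach c d (insert v T) w v) : False := by
  have hvT : ∀ x ∈ T, x ≠ v := fun x hx e => hv (e ▸ hx)
  -- a vertex `x` joined to `v` in a color `e ≠ a` is joined in color `e` to the `a`-neighbours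
  -- of `v` lying in other `a`-components
  have hprop : ∀ e, a ≠ e → ∀ x ∈ T, c x v = e → ∀ y ∈ T, c y v = a → ¬ Reach c a T x y →
      c x y = e := by
    intro e hae x hx hxv y hy hyv hxy
    have hne : x ≠ y := by
      rintro rfl
      exact hxy .refl
    have h₁ : c x y ≠ a := fun h => hxy (.single ⟨hx, hy, hne, h⟩)
    rcases hG x y v hne (hvT y hy) (hvT x hx) with h | h | h
    · exact absurd (h.trans hyv) h₁
    · exact h.trans hxv
    · exact absurd (hyv.symm.trans (h.trans hxv)) hae
  obtain ⟨x, hx, -, hxv⟩ := hb.exists_last hw hv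
  obtain ⟨x', hx', -, hxv'⟩ := hd.exists_last hw hv
  by_cases hxx : Reach c a T x x'
  · obtain ⟨z, hz, hxz⟩ : ∃ z ∈ T, ¬ Reach c a T x z := by
      by_contra! h
      exact hn (((h w hw).symm hc).trans (h w' hw'))
    obtain ⟨y, hy, hzy, hyv⟩ := (ha z hz).exists_last hz hv
    have hxy : ¬ Reach c a T x y := fun h => hxz (h.trans (hzy.symm hc))
    have h₁ := hprop b hab x hx hxv y hy hyv hxy
    have h₂ := hprop d had x' hx' hxv' y hy hyv fun h => hxy (hxx.trans h)
    have h₃ := hxx.color_eq hG hc hy hxy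
    rw [hc y x, hc y x', h₁, h₂] at h₃
    exact hbd h₃
  · obtain ⟨y, hy, hxy, hyv⟩ := (ha x hx).exists_last hx hv
    obtain ⟨y', hy', hxy', hyv'⟩ := (ha x' hx').exists_last hx' hv
    have h₁ := hprop b hab x hx hxv y' hy' hyv' fun h => hxx (h.trans (hxy'.symm hc))
    have h₂ := hprop d had x' hx' hxv' y hy hyv fun h => hxx (hxy.trans (h.symm hc))
    have h₃ := hxy.color_eq hG hc hy' fun h => hxx (h.trans (hxy'.symm hc))
    have h₄ := hxy'.color_eq hG hc hy fun h => hxx (hxy.trans (h.symm hc))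
    rw [hc y' x, h₁] at h₃
    rw [hc y x', h₂, hc y y'] at h₄
    exact hbd (h₃.trans h₄.symm)

/-- In a Gallai coloring, no three color classes are all connected and spanning. -/
lemma not_three_connected (hc : ColorSymm c) (hG : IsGallai c) {a b d : γ} (hab : a ≠ b)
    (had : a ≠ d) (hbd : b ≠ d) (S : Finset V) : 2 ≤ S.card →
    ¬ ((∀ x ∈ S, ∀ y ∈ S, Reach c a S x y) ∧ (∀ x ∈ S, ∀ y ∈ S, Reach c b S x y) ∧
      ∀ x ∈ S, ∀ y ∈ S, Reach c d S x y) := by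
  induction S using Finset.induction_on with
  | empty => simp
  | @insert v T hv ih =>
    rintro hcard ⟨ha, hb, hd⟩
    rw [Finset.card_insert_of_notMem hv] at hcard
    have hI : ∀ x ∈ T, x ∈ insert v T := fun x hx => Finset.mem_insert_of_mem hx
    have hvI := Finset.mem_insert_self v T
    have ha' := fun x hx => ha x (hI x hx) v hvI
    have hb' := fun x hx => hb x (hI x hx) v hvI
    have hd' := fun x hx => hd x (hI x hx) v hvI
    rcases Nat.lt_or_ge T.card 2 with h | h
    · obtain ⟨w, rfl⟩ := Finset.card_eq_one.1 (show T.card = 1 by omega)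
      obtain ⟨y, hy, -, h₁⟩ := (ha' w (by simp)).exists_last (by simp) hv
      obtain ⟨y', hy', -, h₂⟩ := (hb' w (by simp)).exists_last (by simp) hv
      rw [Finset.mem_singleton] at hy hy'
      subst hy hy'
      exact hab (h₁.symm.trans h₂)
    · refine ih h ⟨?_, ?_, ?_⟩ <;> intro w hw w' hw' <;> by_contra hn
      · exact false_of_connected_insert hc hG hab had hbd hv hw hw' hn ha' (hb' w hw) (hd' w hw)
      · exact false_of_connected_insert hc hG hab.symm hbd had hv hw hw' hn hb' (ha' w hw)
          (hd' w hw)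
      · exact false_of_connected_insert hc hG had.symm hbd.symm hab hv hw hw' hn hd' (ha' w hw)
          (hb' w hw)

end Connectivity

section Bound

variable [Fintype V] [Fintype γ] {c : V → V → γ}

/-- The upper bound on the order of a Gallai coloring in terms of its longest paths. -/
def PathBound (c : V → V → γ) : Prop :=
  ∃ i, Fintype.card V ≤ ∑ j, (pathNum c j - 1) / 2 + pathNum c i / 2 + 1

lemma PathBound.mono {c' : V → V → γ} (h : PathBound c')
    (hle : ∀ i, pathNum c' i ≤ pathNum c i) : PathBound c := by
  obtain ⟨i, hi⟩ := h
  have h₁ : ∑ j, (pathNum c' j - 1) / 2 ≤ ∑ j, (pathNum c j - 1) / 2 :=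
    Finset.sum_le_sum fun j _ => by have := hle j; omega
  have := hle i
  exact ⟨i, by omega⟩

variable [DecidableEq γ]

lemma pathBound_of_le {i : γ}
    (h : Fintype.card V ≤ pathNum c i + ∑ j ∈ Finset.univ.erase i, (pathNum c j - 1) / 2) :
    PathBound c := by
  refine ⟨i, ?_⟩
  rw [← Finset.add_sum_erase _ _ (Finset.mem_univ i)]
  omega

variable [DecidableEq V]

lemma exists_neighbour_classes {M : Finset V} (hM : IsModule c M) (hne : M.Nonempty) :
    ∃ R : γ → Finset V, (∀ i v, v ∈ R i ↔ v ∉ M ∧ ∀ m ∈ M, c v m = i) ∧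
      Fintype.card V = M.card + ∑ i, (R i).card := by
  obtain ⟨m, hm⟩ := hne
  refine ⟨fun i => {v ∈ Finset.univ \ M | c v m = i}, fun i v => ?_, ?_⟩
  · simp only [Finset.mem_filter, Finset.mem_sdiff, Finset.mem_univ, true_and]
    refine and_congr_right fun hv => ⟨?_, fun h => h m hm⟩
    rintro rfl m' hm'
    exact hM v hv m' hm' m hm
  · rw [← Finset.card_eq_sum_card_fiberwise (f := fun v => c v m) (t := Finset.univ)
      (fun _ _ => by simp), add_comm, Finset.card_sdiff_add_card_eq_card (Finset.subset_univ _),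
      Finset.card_univ]

lemma pathBound_of_module (hc : ColorSymm c) {M : Finset V} (R : γ → Finset V)
    (hR : ∀ i, ∀ v ∈ R i, v ∉ M ∧ ∀ m ∈ M, c v m = i)
    (hcard : Fintype.card V = M.card + ∑ i, (R i).card) (hlt : ∀ i, (R i).card < M.card)
    (hb : PathBound fun u v : M => c u v) : PathBound c := by
  set cM : M → M → γ := fun u v => c u v with hcM
  have hodd : ∀ j, 2 * (R j).card + 1 ≤ pathNum c j := fun j =>
    pathNum_ge_of_card_lt hc (hR j) (hlt j)
  have hext : ∀ j m, 1 ≤ m → m ≤ pathNum cM j → m + (R j).card ≤ M.card →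
      m + 2 * (R j).card ≤ pathNum c j := by
    intro j m hm hle hmc
    obtain ⟨l, hl, rfl⟩ := exists_pathList_length hle
    have := pathNum_ge_of_attached hc (hR j) (l := l.map Subtype.val)
      ⟨hl.1.map Subtype.val_injective, (List.isChain_map _).2 hl.2⟩
      (by rw [Ne, List.map_eq_nil_iff]; rintro rfl; simp at hm)
      (fun x hx => by obtain ⟨y, -, rfl⟩ := List.mem_map.1 hx; exact y.2) (by simpa using hmc)
    simpa using this
  have : Nonempty M := (Finset.card_pos.1 ((Nat.zero_le _).trans_lt (hlt hb.choose))).coe_sort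
  by_cases hbig : ∃ i, M.card < pathNum cM i + (R i).card
  · obtain ⟨i, hi⟩ := hbig
    have h₁ := hlt i
    have h₂ := hext i (M.card - (R i).card) (by omega) (by omega) (by omega)
    refine pathBound_of_le (i := i) ?_
    have h₃ : ∑ j ∈ Finset.univ.erase i, (R j).card ≤
        ∑ j ∈ Finset.univ.erase i, (pathNum c j - 1) / 2 :=
      Finset.sum_le_sum fun j _ => by have := hodd j; omega
    rw [hcard, ← Finset.add_sum_erase _ _ (Finset.mem_univ i)]
    omega
  · push Not at hbig
    have hgrow : ∀ j, pathNum cM j + 2 * (R j).card ≤ pathNum c j := fun j =>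
      hext j _ (one_le_pathNum cM j) le_rfl (hbig j)
    obtain ⟨i, hi⟩ := hb
    have h₁ : ∑ j, ((R j).card + (pathNum cM j - 1) / 2) ≤ ∑ j, (pathNum c j - 1) / 2 :=
      Finset.sum_le_sum fun j _ => by
        have := hgrow j
        have := one_le_pathNum cM j
        omega
    rw [Finset.sum_add_distrib] at h₁
    have h₂ := hgrow i
    rw [Fintype.card_coe] at hi
    exact ⟨i, by omega⟩

end Bound

section Triples

variable [Fintype V] [Fintype γ] {c : V → V → γ}

open Classical in
/-- The triples consisting of a color and two vertices connected in that color. -/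
noncomputable def reachTriples (c : V → V → γ) : Finset (γ × V × V) :=
  {t | Reach c t.1 Finset.univ t.2.1 t.2.2}

lemma reachTriples_recolor_ssubset [DecidableEq V] (hc : ColorSymm c) {M : Finset V} {q j : γ}
    {x y r : V} (hM : ∀ z, z ∈ M ↔ Reach c q Finset.univ x z) (hxy : x ≠ y) (hq : c x y = q)
    (hr : r ∉ M ∧ ∀ m ∈ M, c r m = j) :
    reachTriples (recolor c M j) ⊂ reachTriples c := by
  have hxM : x ∈ M := (hM x).2 .refl
  have hrne : ∀ m ∈ M, m ≠ r := fun m hm e => hr.1 (e ▸ hm)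
  refine Finset.ssubset_iff_of_subset ?_ |>.2 ⟨(q, x, y), ?_, ?_⟩
  · rintro ⟨i, u, v⟩ h
    simp only [reachTriples, Finset.mem_filter, Finset.mem_univ, true_and] at h ⊢
    induction h with
    | refl => exact .refl
    | @tail a b _ hab ih =>
      obtain ⟨-, -, hne, hcol⟩ := hab
      by_cases hm : a ∈ M ∧ b ∈ M
      · simp only [recolor, hm, and_self, if_true] at hcol
        subst hcol
        refine (ih.tail (c := r) ⟨by simp, by simp, hrne a hm.1, ?_⟩).tail
          ⟨by simp, by simp, (hrne b hm.2).symm, hr.2 b hm.2⟩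
        rw [hc]
        exact hr.2 a hm.1
      · simp only [recolor, hm, if_false] at hcol
        exact ih.tail ⟨by simp, by simp, hne, hcol⟩
  · simp only [reachTriples, Finset.mem_filter, Finset.mem_univ, true_and]
    exact .single ⟨by simp, by simp, hxy, hq⟩
  · simp only [reachTriples, Finset.mem_filter, Finset.mem_univ, true_and]
    intro h
    rcases Relation.ReflTransGen.cases_head h with h | ⟨w, ⟨-, -, hxw, hcol⟩, -⟩
    · exact hxy h
    · by_cases hw : w ∈ M
      · simp only [recolor, hxM, hw, and_self, if_true] at hcol
        refine hr.1 ((hM r).2 (.single ⟨by simp, by simp, hrne x hxM, ?_⟩))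
        rw [hc, hr.2 x hxM, hcol]
      · simp only [recolor, hw, and_false, if_false] at hcol
        exact hw ((hM w).2 (.single ⟨by simp, by simp, hxw, hcol⟩))

end Triples

/-- Every Gallai coloring satisfies the path bound. -/
theorem pathBound_of_isGallai [Fintype γ] (n : ℕ) :
    ∀ (V : Type*) [Fintype V] [Nonempty V] (c : V → V → γ),
    Fintype.card V = n → ColorSymm c → IsGallai c → PathBound c := by
  classical
  induction n using Nat.strong_induction_on with
  | _ n ihn =>
  intro V _ _ c hn hc hG
  induction ht : (reachTriples c).card using Nat.strong_induction_on generalizing c with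
  | _ t iht =>
  have : Nonempty γ := ⟨c (Classical.arbitrary V) (Classical.arbitrary V)⟩
  obtain ⟨r, hmax⟩ := Finite.exists_max (pathNum c)
  by_cases htwo : ∀ b, b ≠ r → (∃ u v, u ≠ v ∧ c u v = b) →
      ∀ u v, u ≠ v → c u v = r ∨ c u v = b
  · rcases bound_of_two_colors hc hmax htwo with h | ⟨b, hbr, h⟩
    · exact pathBound_of_le (i := r) (h.trans (Nat.le_add_right _ _))
    · refine pathBound_of_le (i := r) (h.trans (Nat.add_le_add_left ?_ _))
      exact Finset.single_le_sum (f := fun j => (pathNum c j - 1) / 2) (fun _ _ => Nat.zero_le _)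
        (Finset.mem_erase.2 ⟨hbr, Finset.mem_univ b⟩)
  push Not at htwo
  obtain ⟨b, hbr, ⟨u, v, huv, hub⟩, u', v', huv', hur', hub'⟩ := htwo
  obtain ⟨u₀, v₀, huv₀, hu₀⟩ : ∃ u v, u ≠ v ∧ c u v = r := by
    refine exists_edge_of_two_le (le_trans ?_ (hmax b))
    exact IsPathList.length_le (l := [u, v]) ⟨by simpa using huv, by simpa using hub⟩
  -- some color that occurs is disconnected
  obtain ⟨q, x, y, hxy, hq, z, hz⟩ : ∃ q x y, x ≠ y ∧ c x y = q ∧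
      ∃ z, ¬ Reach c q Finset.univ x z := by
    by_contra! hcon
    have hconn : ∀ q x y, x ≠ y → c x y = q → ∀ w ∈ (Finset.univ : Finset V),
        ∀ w' ∈ (Finset.univ : Finset V), Reach c q Finset.univ w w' :=
      fun q x y h h' w _ w' _ => ((hcon q x y h h' w).symm hc).trans (hcon q x y h h' w')
    refine not_three_connected hc hG hbr.symm (Ne.symm hur') (Ne.symm hub') Finset.univ ?_
      ⟨hconn _ _ _ huv₀ hu₀, hconn _ _ _ huv hub, hconn _ _ _ huv' rfl⟩
    exact Finset.one_lt_card.2 ⟨u, by simp, v, by simp, huv⟩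
  set M : Finset V := {z | Reach c q Finset.univ x z} with hMdef
  have hMmem : ∀ z, z ∈ M ↔ Reach c q Finset.univ x z := fun z => by simp [hMdef]
  have hxM : x ∈ M := (hMmem x).2 .refl
  have hM : IsModule c M := by
    intro v hv m hm m' hm'
    rw [hMmem] at hv hm hm'
    exact (hm.color_eq hG hc (Finset.mem_univ v) hv).symm.trans
      (hm'.color_eq hG hc (Finset.mem_univ v) hv)
  have hMcard : M.card < n := by
    rw [← hn, ← Finset.card_univ]
    exact Finset.card_lt_card (Finset.ssubset_univ_iff.2 fun h =>
      hz ((hMmem z).1 (h ▸ Finset.mem_univ z)))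
  obtain ⟨R, hR, hcard⟩ := exists_neighbour_classes hM ⟨x, hxM⟩
  have hR' := fun i v => (hR i v).1
  by_cases hsmall : ∀ i, (R i).card < M.card
  · have : Nonempty M := ⟨⟨x, hxM⟩⟩
    refine pathBound_of_module hc R hR' hcard hsmall (ihn M.card hMcard M _ (by simp)
      (fun u v => hc u v) fun u v w huv hvw huw => ?_)
    exact hG u v w (Subtype.coe_ne_coe.2 huv) (Subtype.coe_ne_coe.2 hvw) (Subtype.coe_ne_coe.2 huw)
  push Not at hsmall
  obtain ⟨i₀, hi₀⟩ := hsmall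
  by_cases hre : ∃ j, (R j).Nonempty ∧ pathNum (recolor c M j) j ≤ pathNum c j
  · obtain ⟨j, ⟨s, hs⟩, hj⟩ := hre
    refine PathBound.mono (iht _ ?_ (recolor c M j) (recolor_symm hc M j)
      (recolor_isGallai hc hG hM j) rfl) fun i => ?_
    · rw [← ht]
      exact Finset.card_lt_card (reachTriples_recolor_ssubset hc hMmem hxy hq (hR' j s hs))
    · rcases eq_or_ne i j with rfl | hij
      · exact hj
      · refine pathNum_le_of_imp fun u v _ h => ?_
        by_cases huv : u ∈ M ∧ v ∈ M
        · simp only [recolor, huv, and_self, if_true] at h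
          exact absurd h.symm hij
        · simpa only [recolor, huv, if_false] using h
  · push Not at hre
    have hodd : ∀ j, 2 * (R j).card + 1 ≤ pathNum c j := by
      intro j
      rcases (R j).eq_empty_or_nonempty with h | h
      · simpa [h] using one_le_pathNum c j
      · exact (pathNum_recolor_le_or hc hM (hR' j)).resolve_left (hre j h).not_ge
    refine pathBound_of_le (i := i₀) ?_
    have h₁ : ∑ j ∈ Finset.univ.erase i₀, (R j).card ≤
        ∑ j ∈ Finset.univ.erase i₀, (pathNum c j - 1) / 2 :=
      Finset.sum_le_sum fun j _ => by have := hodd j; omega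
    have := hodd i₀
    rw [hcard, ← Finset.add_sum_erase _ _ (Finset.mem_univ i₀)]
    omega

section Ramsey

variable {n k : ℕ}

lemma monoPath_of_le_pathNum [Fintype V] {c : V → V → γ} {i : γ} {m : ℕ} (h : m ≤ pathNum c i) :
    MonoPath c m i := by
  obtain ⟨l, hl, rfl⟩ := exists_pathList_length h
  exact ⟨l.get, List.nodup_iff_injective_get.1 hl.1, fun j hj => hl.2.getElem j hj⟩

lemma exists_monoPath (hn : 1 ≤ n) {N : ℕ} (hN : (n - 1) * k + n + 2 ≤ N)
    {c : Fin N → Fin N → Fin k} (hc : ColorSymm c) (hG : IsGallai c) :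
    ∃ i, MonoPath c (2 * n + 1) i := by
  by_contra! hcon
  have hlt : ∀ i, pathNum c i < 2 * n + 1 := fun i =>
    not_le.1 fun h => hcon i (monoPath_of_le_pathNum h)
  have : Nonempty (Fin N) := ⟨⟨0, by omega⟩⟩
  obtain ⟨i, hi⟩ := pathBound_of_isGallai N (Fin N) c (Fintype.card_fin N) hc hG
  have h₁ : ∑ j, (pathNum c j - 1) / 2 ≤ ∑ _j : Fin k, (n - 1) :=
    Finset.sum_le_sum fun j _ => by have := hlt j; omega
  rw [Finset.sum_const, Finset.card_univ, Fintype.card_fin, smul_eq_mul, mul_comm] at h₁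
  rw [Fintype.card_fin] at hi
  have := hlt i
  omega

/-- The level of the vertex `v`: the first `2 * n` vertices have level `0`, and each further block
of `n - 1` vertices forms a level. -/
def level (n v : ℕ) : ℕ :=
  if v < 2 * n then 0 else (v - 2 * n) / (n - 1) + 1

lemma level_eq_zero_iff {v : ℕ} : level n v = 0 ↔ v < 2 * n := by
  unfold level
  split_ifs <;> simp_all

lemma level_lt (hn : 2 ≤ n) (hk : 2 ≤ k) {v : ℕ} (hv : v < (n - 1) * k + n + 1) :
    level n v < k := by
  unfold level
  split_ifs with h
  · omega
  · obtain ⟨m, rfl⟩ : ∃ m, n = m + 1 := ⟨n - 1, by omega⟩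
    obtain ⟨l, rfl⟩ : ∃ l, k = l + 1 := ⟨k - 1, by omega⟩
    rw [Nat.add_lt_add_iff_right, Nat.div_lt_iff_lt_mul (by omega)]
    simp only [Nat.add_sub_cancel] at hv ⊢
    rw [mul_add, mul_one, mul_comm] at hv
    omega

lemma mem_block_of_level_eq (hn : 2 ≤ n) {i v : ℕ} (h : level n v = i + 1) :
    v ∈ Finset.Ico (2 * n + i * (n - 1)) (2 * n + i * (n - 1) + (n - 1)) := by
  unfold level at h
  split_ifs at h with hv
  have h₁ : (v - 2 * n) / (n - 1) = i := by omega
  have h₂ := Nat.div_add_mod (v - 2 * n) (n - 1)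
  have h₃ := Nat.mod_lt (v - 2 * n) (show 0 < n - 1 by omega)
  rw [h₁, mul_comm] at h₂
  rw [Finset.mem_Ico]
  omega

lemma not_monoPath_level (hn : 2 ≤ n) {N : ℕ} (i : ℕ) :
    ¬ MonoPath (fun u v : Fin N => max (level n u) (level n v)) (2 * n + 1) i := by
  rintro ⟨f, hf, hcol⟩
  rcases i with _ | i
  · have h : ∀ j : Fin (2 * n + 1), (f j : ℕ) ∈ Finset.range (2 * n) := by
      intro j
      rw [Finset.mem_range, ← level_eq_zero_iff]
      rcases Nat.lt_or_ge (j + 1) (2 * n + 1) with hj | hj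
      · exact (Nat.max_eq_zero_iff.1 (hcol j hj)).1
      · obtain ⟨j, hj'⟩ := j
        obtain rfl : j = (2 * n - 1) + 1 := by simp at hj; omega
        exact (Nat.max_eq_zero_iff.1 (hcol (2 * n - 1) hj')).2
    have := Finset.card_le_card_of_injOn (s := Finset.univ) (fun j => (f j : ℕ)) (fun j _ => h j)
      (Fin.val_injective.comp hf).injOn
    simp at this
  · have h : ∀ j : Fin n, ∃ a : Fin (2 * n + 1), a / 2 = (j : ℕ) ∧ level n (f a) = i + 1 := by
      intro j
      have h := hcol (2 * j) (by omega)
      rcases max_choice (level n (f ⟨2 * j, by omega⟩)) (level n (f ⟨2 * j + 1, by omega⟩)) with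
        h' | h'
      · exact ⟨⟨2 * j, by omega⟩, by simp, h'.symm.trans h⟩
      · exact ⟨⟨2 * j + 1, by omega⟩, by simp; omega, h'.symm.trans h⟩
    choose a ha hlev using h
    have := Finset.card_le_card_of_injOn (s := Finset.univ) (fun j => (f (a j) : ℕ))
      (fun j _ => mem_block_of_level_eq hn (hlev j)) (fun j _ j' _ e => by
        have := hf (Fin.val_injective e)
        rw [Fin.ext_iff, ← ha j, ← ha j', this])
    rw [Finset.card_univ, Fintype.card_fin, Nat.card_Ico] at this
    omega

lemma exists_isGallai_not_monoPath (hn : 2 ≤ n) (hk : 2 ≤ k) {N : ℕ}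
    (hN : N ≤ (n - 1) * k + n + 1) :
    ∃ c : Fin N → Fin N → Fin k, ColorSymm c ∧ IsGallai c ∧
      ∀ i, ¬ MonoPath c (2 * n + 1) i := by
  have hlt : ∀ v : Fin N, level n v < k := fun v => level_lt hn hk (by omega)
  refine ⟨fun u v => ⟨max (level n u) (level n v), max_lt (hlt u) (hlt v)⟩, fun u v => ?_,
    fun u v w _ _ _ => ?_, ?_⟩
  · simp only [max_comm]
  · simp only [Fin.mk.injEq]
    omega
  · rintro i ⟨f, hf, h⟩
    exact not_monoPath_level hn i ⟨f, hf, fun j hj => congrArg Fin.val (h j hj)⟩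

end Ramsey

end GallaiPath

/-- Gallai-Ramsey number of the path on $2n+1$ vertices: for all $k ≥ 2$ and $n ≥ 3$,
$GR_k(P_{2n+1}) = (n-1)k + n + 2$. -/
theorem gallai_ramsey_odd_path (k n : ℕ) (hk : 2 ≤ k) (hn : 3 ≤ n) :
    IsLeast {N : ℕ | 0 < N ∧ ∀ c : Fin N → Fin N → Fin k,
        ColorSymm c → IsGallai c → ∃ i : Fin k, MonoPath c (2 * n + 1) i}
      ((n - 1) * k + n + 2) := by
  refine ⟨⟨by omega, fun c hc hG => GallaiPath.exists_monoPath (by omega) le_rfl hc hG⟩, ?_⟩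
  rintro N ⟨-, hN⟩
  by_contra! hlt
  obtain ⟨c, hc, hG, hcon⟩ := GallaiPath.exists_isGallai_not_monoPath (n := n) (k := k) (N := N)
    (by omega) hk (by omega)
  obtain ⟨i, hi⟩ := hN c hc hG
  exact hcon i hi
end

section
/- For all integers k ≥ 2 and n ≥ 3, there exists a Gallai k-coloring of the complete graph on (n−1)k + n vertices with no monochromatic copy of C_{2n}; consequently GR_k(C_{2n}) ≥ (n−1)k + n + 1. -/
theorem nextFin_injective {m : ℕ} : Function.Injective (nextFin (m := m)) := by
  intro a b h
  have h' : (a.val + 1) ≡ (b.val + 1) [MOD m] := congrArg Fin.val h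
  exact Fin.ext (Nat.ModEq.eq_of_lt_of_lt (Nat.ModEq.add_right_cancel' 1 h') a.isLt b.isLt)

/-- If every edge of the cycle has an endpoint in `A`, then `A` contains at least half of its
vertices. -/
theorem le_two_mul_card_of_nextFin_cover {m : ℕ} (A : Finset (Fin m))
    (hA : ∀ j, j ∈ A ∨ nextFin j ∈ A) : m ≤ 2 * A.card := by
  have h : Aᶜ.card ≤ A.card :=
    Finset.card_le_card_of_injOn nextFin
      (fun j hj => (hA j).resolve_left (Finset.mem_compl.mp hj)) nextFin_injective.injOn
  have h' := Finset.card_add_card_compl A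
  rw [Fintype.card_fin] at h'
  omega

/-- The layer containing a vertex: layer `0` consists of the first `2 * n - 1` vertices, and
each later layer of the next `n - 1` vertices. -/
def layer (n v : ℕ) : ℕ := (v - n) / (n - 1)

theorem layer_lt {k n v : ℕ} (hk : 0 < k) (hn : 2 ≤ n) (hv : v < (n - 1) * k + n) :
    layer n v < k := by
  have : 0 < (n - 1) * k := Nat.mul_pos (by omega) hk
  exact Nat.div_lt_of_lt_mul (by omega)

theorem lt_of_layer_eq_zero {n v : ℕ} (hn : 2 ≤ n) (h : layer n v = 0) : v < 2 * n - 1 := by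
  have := (Nat.div_eq_zero_iff_lt (show 0 < n - 1 by omega)).mp h
  omega

theorem mem_Ico_of_layer_eq {n v i : ℕ} (hn : 2 ≤ n) (hi : 0 < i) (h : layer n v = i) :
    v ∈ Finset.Ico ((n - 1) * i + n) ((n - 1) * i + n + (n - 1)) := by
  have hpos : 0 < (n - 1) * i := Nat.mul_pos (by omega) hi
  have h₁ := Nat.div_add_mod (v - n) (n - 1)
  have h₂ := Nat.mod_lt (v - n) (show 0 < n - 1 by omega)
  rw [show (v - n) / (n - 1) = i from h] at h₁
  rw [Finset.mem_Ico]
  omega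

/-- No even cycle of length `2 * n` has all its edges of the same layer, where the layer of an
edge is that of its larger endpoint. -/
theorem not_forall_layer_max_eq {n : ℕ} (hn : 2 ≤ n) (i : ℕ) (g : Fin (2 * n) → ℕ)
    (hg : Function.Injective g) :
    ¬ ∀ j, layer n (max (g j) (g (nextFin j))) = i := by
  intro h
  rcases Nat.eq_zero_or_pos i with rfl | hi
  · have hlt : ∀ j ∈ Finset.univ, g j ∈ Finset.range (2 * n - 1) := fun j _ =>
      Finset.mem_range.mpr <| (le_max_left _ _).trans_lt (lt_of_layer_eq_zero hn (h j))
    have := Finset.card_le_card_of_injOn g hlt hg.injOn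
    simp only [Finset.card_univ, Fintype.card_fin, Finset.card_range] at this
    omega
  · have hcover := le_two_mul_card_of_nextFin_cover
      (Finset.univ.filter fun j => layer n (g j) = i) (fun j => by
        have hj := h j
        rcases max_choice (g j) (g (nextFin j)) with hm | hm <;> rw [hm] at hj <;> simp [hj])
    have := Finset.card_le_card_of_injOn (s := Finset.univ.filter fun j => layer n (g j) = i) g
      (fun j hj => mem_Ico_of_layer_eq hn hi (Finset.mem_filter.mp hj).2) hg.injOn
    rw [Nat.card_Ico] at this
    omega

/-- Coloring each edge by a function of its larger endpoint gives a Gallai coloring. -/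
theorem isGallai_of_max {V γ : Type*} [LinearOrder V] (φ : V → γ) :
    IsGallai fun u v => φ (max u v) := by
  intro u v w _ _ _
  rcases le_total u v with h₁ | h₁ <;> rcases le_total v w with h₂ | h₂
  · simp [h₁, h₂, h₁.trans h₂]
  · simp [h₁, h₂]
  · rcases le_total u w with h₃ | h₃ <;> simp [h₁, h₂, h₃]
  · simp [h₁, h₂.trans h₁]

theorem exists_gallai_coloring_without_even_cycle {k n N : ℕ} (hk : 0 < k) (hn : 2 ≤ n)
    (hN : N ≤ (n - 1) * k + n) :
    ∃ c : Fin N → Fin N → Fin k,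
      ColorSymm c ∧ IsGallai c ∧ ¬ ∃ i : Fin k, MonoCycle c (2 * n) i := by
  let φ : Fin N → Fin k := fun w => ⟨layer n w, layer_lt hk hn (w.isLt.trans_le hN)⟩
  refine ⟨fun u v => φ (max u v), fun u v => congrArg φ (max_comm u v), isGallai_of_max φ, ?_⟩
  rintro ⟨i, f, hf, h⟩
  refine not_forall_layer_max_eq hn i (fun j => (f j).val) (Fin.val_injective.comp hf)
    fun j => ?_
  have := congrArg Fin.val (h j)
  simpa [φ, Fin.coe_max] using this

/-- Lower bound construction: for all $k ≥ 2$ and $n ≥ 3$ there is a Gallai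
$k$-coloring of $K_{(n-1)k+n}$ with no monochromatic $C_{2n}$; consequently
$GR_k(C_{2n}) ≥ (n-1)k + n + 1$. -/
theorem gallai_ramsey_even_cycle_lower (k n : ℕ) (hk : 2 ≤ k) (hn : 3 ≤ n) :
    (∃ c : Fin ((n - 1) * k + n) → Fin ((n - 1) * k + n) → Fin k,
        ColorSymm c ∧ IsGallai c ∧ ¬ ∃ i : Fin k, MonoCycle c (2 * n) i) ∧
    ∀ N : ℕ, (0 < N ∧ ∀ c : Fin N → Fin N → Fin k,
        ColorSymm c → IsGallai c → ∃ i : Fin k, MonoCycle c (2 * n) i) →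
      (n - 1) * k + n + 1 ≤ N := by
  refine ⟨exists_gallai_coloring_without_even_cycle (by omega) (by omega) le_rfl, ?_⟩
  rintro N ⟨-, hN⟩
  by_contra hlt
  obtain ⟨c, hsymm, hgallai, hc⟩ :=
    exists_gallai_coloring_without_even_cycle (k := k) (n := n) (N := N) (by omega) (by omega)
      (by omega)
  exact hc (hN c hsymm hgallai)
end

section
/- For all integers k ≥ 2, there exists a Gallai k-coloring of the complete graph on k + 3 vertices with no monochromatic copy of C_4; consequently GR_k(C_4) ≥ k + 4. -/
/-- The coloring of pairs of naturals that is the two-colored pentagon on `{0, …, 4}` and gives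
an edge whose larger endpoint is `n ≥ 5` the color `n - 3`. -/
def pentagonStarColor (u v : ℕ) : ℕ :=
  if max u v < 5 then (if (u + 1) % 5 = v ∨ (v + 1) % 5 = u then 0 else 1) else max u v - 3

theorem pentagonStarColor_comm (u v : ℕ) : pentagonStarColor u v = pentagonStarColor v u := by
  simp only [pentagonStarColor, max_comm u v, or_comm]

theorem pentagonStarColor_lt {k u v : ℕ} (hk : 2 ≤ k) (hu : u < k + 3) (hv : v < k + 3) :
    pentagonStarColor u v < k := by
  unfold pentagonStarColor
  split_ifs <;> omega

theorem pentagonStarColor_gallai (u v w : ℕ) :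
    pentagonStarColor u v = pentagonStarColor v w ∨
      pentagonStarColor u v = pentagonStarColor u w ∨
      pentagonStarColor v w = pentagonStarColor u w := by
  unfold pentagonStarColor
  split_ifs <;> omega

theorem max_lt_five_of_pentagonStarColor_lt_two {u v : ℕ} (h : pentagonStarColor u v < 2) :
    max u v < 5 := by
  unfold pentagonStarColor at h
  split_ifs at h <;> omega

theorem max_eq_of_two_le_pentagonStarColor {u v : ℕ} (h : 2 ≤ pentagonStarColor u v) :
    max u v = pentagonStarColor u v + 3 := by
  unfold pentagonStarColor at h ⊢
  split_ifs at h ⊢ <;> omega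

theorem pentagonStarColor_pentagon_no_four_cycle : ∀ a b c d : Fin 5, a ≠ c → b ≠ d →
    pentagonStarColor a b = pentagonStarColor b c →
    pentagonStarColor b c = pentagonStarColor c d →
    pentagonStarColor c d = pentagonStarColor d a →
    a = b ∨ b = c ∨ c = d ∨ d = a := by
  decide

theorem pentagonStarColor_no_four_cycle {a b c d i : ℕ} (hab : a ≠ b) (hac : a ≠ c)
    (had : a ≠ d) (hbc : b ≠ c) (hbd : b ≠ d) (hcd : c ≠ d)
    (h₁ : pentagonStarColor a b = i) (h₂ : pentagonStarColor b c = i)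
    (h₃ : pentagonStarColor c d = i) (h₄ : pentagonStarColor d a = i) : False := by
  rcases lt_or_ge i 2 with hi | hi
  · have m₁ := max_lt_five_of_pentagonStarColor_lt_two (h₁.trans_lt hi)
    have m₂ := max_lt_five_of_pentagonStarColor_lt_two (h₃.trans_lt hi)
    have := pentagonStarColor_pentagon_no_four_cycle ⟨a, by omega⟩ ⟨b, by omega⟩ ⟨c, by omega⟩
      ⟨d, by omega⟩ (by simpa using hac) (by simpa using hbd)
      (h₁.trans h₂.symm) (h₂.trans h₃.symm) (h₃.trans h₄.symm)
    simp only [Fin.mk.injEq] at this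
    omega
  · have m₁ := max_eq_of_two_le_pentagonStarColor (hi.trans_eq h₁.symm)
    have m₂ := max_eq_of_two_le_pentagonStarColor (hi.trans_eq h₃.symm)
    omega

theorem exists_gallai_coloring_no_four_cycle {k n : ℕ} (hk : 2 ≤ k) (hn : n ≤ k + 3) :
    ∃ c : Fin n → Fin n → Fin k,
      ColorSymm c ∧ IsGallai c ∧ ¬ ∃ i : Fin k, MonoCycle c 4 i := by
  refine ⟨fun u v => ⟨pentagonStarColor u v, pentagonStarColor_lt hk (by omega) (by omega)⟩,
    fun u v => Fin.ext (pentagonStarColor_comm u v), fun u v w _ _ _ => ?_, ?_⟩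
  · simpa only [Fin.mk.injEq] using pentagonStarColor_gallai u v w
  · rintro ⟨i, f, hf, h⟩
    have ne {x y : Fin 4} (hxy : x ≠ y) : (f x : ℕ) ≠ f y :=
      fun e => hxy (hf (Fin.ext e))
    exact pentagonStarColor_no_four_cycle
      (ne (x := 0) (y := 1) (by decide)) (ne (y := 2) (by decide)) (ne (y := 3) (by decide))
      (ne (by decide)) (ne (by decide)) (ne (by decide))
      (congrArg Fin.val (h 0)) (congrArg Fin.val (h 1))
      (congrArg Fin.val (h 2)) (congrArg Fin.val (h 3))

/-- Lower bound construction: for all $k ≥ 2$ there is a Gallai $k$-coloring of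
$K_{k+3}$ with no monochromatic $C_4$; consequently $GR_k(C_4) ≥ k + 4$. -/
theorem gallai_ramsey_C4_lower (k : ℕ) (hk : 2 ≤ k) :
    (∃ c : Fin (k + 3) → Fin (k + 3) → Fin k,
        ColorSymm c ∧ IsGallai c ∧ ¬ ∃ i : Fin k, MonoCycle c 4 i) ∧
    ∀ N : ℕ, (0 < N ∧ ∀ c : Fin N → Fin N → Fin k,
        ColorSymm c → IsGallai c → ∃ i : Fin k, MonoCycle c 4 i) →
      k + 4 ≤ N := by
  refine ⟨exists_gallai_coloring_no_four_cycle hk le_rfl, fun N hN => ?_⟩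
  by_contra hlt
  obtain ⟨c, hsymm, hgallai, hc⟩ :=
    exists_gallai_coloring_no_four_cycle (n := N) hk (by omega)
  exact hc (hN.2 c hsymm hgallai)
end

section
/- For all integers k ≥ 1 and n ≥ 2, the k-color Ramsey number of the even cycle satisfies R_k(C_{2n}) ≥ (n−1)k + n + k if k is odd, and R_k(C_{2n}) ≥ (n−1)k + n + k − 1 if k is even. -/
/-- A monochromatic cycle unrolls to a periodic monochromatic sequence. -/
lemma MonoCycle.exists_periodic {V γ : Type*} {c : V → V → γ} {m : ℕ} {i : γ}
    (hm : 0 < m) (h : MonoCycle c m i) :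
    ∃ g : ℕ → V, (∀ t, c (g t) (g (t + 1)) = i) ∧ ∀ s t, g s = g t → s ≡ t [MOD m] := by
  obtain ⟨f, hf, hc⟩ := h
  refine ⟨fun t => f ⟨t % m, Nat.mod_lt _ hm⟩, fun t => ?_, fun s t hst => ?_⟩
  · have h := hc ⟨t % m, Nat.mod_lt _ hm⟩
    simpa [nextFin] using h
  · simpa [Nat.ModEq] using hf hst

lemma Nat.ModEq.eq_of_lt_add {m a s t : ℕ} (hs : s < m) (ht : t < m)
    (h : a + s ≡ a + t [MOD m]) : s = t := by
  have h' := Nat.ModEq.add_left_cancel' a h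
  rwa [Nat.ModEq, Nat.mod_eq_of_lt hs, Nat.mod_eq_of_lt ht] at h'

/-- A coloring without monochromatic `m`-cycles can be transported to fewer vertices and
at least as many colors. -/
lemma exists_coloring_fin {V γ : Type*} [Fintype V] [Fintype γ] {m N k : ℕ}
    (c : V → V → γ) (hc : ColorSymm c) (hm : ∀ i, ¬ MonoCycle c m i) (hm0 : 0 < m)
    (hN : N ≤ Fintype.card V) (hk : Fintype.card γ ≤ k) :
    ∃ c : Fin N → Fin N → Fin k, ColorSymm c ∧ ∀ i, ¬ MonoCycle c m i := by
  obtain ⟨φ⟩ : Nonempty (Fin N ↪ V) :=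
    Function.Embedding.nonempty_of_card_le (by simpa using hN)
  obtain ⟨ψ⟩ : Nonempty (γ ↪ Fin k) :=
    Function.Embedding.nonempty_of_card_le (by simpa using hk)
  refine ⟨fun u v => ψ (c (φ u) (φ v)), fun u v => congrArg ψ (hc _ _), ?_⟩
  rintro i ⟨f, hf, hi⟩
  refine hm (c (φ (f ⟨0, hm0⟩)) (φ (f (nextFin ⟨0, hm0⟩))))
    ⟨φ ∘ f, φ.injective.comp hf, fun j => ψ.injective ?_⟩
  exact (hi j).trans (hi _).symm

/-- Adding `n - 1` vertices, all of whose edges get a new color, creates no monochromatic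
cycle on `2 * n` vertices. -/
lemma exists_coloring_sum_option {V γ : Type*} {n : ℕ} (hn : 0 < n)
    (c : V → V → γ) (hc : ColorSymm c) (hm : ∀ i, ¬ MonoCycle c (2 * n) i) :
    ∃ c : V ⊕ Fin (n - 1) → V ⊕ Fin (n - 1) → Option γ,
      ColorSymm c ∧ ∀ i, ¬ MonoCycle c (2 * n) i := by
  refine ⟨fun u v => Sum.elim (fun a => Sum.elim (fun b => some (c a b)) (fun _ => none) v)
    (fun _ => none) u, ?_, ?_⟩
  · rintro (u | u) (v | v)
    · exact congrArg some (hc u v)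
    all_goals rfl
  · rintro (_ | i) h
    · obtain ⟨g, hg, hinj⟩ := h.exists_periodic (by omega)
      have key : ∀ s : Fin n, ∃ p : Fin (n - 1), ∃ r < 2, g (2 * s + r) = Sum.inr p := by
        intro s
        rcases h0 : g (2 * s) with a | p
        · rcases h1 : g (2 * s + 1) with b | p
          · have := hg (2 * s)
            simp [h0, h1] at this
          · exact ⟨p, 1, by omega, h1⟩
        · exact ⟨p, 0, by omega, h0⟩
      choose p r hr hp using key
      have hpi : Function.Injective p := by
        intro s t hst
        have h := hinj (2 * s + r s) (2 * t + r t) (by rw [hp, hp, hst])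
        have hs := hr s
        have ht := hr t
        rw [Nat.ModEq, Nat.mod_eq_of_lt (by omega), Nat.mod_eq_of_lt (by omega)] at h
        omega
      have := Fintype.card_le_of_injective p hpi
      simp only [Fintype.card_fin] at this
      omega
    · obtain ⟨f, hf, hi⟩ := h
      have key : ∀ j, ∃ a, f j = Sum.inl a := by
        intro j
        rcases h : f j with a | p
        · exact ⟨a, rfl⟩
        · have := hi j
          simp [h] at this
      choose f' hf' using key
      refine hm i ⟨f', fun s t hst => hf (by rw [hf', hf', hst]), fun j => ?_⟩
      simpa [hf'] using hi j

/-- Blow up every vertex of an edge-colored graph with loops, whose color classes have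
components of at most two vertices, to `n - 1` vertices, and add for each color `i` a vertex
joined to the blow-up in color `i`. -/
def blowUpColoring {P : Type*} {k : ℕ} (e : P → P → Fin k) (m : ℕ) :
    (P × Fin m) ⊕ Fin k → (P × Fin m) ⊕ Fin k → Fin k
  | .inl a, .inl b => e a.1 b.1
  | .inl _, .inr j => j
  | .inr i, .inl _ => i
  | .inr i, .inr j => min i j

lemma not_monoCycle_blowUpColoring {P : Type*} {k n : ℕ} (hn : 2 ≤ n) (e : P → P → Fin k)
    (he : ∀ i a, ∃ S : Finset P, a ∈ S ∧ S.card ≤ 2 ∧ ∀ x ∈ S, ∀ y, e x y = i → y ∈ S)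
    (i : Fin k) : ¬ MonoCycle (blowUpColoring e (n - 1)) (2 * n) i := by
  intro h
  obtain ⟨g, hg, hinj⟩ := h.exists_periodic (by omega)
  have inj : ∀ a s t, s < 2 * n → t < 2 * n → g (a + s) = g (a + t) → s = t :=
    fun a s t hs ht h => (hinj _ _ h).eq_of_lt_add hs ht
  have left : ∀ t j, g t = Sum.inr j → j ≠ i → g (t + 1) = Sum.inr i := by
    intro t j hj hji
    have h := hg t
    rcases h1 : g (t + 1) with b | l <;> rw [hj, h1] at h <;> simp only [blowUpColoring] at h
    · exact absurd h hji
    · rcases min_choice j l with h' | h' <;> rw [h'] at h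
      · exact absurd h hji
      · rw [h]
  have right : ∀ t j, g (t + 1) = Sum.inr j → j ≠ i → g t = Sum.inr i := by
    intro t j hj hji
    have h := hg t
    rcases h1 : g t with b | l <;> rw [hj, h1] at h <;> simp only [blowUpColoring] at h
    · exact absurd h hji
    · rcases min_choice l j with h' | h' <;> rw [h'] at h
      · rw [h]
      · exact absurd h hji
  have special : ∀ t j, g (t + 1) = Sum.inr j → j = i := by
    intro t j hj
    by_contra hji
    have := inj t 0 2 (by omega) (by omega)
      ((right t j hj hji).trans (left (t + 1) j hj hji).symm)
    omega
  obtain ⟨t₀, ht₀⟩ : ∃ t₀, ∀ s, s < 2 * n - 1 → ∃ a, g (t₀ + 1 + s) = Sum.inl a := by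
    by_cases hex : ∃ t, g t = Sum.inr i
    · obtain ⟨t, ht⟩ := hex
      refine ⟨t, fun s hs => ?_⟩
      rcases h : g (t + 1 + s) with a | j
      · exact ⟨a, rfl⟩
      · have hj : j = i := special (t + s) j (by rw [← h]; congr 1; omega)
        have := inj t 0 (1 + s) (by omega) (by omega) (by
          rw [← Nat.add_assoc, h, hj]; exact ht)
        omega
    · refine ⟨0, fun s _ => ?_⟩
      rcases h : g (0 + 1 + s) with a | j
      · exact ⟨a, rfl⟩
      · have hj : j = i := special s j (by rw [← h]; congr 1; omega)
        exact absurd ⟨_, hj ▸ h⟩ hex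
  obtain ⟨a₀, ha₀⟩ := ht₀ 0 (by omega)
  obtain ⟨S, haS, hS, hcl⟩ := he i a₀.1
  have mem : ∀ s, s < 2 * n - 1 →
      ∃ a ∈ S ×ˢ (Finset.univ : Finset (Fin (n - 1))), g (t₀ + 1 + s) = Sum.inl a := by
    intro s
    induction s with
    | zero => exact fun _ => ⟨a₀, by simpa using haS, ha₀⟩
    | succ s ih =>
      intro hs
      obtain ⟨a, ha, hga⟩ := ih (by omega)
      obtain ⟨b, hb⟩ := ht₀ (s + 1) hs
      have h := hg (t₀ + 1 + s)
      rw [Nat.add_assoc _ s 1, hb, hga] at h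
      refine ⟨b, ?_, hb⟩
      simp only [Finset.mem_product, Finset.mem_univ, and_true] at ha ⊢
      exact hcl _ ha _ h
  have : Nonempty (P × Fin (n - 1)) := ⟨a₀⟩
  choose! φ hφ hgφ using mem
  have hcard : (Finset.range (2 * n - 1)).card ≤
      (S ×ˢ (Finset.univ : Finset (Fin (n - 1)))).card := by
    refine Finset.card_le_card_of_injOn φ (fun s hs => hφ s (by simpa using hs)) ?_
    intro s hs t ht hst
    simp only [Finset.coe_range, Set.mem_Iio] at hs ht
    exact inj (t₀ + 1) s t (by omega) (by omega) (by rw [hgφ s hs, hgφ t ht, hst])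
  rw [Finset.card_product, Finset.card_range, Finset.card_univ, Fintype.card_fin] at hcard
  have := Nat.mul_le_mul_right (n - 1) hS
  omega

/-- For odd `k`, the complete graph on `k + 1` vertices with loops has an edge coloring with
`k` colors all of whose color classes have components of at most two vertices. -/
lemma exists_coloring_components_card_le_two {k : ℕ} (hk : Odd k) :
    ∃ e : Option (ZMod k) → Option (ZMod k) → ZMod k, (∀ a b, e a b = e b a) ∧
      ∀ i a, ∃ S : Finset (Option (ZMod k)),
        a ∈ S ∧ S.card ≤ 2 ∧ ∀ x ∈ S, ∀ y, e x y = i → y ∈ S := by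
  classical
  obtain ⟨w, hw⟩ : ∃ w : ZMod k, w + w = 1 := by
    obtain ⟨r, hr⟩ := hk
    refine ⟨r + 1, ?_⟩
    have : ((2 * r + 1 : ℕ) : ZMod k) = 0 := by rw [← hr]; simp
    push_cast at this
    linear_combination this
  let e : Option (ZMod k) → Option (ZMod k) → ZMod k := fun a b =>
    match a, b with
    | some a, some b => a + b
    | some a, none => a + a
    | none, some b => b + b
    | none, none => 0
  have half : ∀ i b : ZMod k, b + b = i → b = w * i := fun i b h => by
    linear_combination w * h - b * hw
  have main : ∀ i : ZMod k, ∀ x ∈ ({none, some (w * i)} : Finset (Option (ZMod k))),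
      ∀ y, e x y = i → y ∈ ({none, some (w * i)} : Finset (Option (ZMod k))) := by
    intro i x hx y hy
    simp only [Finset.mem_insert, Finset.mem_singleton] at hx ⊢
    rcases y with _ | b
    · exact Or.inl rfl
    · refine Or.inr (congrArg some ?_)
      rcases hx with rfl | rfl
      · exact half i b hy
      · have hy' : w * i + b = i := hy
        linear_combination hy' - i * hw
  refine ⟨e, ?_, ?_⟩
  · rintro (_ | a) (_ | b) <;> simp [e, add_comm]
  · rintro i (_ | a)
    · exact ⟨{none, some (w * i)}, by simp, Finset.card_le_two, main i⟩
    · by_cases ha : a + a = i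
      · exact ⟨{none, some (w * i)}, by simp [half i a ha], Finset.card_le_two, main i⟩
      · refine ⟨{some a, some (i - a)}, by simp, Finset.card_le_two, ?_⟩
        intro x hx y hy
        simp only [Finset.mem_insert, Finset.mem_singleton] at hx ⊢
        rcases hx with rfl | rfl <;> rcases y with _ | b
        · exact absurd hy ha
        · have hy' : a + b = i := hy
          exact Or.inr (congrArg some (by linear_combination hy'))
        · have hy' : (i - a) + (i - a) = i := hy
          exact absurd (by linear_combination -hy') ha
        · have hy' : (i - a) + b = i := hy
          exact Or.inl (congrArg some (by linear_combination hy'))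

lemma exists_coloring_of_odd {k n : ℕ} (hk : Odd k) (hn : 2 ≤ n) :
    ∃ c : Fin ((k + 1) * (n - 1) + k) → Fin ((k + 1) * (n - 1) + k) → Fin k,
      ColorSymm c ∧ ∀ i, ¬ MonoCycle c (2 * n) i := by
  have : NeZero k := ⟨hk.pos.ne'⟩
  obtain ⟨e, hsymm, he⟩ := exists_coloring_components_card_le_two hk
  let ψ : ZMod k ≃ Fin k := Fintype.equivFinOfCardEq (ZMod.card k)
  refine exists_coloring_fin (blowUpColoring (fun a b => ψ (e a b)) (n - 1)) ?_
    (not_monoCycle_blowUpColoring hn _ fun i a => ?_) (by omega) ?_ (by simp)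
  · rintro (u | u) (v | v)
    · exact congrArg ψ (hsymm _ _)
    · rfl
    · rfl
    · exact min_comm _ _
  · obtain ⟨S, haS, hS, hcl⟩ := he (ψ.symm i) a
    exact ⟨S, haS, hS, fun x hx y hy => hcl x hx y (by rw [← hy]; simp)⟩
  · simp [ZMod.card]

/-- Lower bounds for the $k$-color Ramsey number of even cycles (Dzido–Nowik–Szuca):
for all $k ≥ 1$ and $n ≥ 2$, $R_k(C_{2n}) ≥ (n-1)k+n+k$ if $k$ is odd and
$R_k(C_{2n}) ≥ (n-1)k+n+k-1$ if $k$ is even. -/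
theorem multicolor_ramsey_even_cycle_lower (k n : ℕ) (hk : 1 ≤ k) (hn : 2 ≤ n) :
    ∀ N : ℕ, (∀ c : Fin N → Fin N → Fin k,
        ColorSymm c → ∃ i : Fin k, MonoCycle c (2 * n) i) →
      (Odd k → (n - 1) * k + n + k ≤ N) ∧
      (Even k → (n - 1) * k + n + k - 1 ≤ N) := by
  intro N h
  obtain ⟨m, rfl⟩ : ∃ m, n = m + 1 := ⟨n - 1, by omega⟩
  constructor <;> intro hpar <;> by_contra! hlt
  · obtain ⟨c, hc, hm⟩ := exists_coloring_of_odd hpar hn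
    obtain ⟨c', hc', hm'⟩ := exists_coloring_fin (N := N) (k := k) c hc hm (by omega)
      (by simp only [Fintype.card_fin, Nat.add_sub_cancel] at hlt ⊢; linarith) (by simp)
    obtain ⟨i, hi⟩ := h c' hc'
    exact hm' i hi
  · obtain ⟨l, rfl⟩ : ∃ l, k = l + 1 := ⟨k - 1, by omega⟩
    have hl : Odd l := by
      rw [Nat.even_add_one] at hpar
      exact Nat.not_even_iff_odd.mp hpar
    obtain ⟨c, hc, hm⟩ := exists_coloring_of_odd hl hn
    obtain ⟨d, hd, hdm⟩ := exists_coloring_sum_option (by omega) c hc hm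
    obtain ⟨c', hc', hm'⟩ := exists_coloring_fin (N := N) (k := l + 1) d hd hdm (by omega)
      (by
        simp only [Fintype.card_sum, Fintype.card_fin, Nat.add_sub_cancel] at hlt ⊢
        have : m * (l + 1) + (m + 1) + (l + 1) - 1 = (l + 1) * m + m + l + 1 := by
          rw [mul_comm]; omega
        linarith) (by simp)
    obtain ⟨i, hi⟩ := h c' hc'
    exact hm' i hi
end

section
/- For all integers n ≥ 3, the 2-color Ramsey number of the even cycle satisfies R(C_{2n}, C_{2n}) = 3n − 1. -/
/-- `f` runs around a cycle on `s` vertices in `G`. -/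
structure IsCyc {V : Type*} (G : SimpleGraph V) (s : ℕ) (f : ℕ → V) : Prop where
  periodic : ∀ i, f (i + s) = f i
  adj : ∀ i, G.Adj (f i) (f (i + 1))
  inj : ∀ i < s, ∀ j < s, f i = f j → i = j

/-- `G` contains a cycle on `s` vertices. -/
def HasCyc {V : Type*} (G : SimpleGraph V) (s : ℕ) : Prop := ∃ f, IsCyc G s f

/-- `l` lists the vertices of a walk from `a` to `b`. -/
structure IsPth {V : Type*} (G : SimpleGraph V) (a b : V) (l : List V) : Prop where
  chain : l.IsChain G.Adj
  head : l.head? = some a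
  last : l.getLast? = some b

/-- The list `f a, f (a + 1), …, f (a + k - 1)`. -/
def seg {V : Type*} (f : ℕ → V) (a k : ℕ) : List V := (List.range k).map fun j => f (a + j)

section Basic

variable {V : Type*} {G : SimpleGraph V} {a b c d : V} {l l' : List V} {f : ℕ → V} {s : ℕ}

theorem IsPth.singleton (G : SimpleGraph V) (a : V) : IsPth G a a [a] := ⟨by simp, rfl, rfl⟩

theorem IsPth.append (h : IsPth G a b l) (hbc : G.Adj b c) (h' : IsPth G c d l') :
    IsPth G a d (l ++ l') := by
  refine ⟨?_, by simp [h.head], by simp [h'.last]⟩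
  rw [List.isChain_append]
  refine ⟨h.chain, h'.chain, ?_⟩
  simp [h.last, h'.head, hbc]

theorem IsPth.cons (h : IsPth G b c l) (hab : G.Adj a b) : IsPth G a c (a :: l) :=
  (IsPth.singleton G a).append hab h

theorem IsPth.reverse (h : IsPth G a b l) : IsPth G b a l.reverse := by
  refine ⟨?_, by simp [h.last], by simp [h.head]⟩
  rw [List.isChain_reverse]
  exact h.chain.imp fun _ _ h => h.symm

theorem IsPth.hasCyc (h : IsPth G a b l) (hba : G.Adj b a) (hn : l.Nodup) :
    HasCyc G l.length := by
  have h0 : 0 < l.length := by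
    cases l with
    | nil => simpa using h.head
    | cons => simp
  have hlt : ∀ i, i % l.length < l.length := fun i => Nat.mod_lt _ h0
  refine ⟨fun i => l[i % l.length]'(hlt i), fun i => by simp, fun i => ?_, fun i hi j hj hij => ?_⟩
  · by_cases hi : i % l.length + 1 < l.length
    · have e : (i + 1) % l.length = i % l.length + 1 := by
        rw [Nat.add_mod, Nat.mod_eq_of_lt (a := 1) (by omega), Nat.mod_eq_of_lt hi]
      simp only [e]
      exact List.isChain_iff_getElem.1 h.chain _ hi
    · have e1 : i % l.length = l.length - 1 := by have := hlt i; omega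
      have e : (i + 1) % l.length = 0 := by
        rw [Nat.add_mod, e1, Nat.add_mod_mod, Nat.sub_add_cancel h0, Nat.mod_self]
      have hh := h.head
      have hl := h.last
      rw [List.head?_eq_getElem?, List.getElem?_eq_getElem h0, Option.some_inj] at hh
      rw [List.getLast?_eq_getElem?, List.getElem?_eq_getElem (by omega), Option.some_inj] at hl
      simp only [e, e1, hh, hl, hba]
  · rw [hn.getElem_inj_iff, Nat.mod_eq_of_lt hi, Nat.mod_eq_of_lt hj] at hij
    exact hij

@[simp] theorem length_seg (f : ℕ → V) (a k : ℕ) : (seg f a k).length = k := by simp [seg]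

theorem mem_seg {a k : ℕ} {v : V} : v ∈ seg f a k ↔ ∃ i, a ≤ i ∧ i < a + k ∧ f i = v := by
  simp only [seg, List.mem_map, List.mem_range]
  constructor
  · rintro ⟨j, hj, rfl⟩
    exact ⟨a + j, by omega, by omega, rfl⟩
  · rintro ⟨i, h1, h2, rfl⟩
    exact ⟨i - a, by omega, by congr 1; omega⟩

theorem isPth_seg {a b : ℕ} (hab : a ≤ b)
    (h : ∀ i, a ≤ i → i < b → G.Adj (f i) (f (i + 1))) :
    IsPth G (f a) (f b) (seg f a (b + 1 - a)) := by
  induction b, hab using Nat.le_induction with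
  | base => simpa [seg] using IsPth.singleton G (f a)
  | succ b hab ih =>
    have e : seg f a (b + 1 + 1 - a) = seg f a (b + 1 - a) ++ [f (b + 1)] := by
      rw [show b + 1 + 1 - a = b + 1 - a + 1 by omega, seg, List.range_succ, List.map_append]
      simp only [List.map_cons, List.map_nil, seg]
      congr 3
      omega
    rw [e]
    exact (ih fun i h1 h2 => h i h1 (by omega)).append (h b hab (by omega)) (.singleton G _)

theorem IsCyc.ne (hf : IsCyc G s f) {i j : ℕ} (hij : i < j) (hj : j < i + s) : f i ≠ f j := by
  have key : ∀ i, f (i % s) = f i := fun i => by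
    have : ∀ k, f (i % s + k * s) = f (i % s) := fun k => by
      induction k with
      | zero => simp
      | succ k ih => rw [Nat.succ_mul, ← Nat.add_assoc, hf.periodic, ih]
    rw [← this (i / s), Nat.mod_add_div']
  intro h
  rw [← key i, ← key j] at h
  have hs : 0 < s := by omega
  have := hf.inj _ (Nat.mod_lt _ hs) _ (Nat.mod_lt _ hs) h
  have hd : s ∣ j - i := (Nat.modEq_iff_dvd' hij.le).1 this
  have := Nat.le_of_dvd (by omega) hd
  omega

theorem IsCyc.eq_of_lt (hf : IsCyc G s f) {i j : ℕ} (hi : i < j + s) (hj : j < i + s)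
    (h : f i = f j) : i = j := by
  rcases lt_trichotomy i j with h1 | h1 | h1
  · exact absurd h (hf.ne h1 hj)
  · exact h1
  · exact absurd h.symm (hf.ne h1 hi)

theorem IsCyc.shift (hf : IsCyc G s f) (t : ℕ) : IsCyc G s (fun i => f (t + i)) where
  periodic i := by rw [← Nat.add_assoc, hf.periodic]
  adj i := hf.adj (t + i)
  inj i hi j hj h := by
    have := hf.eq_of_lt (by omega) (by omega) h
    omega

theorem IsCyc.isPth_seg (hf : IsCyc G s f) {a b : ℕ} (hab : a ≤ b) :
    IsPth G (f a) (f b) (seg f a (b + 1 - a)) :=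
  _root_.isPth_seg hab fun i _ _ => hf.adj i

theorem nodup_seg {a k : ℕ}
    (h : ∀ i j, a ≤ i → i < a + k → a ≤ j → j < a + k → f i = f j → i = j) :
    (seg f a k).Nodup := by
  refine List.Nodup.map_on (fun i hi j hj hij => ?_) List.nodup_range
  rw [List.mem_range] at hi hj
  have := h _ _ (by omega) (by omega) (by omega) (by omega) hij
  omega

theorem IsCyc.nodup_seg (hf : IsCyc G s f) {a k : ℕ} (hk : k ≤ s) : (seg f a k).Nodup :=
  _root_.nodup_seg fun _ _ _ _ _ _ h => hf.eq_of_lt (by omega) (by omega) h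

theorem IsCyc.disjoint_seg (hf : IsCyc G s f) {a k b m : ℕ} (h1 : a + k ≤ b) (h2 : b + m ≤ a + s) :
    (seg f a k).Disjoint (seg f b m) := by
  intro v hv hv'
  obtain ⟨i, _, _, rfl⟩ := mem_seg.1 hv
  obtain ⟨j, _, _, hj⟩ := mem_seg.1 hv'
  have := hf.eq_of_lt (by omega) (by omega) hj
  omega

theorem notMem_seg {y : V} (hy : ∀ i, f i ≠ y) (a k : ℕ) : y ∉ seg f a k := fun h => by
  obtain ⟨i, _, _, h⟩ := mem_seg.1 h
  exact hy i h

theorem IsCyc.zero_adj (hf : IsCyc G s f) {v : V} : G.Adj (f s) v ↔ G.Adj (f 0) v := by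
  rw [← hf.periodic 0, Nat.zero_add]

end Basic

section Extend

variable {V : Type*} {G : SimpleGraph V} {f : ℕ → V} {s : ℕ}

/-- Inserting a vertex between two consecutive neighbours. -/
theorem IsCyc.insert_one (hf : IsCyc G s f) (hs : 1 ≤ s) {y : V} (hy : ∀ i, f i ≠ y) {t : ℕ}
    (h0 : G.Adj y (f t)) (h1 : G.Adj y (f (t + 1))) : HasCyc G (s + 1) := by
  have hf' := hf.shift t
  have := ((hf'.isPth_seg hs).cons h1).hasCyc (hf'.zero_adj.2 h0.symm)
    (List.nodup_cons.2 ⟨notMem_seg (fun i => hy _) _ _, hf'.nodup_seg (by omega)⟩)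
  simpa using this

/-- Replacing an edge of the cycle by a path through two adjacent new vertices. -/
theorem IsCyc.insert_edge (hf : IsCyc G s f) (hs : 1 ≤ s) {y z : V} (hy : ∀ i, f i ≠ y)
    (hz : ∀ i, f i ≠ z) (hyz : G.Adj y z) {t : ℕ}
    (h0 : G.Adj y (f t)) (h1 : G.Adj z (f (t + 1))) : HasCyc G (s + 2) := by
  have hf' := hf.shift t
  have := (((hf'.isPth_seg hs).cons h1).cons hyz).hasCyc (hf'.zero_adj.2 h0.symm)
    (by simp [notMem_seg (f := fun i => f (t + i)) (fun i => hy _),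
      notMem_seg (f := fun i => f (t + i)) (fun i => hz _), hyz.ne, hf'.nodup_seg])
  simpa using this

/-- Replacing a vertex of the cycle by two adjacent new vertices. -/
theorem IsCyc.replace_vertex (hf : IsCyc G s f) (hs : 2 ≤ s) {y z : V} (hy : ∀ i, f i ≠ y)
    (hz : ∀ i, f i ≠ z) (hyz : G.Adj y z) {t : ℕ}
    (h0 : G.Adj y (f t)) (h1 : G.Adj z (f (t + 2))) : HasCyc G (s + 1) := by
  have hf' := hf.shift t
  have := (((hf'.isPth_seg hs).cons h1).cons hyz).hasCyc (hf'.zero_adj.2 h0.symm)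
    (by
      have := hf'.nodup_seg (a := 2) (k := s - 1) (by omega)
      simp [notMem_seg (f := fun i => f (t + i)) (fun i => hy _),
        notMem_seg (f := fun i => f (t + i)) (fun i => hz _), hyz.ne, this])
  simpa [show s - 1 + 1 + 1 = s + 1 by omega] using this

/-- Two new vertices `y`, `z` joined to the two ends of two edges of the cycle. -/
theorem IsCyc.insert_two (hf : IsCyc G s f) {y z : V} (hy : ∀ i, f i ≠ y)
    (hz : ∀ i, f i ≠ z) (hyz : y ≠ z) {t u : ℕ} (hu : 1 ≤ u) (hus : u < s)
    (h0 : G.Adj y (f t)) (h1 : G.Adj z (f (t + 1)))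
    (h2 : G.Adj y (f (t + u))) (h3 : G.Adj z (f (t + u + 1))) : HasCyc G (s + 2) := by
  have hf' := hf.shift t
  have := (((hf'.isPth_seg hu).reverse.append h1.symm
    ((hf'.isPth_seg (show u + 1 ≤ s by omega)).cons h3)).cons h2).hasCyc (hf'.zero_adj.2 h0.symm)
    (by
      have a1 := hf'.nodup_seg (a := 1) (k := u) (by omega)
      have a2 := hf'.nodup_seg (a := u + 1) (k := s - u) (by omega)
      have a3 := hf'.disjoint_seg (a := 1) (k := u) (b := u + 1) (m := s - u) (by omega) (by omega)
      simp [List.nodup_append', notMem_seg (f := fun i => f (t + i)) (fun i => hy _),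
        notMem_seg (f := fun i => f (t + i)) (fun i => hz _), hyz, a1, a2, a3])
  have e : u + (s - u + 1) + 1 = s + 2 := by omega
  simpa [e] using this

end Extend

section Shorten

variable {V : Type*} {G : SimpleGraph V} {f : ℕ → V} {s : ℕ}

theorem IsCyc.chord_two (hf : IsCyc G s f) (hs : 2 ≤ s) {t : ℕ} (h : G.Adj (f t) (f (t + 2))) :
    HasCyc G (s - 1) := by
  have hf' := hf.shift t
  simpa using (hf'.isPth_seg hs).hasCyc (hf'.zero_adj.2 h) (hf'.nodup_seg (by omega))

theorem IsCyc.chord_three (hf : IsCyc G s f) (hs : 3 ≤ s) {t : ℕ}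
    (h : G.Adj (f t) (f (t + 3))) : HasCyc G (s - 2) := by
  have hf' := hf.shift t
  simpa using (hf'.isPth_seg hs).hasCyc (hf'.zero_adj.2 h) (hf'.nodup_seg (by omega))

theorem IsCyc.two_chords (hf : IsCyc G s f) {t j : ℕ} (hj : 2 ≤ j) (hjs : j + 2 ≤ s)
    (h : G.Adj (f t) (f (t + 2))) (h' : G.Adj (f (t + j)) (f (t + j + 2))) :
    HasCyc G (s - 2) := by
  have hf' := hf.shift t
  have := ((hf'.isPth_seg hj).append h' (hf'.isPth_seg hjs)).hasCyc (hf'.zero_adj.2 h)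
    ((hf'.nodup_seg (by omega)).append (hf'.nodup_seg (by omega))
      (hf'.disjoint_seg (by omega) (by omega)))
  have e : j - 1 + (s - (j + 1)) = s - 2 := by omega
  simpa [e] using this

theorem IsCyc.crossing_right (hf : IsCyc G s f) {t j : ℕ} (hj : 1 ≤ j) (hjs : j + 2 ≤ s)
    (h : G.Adj (f t) (f (t + j))) (h' : G.Adj (f (t + 1)) (f (t + j + 2))) :
    HasCyc G (s - 1) := by
  have hf' := hf.shift t
  have := ((hf'.isPth_seg hj).reverse.append h' (hf'.isPth_seg hjs)).hasCyc (hf'.zero_adj.2 h)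
    ((List.nodup_reverse.2 (hf'.nodup_seg (by omega))).append (hf'.nodup_seg (by omega))
      (List.disjoint_reverse_left.2 (hf'.disjoint_seg (by omega) (by omega))))
  have e : j + (s - (j + 1)) = s - 1 := by omega
  simpa [e] using this

theorem IsCyc.crossing_left (hf : IsCyc G s f) {t j : ℕ} (hj : 2 ≤ j) (hjs : j + 1 ≤ s)
    (h : G.Adj (f t) (f (t + j))) (h' : G.Adj (f (t + 2)) (f (t + j + 1))) :
    HasCyc G (s - 1) := by
  have hf' := hf.shift t
  have := ((hf'.isPth_seg hj).reverse.append h' (hf'.isPth_seg hjs)).hasCyc (hf'.zero_adj.2 h)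
    ((List.nodup_reverse.2 (hf'.nodup_seg (by omega))).append (hf'.nodup_seg (by omega))
      (List.disjoint_reverse_left.2 (hf'.disjoint_seg (by omega) (by omega))))
  have e : j - 1 + (s - j) = s - 1 := by omega
  simpa [e] using this

theorem IsCyc.compl_adj (hf : IsCyc G s f) {i j : ℕ} (hij : i < j) (hj : j < i + s)
    (h : ¬ G.Adj (f i) (f j)) : Gᶜ.Adj (f i) (f j) :=
  (SimpleGraph.compl_adj _ _ _).2 ⟨hf.ne hij hj, h⟩

/-- A monochromatic odd cycle yields a monochromatic cycle that is shorter by one. -/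
theorem hasCyc_of_odd {k : ℕ} (hk : 3 ≤ k) (h : HasCyc G (2 * k + 1)) :
    HasCyc G (2 * k) ∨ HasCyc Gᶜ (2 * k) := by
  obtain ⟨f, hf⟩ := h
  by_contra! hno
  obtain ⟨hG, hB⟩ := hno
  have two : ∀ i, Gᶜ.Adj (f i) (f (i + 2)) := fun i =>
    hf.compl_adj (by omega) (by omega) fun h => hG (hf.chord_two (by omega) h)
  have hg : IsCyc Gᶜ (2 * k + 1) (fun i => f (2 * i)) := by
    refine ⟨fun i => ?_, fun i => two _, fun i hi j hj hij => ?_⟩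
    · rw [show 2 * (i + (2 * k + 1)) = 2 * i + (2 * k + 1) + (2 * k + 1) by ring, hf.periodic,
        hf.periodic]
    · by_contra hne
      wlog hlt : i < j generalizing i j
      · exact this j hj i hi hij.symm (Ne.symm hne) (by omega)
      by_cases h1 : 2 * j < 2 * i + (2 * k + 1)
      · exact hf.ne (by omega) h1 hij
      · refine hf.ne (i := 2 * i + (2 * k + 1)) (j := 2 * j) (by omega) (by omega) ?_
        rw [hf.periodic]
        exact hij
  have four' : ∀ i, G.Adj (f (2 * i)) (f (2 * i + 4)) := fun i => by
    have := hg.compl_adj (i := i) (j := i + 2) (by omega) (by omega)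
      fun h => hB (hg.chord_two (by omega) h)
    rwa [compl_compl] at this
  have four : ∀ i, G.Adj (f i) (f (i + 4)) := fun i => by
    rcases Nat.even_or_odd' i with ⟨j, rfl | rfl⟩
    · exact four' j
    · have := four' (j + k + 1)
      rw [show 2 * (j + k + 1) = 2 * j + 1 + (2 * k + 1) by ring, hf.periodic,
        show 2 * j + 1 + (2 * k + 1) + 4 = 2 * j + 1 + 4 + (2 * k + 1) by ring, hf.periodic] at this
      exact this
  have three : ∀ i, ¬ G.Adj (f (i + 2)) (f (i + 5)) := fun i h =>
    hG (hf.crossing_left (j := 4) (by omega) (by omega) (four i) h)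
  have five : ∀ i, ¬ G.Adj (f (i + 1)) (f (i + 6)) := fun i h =>
    hG (hf.crossing_right (j := 4) (by omega) (by omega) (four i) h)
  obtain rfl | hk4 : k = 3 ∨ 4 ≤ k := by omega
  · refine three 2 ?_
    have := four 0
    rw [← hf.periodic 0] at this
    exact this.symm
  · refine hB (hg.crossing_right (t := 1) (j := k + 2) (by omega) (by omega) ?_ ?_)
    · have := hf.compl_adj (by omega) (by omega) (three 0)
      rw [show 2 * (1 + (k + 2)) = 0 + 5 + (2 * k + 1) by ring, hf.periodic]
      exact this
    · have := hf.compl_adj (by omega) (by omega) (five 3)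
      rw [show 2 * (1 + (k + 2) + 2) = 3 + 6 + (2 * k + 1) by ring, hf.periodic]
      exact this

/-- A monochromatic even cycle yields a monochromatic cycle that is shorter by two. -/
theorem hasCyc_of_even {k : ℕ} (hk : 3 ≤ k) (h : HasCyc G (2 * k)) :
    HasCyc G (2 * k - 2) ∨ HasCyc Gᶜ (2 * k - 2) := by
  obtain ⟨f, hf⟩ := h
  by_contra! hno
  obtain ⟨hG, hB⟩ := hno
  obtain ⟨t, ht⟩ : ∃ t, ∀ j, j + 2 < 2 * k → ¬ G.Adj (f (t + j)) (f (t + j + 2)) := by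
    by_cases h0 : ∃ i, G.Adj (f i) (f (i + 2))
    · obtain ⟨i, hi, hi'⟩ : ∃ i, G.Adj (f i) (f (i + 2)) ∧
          ¬ G.Adj (f (i + (2 * k - 1))) (f (i + (2 * k - 1) + 2)) := by
        obtain ⟨i, hi⟩ := h0
        by_cases h1 : G.Adj (f (i + (2 * k - 1))) (f (i + (2 * k - 1) + 2))
        · refine ⟨_, h1, fun h2 => hG (hf.two_chords (j := 2 * k - 2) (by omega) (by omega) hi ?_)⟩
          have e : i + (2 * k - 1) + (2 * k - 1) = i + (2 * k - 2) + 2 * k := by omega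
          rwa [e, hf.periodic, show i + (2 * k - 2) + 2 * k + 2 = i + (2 * k - 2) + 2 + 2 * k by ring,
            hf.periodic] at h2
        · exact ⟨i, hi, h1⟩
      refine ⟨i + 2, fun j hj h => ?_⟩
      by_cases hj' : j + 4 ≤ 2 * k
      · refine hG (hf.two_chords (j := j + 2) (by omega) (by omega) hi ?_)
        rwa [show i + (j + 2) = i + 2 + j by ring]
      · obtain rfl : j = 2 * k - 3 := by omega
        rw [show i + 2 + (2 * k - 3) = i + (2 * k - 1) by omega] at h
        exact hi' h
    · push Not at h0
      exact ⟨0, fun j _ => h0 _⟩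
  have hf' := hf.shift t
  set g := fun i => f (t + i) with hgdef
  have two : ∀ j, j + 2 < 2 * k → Gᶜ.Adj (g j) (g (j + 2)) := fun j hj =>
    hf'.compl_adj (by omega) (by omega) (ht j hj)
  have three : ∀ i, Gᶜ.Adj (g i) (g (i + 3)) := fun i =>
    hf'.compl_adj (by omega) (by omega) fun h => hG (hf'.chord_three (by omega) h)
  have p1 : IsPth Gᶜ (g 0) (g (2 * (k - 2))) (seg (fun i => g (2 * i)) 0 (k - 2 + 1 - 0)) :=
    isPth_seg (f := fun i => g (2 * i)) (a := 0) (b := k - 2) (by omega)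
      fun i _ hi => two (2 * i) (by omega)
  have p2 : IsPth Gᶜ (g 3) (g (2 * (k - 1) + 1))
      (seg (fun i => g (2 * i + 1)) 1 (k - 1 + 1 - 1)) :=
    isPth_seg (f := fun i => g (2 * i + 1)) (a := 1) (b := k - 1) (by omega)
      fun i _ hi => two (2 * i + 1) (by omega)
  have e : 2 * (k - 1) + 1 = 2 * (k - 2) + 3 := by omega
  refine hB ?_
  have := (p1.append (by rw [e]; exact three _) p2.reverse).hasCyc (three 0).symm (by
    refine (nodup_seg fun i j _ _ _ _ h => ?_).append
      (List.nodup_reverse.2 (nodup_seg fun i j _ _ _ _ h => ?_))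
      (List.disjoint_reverse_right.2 fun v hv hv' => ?_)
    · have := hf'.eq_of_lt (by omega) (by omega) h
      omega
    · have := hf'.eq_of_lt (by omega) (by omega) h
      omega
    · obtain ⟨i, _, _, rfl⟩ := mem_seg.1 hv
      obtain ⟨j, _, _, hj⟩ := mem_seg.1 hv'
      have := hf'.eq_of_lt (by omega) (by omega) hj
      omega)
  have e : k - 2 + 1 + (k - 1) = 2 * k - 2 := by omega
  simpa [e] using this

/-- Monochromatic cycles can be shortened to any even length that is at least six. -/
theorem hasCyc_of_le {n s : ℕ} (hn : 3 ≤ n) (hs : 2 * n ≤ s) (h : HasCyc G s ∨ HasCyc Gᶜ s) :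
    HasCyc G (2 * n) ∨ HasCyc Gᶜ (2 * n) := by
  have odd : ∀ k, 3 ≤ k → HasCyc G (2 * k + 1) ∨ HasCyc Gᶜ (2 * k + 1) →
      HasCyc G (2 * k) ∨ HasCyc Gᶜ (2 * k) := by
    rintro k hk (h | h)
    · exact hasCyc_of_odd hk h
    · simpa [or_comm] using hasCyc_of_odd hk h
  have even : ∀ k, n ≤ k → HasCyc G (2 * k) ∨ HasCyc Gᶜ (2 * k) →
      HasCyc G (2 * n) ∨ HasCyc Gᶜ (2 * n) := by
    intro k hk
    induction k, hk using Nat.le_induction with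
    | base => exact id
    | succ k hk ih =>
      rintro (h | h)
      · exact ih (hasCyc_of_even (k := k + 1) (by omega) h)
      · exact ih (by simpa [Nat.mul_add, or_comm] using hasCyc_of_even (k := k + 1) (by omega) h)
  rcases Nat.even_or_odd' s with ⟨k, rfl | rfl⟩
  · exact even k (by omega) h
  · exact even k (by omega) (odd k (by omega) h)

end Shorten

section Links

variable {V : Type*}

open Classical in
/-- The common neighbours of `a` and `b` in `X`. -/
noncomputable def common (B : SimpleGraph V) (X : Finset V) (a b : V) : Finset V :=
  X.filter fun x => B.Adj a x ∧ B.Adj b x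

variable {B : SimpleGraph V} {X Y : Finset V} {a b c x : V}

theorem mem_common : x ∈ common B X a b ↔ x ∈ X ∧ B.Adj a x ∧ B.Adj b x := by
  simp [common]

theorem common_comm (B : SimpleGraph V) (X : Finset V) (a b : V) :
    common B X a b = common B X b a := by
  ext
  simp only [mem_common, and_comm (a := B.Adj a _)]

open Classical in
/-- Vertices in a list can be linked greedily by distinct common neighbours. -/
theorem exists_link_path_list (ys : List V) : ∀ (a : V) (F : Finset V), (a :: ys).Nodup →
    (∀ v ∈ a :: ys, v ∉ X) →
    (∀ u ∈ a :: ys, ∀ v ∈ a :: ys, u ≠ v → ys.length ≤ (common B X u v \ F).card) →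
    ∃ (b : V) (l : List V) (U : Finset V), (a :: ys).getLast? = some b ∧ IsPth B a b l ∧ l.Nodup ∧
      l.length = 2 * ys.length + 1 ∧ U ⊆ X \ F ∧ U.card = ys.length ∧
      ∀ v ∈ l, v ∈ a :: ys ∨ v ∈ U := by
  induction ys with
  | nil =>
    intro a F _ _ _
    exact ⟨a, [a], ∅, rfl, .singleton B a, by simp, by simp, by simp, by simp, by simp⟩
  | cons c ys ih =>
    intro a F hn hX hK
    have hac : a ≠ c := by
      rintro rfl
      simp at hn
    obtain ⟨x, hx⟩ : (common B X a c \ F).Nonempty := by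
      rw [← Finset.card_pos]
      have := hK a (by simp) c (by simp) hac
      simp only [List.length_cons] at this
      omega
    rw [Finset.mem_sdiff, mem_common] at hx
    obtain ⟨⟨hxX, hax, hcx⟩, hxF⟩ := hx
    obtain ⟨b, l, U, hb, hl, hln, hlen, hU, hUc, hmem⟩ := ih c (insert x F) hn.of_cons
      (fun v hv => hX v (List.mem_cons_of_mem _ hv)) (fun u hu v hv huv => by
        have := hK u (List.mem_cons_of_mem _ hu) v (List.mem_cons_of_mem _ hv) huv
        have h2 := Finset.card_le_card_sdiff_add_card (s := common B X u v \ F) (t := {x})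
        rw [sdiff_sdiff_left, Finset.sup_eq_union, Finset.union_comm, ← Finset.insert_eq,
          Finset.card_singleton] at h2
        simp only [List.length_cons] at this
        omega)
    have hxU : x ∉ U := fun h => by simpa using hU h
    refine ⟨b, a :: x :: l, insert x U, by simpa using hb, (hl.cons hcx.symm).cons hax, ?_,
      by simp [hlen]; omega, ?_, by simp [hxU, hUc], ?_⟩
    · have haU : a ∉ U := fun h => hX a (by simp) (Finset.mem_sdiff.1 (hU h)).1
      have hxc : x ∉ c :: ys := fun h => hX x (List.mem_cons_of_mem _ h) hxX
      refine List.nodup_cons.2 ⟨?_, List.nodup_cons.2 ⟨?_, hln⟩⟩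
      · rw [List.mem_cons, not_or]
        exact ⟨hax.ne, fun h => (hmem a h).elim (List.nodup_cons.1 hn).1 haU⟩
      · exact fun h => (hmem x h).elim hxc hxU
    · refine Finset.insert_subset (by simp [hxX, hxF]) (hU.trans ?_)
      exact Finset.sdiff_subset_sdiff subset_rfl (Finset.subset_insert _ _)
    · intro v hv
      rw [List.mem_cons, List.mem_cons] at hv
      rcases hv with rfl | rfl | hv
      · simp
      · simp
      · rcases hmem v hv with h | h
        · exact .inl (List.mem_cons_of_mem _ h)
        · exact .inr (Finset.mem_insert_of_mem h)

open Classical in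
theorem exists_link_path (ha : a ∈ Y) (hb : b ∈ Y) (hab : a ≠ b) (hXY : Disjoint Y X)
    (F : Finset V)
    (hK : ∀ u ∈ Y, ∀ v ∈ Y, u ≠ v → Y.card ≤ (common B X u v \ F).card + 1) :
    ∃ (l : List V) (U : Finset V), IsPth B a b l ∧ l.Nodup ∧ l.length + 1 = 2 * Y.card ∧
      U ⊆ X \ F ∧ U.card + 1 = Y.card ∧ ∀ v ∈ l, v ∈ Y ∨ v ∈ U := by
  set M := (Y.erase a).erase b
  have hM : M.card + 2 = Y.card := by
    have h1 := Finset.card_erase_add_one ha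
    have h2 : M.card + 1 = _ := Finset.card_erase_add_one (Finset.mem_erase.2 ⟨hab.symm, hb⟩)
    omega
  have hmem : ∀ v, v ∈ a :: (M.toList ++ [b]) ↔ v ∈ Y := fun v => by
    simp only [List.mem_cons, List.mem_append, Finset.mem_toList, M, Finset.mem_erase,
      List.not_mem_nil, or_false]
    grind
  obtain ⟨b', l, U, hb', hl, hn, hlen, hU, hUc, hv⟩ := exists_link_path_list (B := B) (X := X)
    (M.toList ++ [b]) a F (by
      simp [List.nodup_append', Finset.nodup_toList, M, hab])
    (fun v hv => Finset.disjoint_left.1 hXY ((hmem v).1 hv))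
    (fun u hu v hv huv => by
      have := hK u ((hmem u).1 hu) v ((hmem v).1 hv) huv
      simp only [List.length_append, Finset.length_toList, List.length_singleton]
      omega)
  obtain rfl : b = b' := by
    simpa [List.getLast?_cons] using hb'
  simp only [List.length_append, Finset.length_toList, List.length_singleton] at hlen hUc
  exact ⟨l, U, hl, hn, by omega, hU, by omega, fun v h => (hv v h).imp_left (hmem v).1⟩

/-- If any two of the `p` vertices in `Y` have at least `p - 1` common neighbours in `X` and there
is no cycle of length `2 * p`, then all these neighbourhoods are equal, of size `p - 1`. -/
theorem exists_common_eq (hY : 3 ≤ Y.card) (hXY : Disjoint Y X)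
    (hK : ∀ u ∈ Y, ∀ v ∈ Y, u ≠ v → Y.card ≤ (common B X u v).card + 1)
    (hno : ¬ HasCyc B (2 * Y.card)) :
    ∃ L ⊆ X, L.card + 1 = Y.card ∧ ∀ u ∈ Y, ∀ v ∈ Y, u ≠ v → common B X u v = L := by
  classical
  have small : ∀ u ∈ Y, ∀ v ∈ Y, u ≠ v → (common B X u v).card < Y.card := by
    intro u hu v hv huv
    by_contra! h
    obtain ⟨l, U, hl, hn, hlen, hU, hUc, hmem⟩ := exists_link_path (B := B) hu hv huv hXY ∅
      (by simpa using hK)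
    obtain ⟨x, hx, hxU⟩ := Finset.exists_mem_notMem_of_card_lt_card (s := U) (t := common B X u v)
      (by omega)
    rw [mem_common] at hx
    refine hno ?_
    have := (hl.cons hx.2.1.symm).hasCyc hx.2.2 (List.nodup_cons.2 ⟨fun h => ?_, hn⟩)
    · simpa [hlen] using this
    · exact (hmem x h).elim (fun h => Finset.disjoint_left.1 hXY h hx.1) hxU
  have sub : ∀ u ∈ Y, ∀ v ∈ Y, ∀ w ∈ Y, u ≠ v → u ≠ w → v ≠ w →
      common B X u v ⊆ common B X u w := by
    intro u hu v hv w hw huv huw hvw x hx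
    by_contra hx'
    have hcard := Finset.card_erase_add_one hu
    obtain ⟨l, U, hl, hn, hlen, hU, hUc, hmem⟩ := exists_link_path (B := B) (Y := Y.erase u)
      (Finset.mem_erase.2 ⟨huv.symm, hv⟩) (Finset.mem_erase.2 ⟨huw.symm, hw⟩) hvw
      (Finset.disjoint_of_subset_left (Finset.erase_subset _ _) hXY) {x}
      (fun a ha b hb hab => by
        have h1 := hK a (Finset.mem_of_mem_erase ha) b (Finset.mem_of_mem_erase hb) hab
        have h2 := Finset.card_le_card_sdiff_add_card (s := common B X a b) (t := {x})
        rw [Finset.card_singleton] at h2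
        omega)
    obtain ⟨z, hz, hzU⟩ := Finset.exists_mem_notMem_of_card_lt_card (s := U) (t := common B X u w)
      (by have := hK u hu w hw huw; omega)
    have hzx : z ≠ x := fun h => hx' (h ▸ hz)
    rw [mem_common] at hx hz
    have hxU : x ∉ U := fun h => by simpa using hU h
    have huX := Finset.disjoint_left.1 hXY hu
    have notMem : ∀ y ∈ X, y ∉ U → y ∉ l := fun y hyX hyU h => (hmem y h).elim
      (fun h => Finset.disjoint_left.1 hXY (Finset.mem_of_mem_erase h) hyX) hyU
    have hul : u ∉ l := fun h => (hmem u h).elim (by simp)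
      fun h => huX (Finset.mem_sdiff.1 (hU h)).1
    refine hno ?_
    have := (((hl.cons hx.2.2.symm).cons hx.2.1).cons hz.2.1.symm).hasCyc hz.2.2
      (by simp [hz.2.1.ne', hzx, hx.2.1.ne, hul, hn, notMem z hz.1 hzU, notMem x hx.1 hxU])
    have e : l.length + 1 + 1 + 1 = 2 * Y.card := by omega
    simpa [e] using this
  have eq : ∀ u ∈ Y, ∀ v ∈ Y, ∀ w ∈ Y, u ≠ v → u ≠ w →
      common B X u v = common B X u w := by
    intro u hu v hv w hw huv huw
    by_cases hvw : v = w
    · rw [hvw]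
    · exact (sub u hu v hv w hw huv huw hvw).antisymm (sub u hu w hw v hv huw huv (Ne.symm hvw))
  obtain ⟨p, hp, q, hq, hpq⟩ := Finset.one_lt_card.1 (show 1 < Y.card by omega)
  refine ⟨common B X p q, fun x hx => (mem_common.1 hx).1, ?_, fun u hu v hv huv => ?_⟩
  · have := small p hp q hq hpq
    have := hK p hp q hq hpq
    omega
  · by_cases hup : u = p
    · subst hup
      exact eq u hu v hv q hq huv hpq
    · rw [eq u hu v hv p hp huv hup, common_comm]
      exact eq p hp u hu q hq (Ne.symm hup) hpq

end Links

section Main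

variable {V : Type*} {G : SimpleGraph V} {f : ℕ → V} {s : ℕ}

theorem card_filter_periodic {p : ℕ → Prop} [DecidablePred p] (hp : ∀ i, p (i + s) ↔ p i) (t : ℕ) :
    ((Finset.range s).filter fun i => p (i + t)).card = ((Finset.range s).filter p).card := by
  rw [← Nat.count_eq_card_filter_range p s,
    ← Nat.filter_Ico_card_eq_of_periodic t s p fun i => propext (hp i)]
  refine Finset.card_bij (fun i _ => i + t) ?_ ?_ ?_
  · intro i hi
    simp only [Finset.mem_filter, Finset.mem_range, Finset.mem_Ico] at hi ⊢
    exact ⟨by omega, hi.2⟩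
  · intro i _ j _ h
    omega
  · intro j hj
    simp only [Finset.mem_filter, Finset.mem_Ico] at hj
    exact ⟨j - t, by
      simp only [Finset.mem_filter, Finset.mem_range]
      exact ⟨by omega, by rw [Nat.sub_add_cancel hj.1.1]; exact hj.2⟩, by omega⟩

/-- A subset of a cyclic order is at most half of it, up to the number of consecutive pairs. -/
theorem two_mul_card_filter_le {p : ℕ → Prop} [DecidablePred p] (hp : ∀ i, p (i + s) ↔ p i) :
    2 * ((Finset.range s).filter p).card ≤
      s + ((Finset.range s).filter fun i => p i ∧ p (i + 1)).card := by
  have h1 := card_filter_periodic hp 1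
  have h2 := Finset.card_union_add_card_inter ((Finset.range s).filter p)
    ((Finset.range s).filter fun i => p (i + 1))
  rw [← Finset.filter_and, ← Finset.filter_or] at h2
  have h3 := Finset.card_filter_le (Finset.range s) fun i => p i ∨ p (i + 1)
  rw [Finset.card_range] at h3
  omega

/-- A nonempty subset of a cyclic order that has more than a third of its elements contains two
elements at distance one or two. -/
theorem exists_close_pair {p : ℕ → Prop} [DecidablePred p] (hp : ∀ i, p (i + s) ↔ p i)
    (h : s < 3 * ((Finset.range s).filter p).card) :
    ∃ i, p i ∧ (p (i + 1) ∨ p (i + 2)) := by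
  by_contra! hno
  have h1 := card_filter_periodic hp 1
  have h2 := card_filter_periodic hp 2
  have d1 : Disjoint ((Finset.range s).filter p) ((Finset.range s).filter fun i => p (i + 1)) :=
    Finset.disjoint_filter.2 fun i _ hi => (hno i hi).1
  have d2 : Disjoint ((Finset.range s).filter p ∪ (Finset.range s).filter fun i => p (i + 1))
      ((Finset.range s).filter fun i => p (i + 2)) :=
    Finset.disjoint_union_left.2 ⟨Finset.disjoint_filter.2 fun i _ hi => (hno i hi).2,
      Finset.disjoint_filter.2 fun i _ hi => (hno _ hi).1⟩
  have h3 := Finset.card_union_of_disjoint d1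
  have h4 := Finset.card_union_of_disjoint d2
  have h5 := Finset.card_le_card (Finset.union_subset (Finset.union_subset
    (Finset.filter_subset p (Finset.range s)) (Finset.filter_subset (fun i => p (i + 1)) _))
    (Finset.filter_subset (fun i => p (i + 2)) _))
  rw [Finset.card_range] at h5
  omega

/-- The vertex set of a cycle. -/
noncomputable def cycSet (f : ℕ → V) (s : ℕ) : Finset V := by
  classical exact (Finset.range s).image f

theorem mem_cycSet {v : V} : v ∈ cycSet f s ↔ ∃ i < s, f i = v := by
  classical simp [cycSet]

theorem IsCyc.mem_cycSet (hf : IsCyc G s f) (hs : 0 < s) (i : ℕ) : f i ∈ cycSet f s := by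
  have key : ∀ i, i < s → ∀ k, f (i + k * s) ∈ cycSet f s := fun i hi k => by
    induction k with
    | zero => exact _root_.mem_cycSet.2 ⟨i, hi, by simp⟩
    | succ k ih => rwa [Nat.succ_mul, ← Nat.add_assoc, hf.periodic]
  simpa [Nat.mod_add_div'] using key (i % s) (Nat.mod_lt _ hs) (i / s)

theorem IsCyc.card_filter (hf : IsCyc G s f) (q : V → Prop) [DecidablePred q] :
    ((cycSet f s).filter q).card = ((Finset.range s).filter fun i => q (f i)).card := by
  classical
  rw [cycSet, Finset.filter_image, Finset.card_image_of_injOn]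
  intro i hi j hj h
  simp only [Finset.coe_filter, Finset.mem_range, Set.mem_ofPred_eq] at hi hj
  exact hf.inj i hi.1 j hj.1 h

theorem IsCyc.card_cycSet (hf : IsCyc G s f) : (cycSet f s).card = s := by
  classical simpa using hf.card_filter fun _ => True

open Classical in
theorem IsCyc.card_common (hf : IsCyc G s f) (hs : 0 < s) {y z : V} (hy : y ∉ cycSet f s)
    (hz : z ∉ cycSet f s) :
    (common Gᶜ (cycSet f s) y z).card +
      ((Finset.range s).filter fun i => G.Adj y (f i) ∨ G.Adj z (f i)).card = s := by
  have hc : (common Gᶜ (cycSet f s) y z).card =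
      ((Finset.range s).filter fun i => Gᶜ.Adj y (f i) ∧ Gᶜ.Adj z (f i)).card := by
    rw [← hf.card_filter fun x => Gᶜ.Adj y x ∧ Gᶜ.Adj z x]
    congr 1
    ext x
    rw [mem_common, Finset.mem_filter]
  rw [hc]
  have := Finset.card_filter_add_card_filter_not (s := Finset.range s)
    (fun i => G.Adj y (f i) ∨ G.Adj z (f i))
  rw [Finset.card_range, Nat.add_comm] at this
  refine Eq.trans ?_ this
  congr 2
  refine Finset.filter_congr fun i _ => ?_
  have h1 : y ≠ f i := fun h => hy (h ▸ hf.mem_cycSet hs i)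
  have h2 : z ≠ f i := fun h => hz (h ▸ hf.mem_cycSet hs i)
  simp [SimpleGraph.compl_adj, h1, h2]

theorem IsCyc.le_card_common (hf : IsCyc G s f) (hs : 1 ≤ s) (h1 : ¬ HasCyc G (s + 1))
    (h2 : ¬ HasCyc G (s + 2)) {y z : V} (hy : y ∉ cycSet f s) (hz : z ∉ cycSet f s)
    (hyz : y ≠ z) :
    s ≤ 2 * (common Gᶜ (cycSet f s) y z).card + 2 ∧
      (G.Adj y z → s ≤ 2 * (common Gᶜ (cycSet f s) y z).card) := by
  classical
  have hy' : ∀ i, f i ≠ y := fun i h => hy (h ▸ hf.mem_cycSet hs i)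
  have hz' : ∀ i, f i ≠ z := fun i h => hz (h ▸ hf.mem_cycSet hs i)
  have hcard := hf.card_common hs hy hz
  have htwo := two_mul_card_filter_le (s := s)
    (p := fun i => G.Adj y (f i) ∨ G.Adj z (f i)) fun i => by rw [hf.periodic]
  have one : ∀ w, (∀ i, f i ≠ w) → ∀ i, G.Adj w (f i) → ¬ G.Adj w (f (i + 1)) :=
    fun w hw i h h' => h1 (hf.insert_one hs hw h h')
  have sub : ((Finset.range s).filter fun i => (G.Adj y (f i) ∨ G.Adj z (f i)) ∧
      (G.Adj y (f (i + 1)) ∨ G.Adj z (f (i + 1)))) ⊆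
      ((Finset.range s).filter fun i => G.Adj y (f i) ∧ G.Adj z (f (i + 1))) ∪
      ((Finset.range s).filter fun i => G.Adj z (f i) ∧ G.Adj y (f (i + 1))) := by
    intro i
    simp only [Finset.mem_filter, Finset.mem_union]
    have := one y hy' i
    have := one z hz' i
    tauto
  have cross : ∀ v w, (∀ i, f i ≠ v) → (∀ i, f i ≠ w) → v ≠ w →
      ((Finset.range s).filter fun i => G.Adj v (f i) ∧ G.Adj w (f (i + 1))).card ≤ 1 := by
    intro v w hv hw hvw
    refine Finset.card_le_one.2 fun i hi j hj => ?_
    simp only [Finset.mem_filter, Finset.mem_range] at hi hj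
    by_contra hij
    wlog hlt : i < j generalizing i j
    · exact this j i hj hi (Ne.symm hij) (by omega)
    refine h2 (hf.insert_two (t := i) (u := j - i) hv hw hvw (by omega) (by omega) hi.2.1 hi.2.2 ?_ ?_)
    · rw [Nat.add_sub_cancel' hlt.le]
      exact hj.2.1
    · rw [Nat.add_sub_cancel' hlt.le]
      exact hj.2.2
  have hle := (Finset.card_le_card sub).trans (Finset.card_union_le _ _)
  refine ⟨?_, fun hadj => ?_⟩
  · have := cross y z hy' hz' hyz
    have := cross z y hz' hy' hyz.symm
    omega
  · have empty : ∀ v w, (∀ i, f i ≠ v) → (∀ i, f i ≠ w) → G.Adj v w →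
        ((Finset.range s).filter fun i => G.Adj v (f i) ∧ G.Adj w (f (i + 1))).card = 0 :=
      fun v w hv hw hvw => Finset.card_eq_zero.2 <|
        Finset.filter_false_of_mem fun i _ h => h2 (hf.insert_edge hs hv hw hvw h.1 h.2)
    have := empty y z hy' hz' hadj
    have := empty z y hz' hy' hadj.symm
    omega

/-- The configuration in which all pairs in `Y` have many common neighbours in the second color. -/
theorem IsCyc.false_of_card_common (hf : IsCyc G s f) {m : ℕ} (hm : 3 ≤ m)
    (h1 : ¬ HasCyc G (s + 1)) (hB : ¬ HasCyc Gᶜ (2 * m)) {Y : Finset V} (hY : Y.card = m)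
    (hYC : Disjoint Y (cycSet f s))
    (hK : ∀ y ∈ Y, ∀ z ∈ Y, y ≠ z → m ≤ (common Gᶜ (cycSet f s) y z).card + 1)
    (hs : s + 1 = 2 * m ∨ s + 2 = 2 * m ∧ ∀ y ∈ Y, ∀ z ∈ Y, y ≠ z → G.Adj y z) : False := by
  classical
  subst hY
  have hs0 : 2 ≤ s := by omega
  obtain ⟨L, hLC, hLcard, hL⟩ := exists_common_eq hm hYC hK hB
  have hne : ∀ y ∈ Y, ∀ i, f i ≠ y := fun y hy i h =>
    Finset.disjoint_left.1 hYC hy (h ▸ hf.mem_cycSet (by omega) i)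
  have blue : ∀ i, f i ∉ L → (Y.filter fun y => ¬ G.Adj y (f i)).card ≤ 1 := by
    intro i hi
    refine Finset.card_le_one.2 fun y hy z hz => ?_
    rw [Finset.mem_filter] at hy hz
    by_contra hyz
    refine hi ?_
    rw [← hL y hy.1 z hz.1 hyz, mem_common]
    simp only [SimpleGraph.compl_adj]
    exact ⟨hf.mem_cycSet (by omega) i, ⟨(hne y hy.1 i).symm, hy.2⟩, (hne z hz.1 i).symm, hz.2⟩
  have cons : ∀ i, f i ∉ L → f (i + 1) ∉ L → False := by
    intro i hi hi'
    obtain ⟨y, hy, hyn⟩ := Finset.exists_mem_notMem_of_card_lt_card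
      (s := (Y.filter fun y => ¬ G.Adj y (f i)) ∪ Y.filter fun y => ¬ G.Adj y (f (i + 1)))
      (t := Y) (by
        have := Finset.card_union_le (Y.filter fun y => ¬ G.Adj y (f i))
          (Y.filter fun y => ¬ G.Adj y (f (i + 1)))
        have := blue i hi
        have := blue (i + 1) hi'
        omega)
    simp only [Finset.mem_union, Finset.mem_filter, hy, true_and, not_or, not_not] at hyn
    exact h1 (hf.insert_one (by omega) (hne y hy) hyn.1 hyn.2)
  have hp : ∀ i, f (i + s) ∉ L ↔ f i ∉ L := fun i => by rw [hf.periodic]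
  have hcard : ((Finset.range s).filter fun i => f i ∉ L).card + L.card = s := by
    rw [← hf.card_filter fun v => v ∉ L, Finset.filter_notMem_eq_sdiff,
      Finset.card_sdiff_add_card_eq_card hLC, hf.card_cycSet]
  rcases hs with hs | ⟨hs, hred⟩
  · have := two_mul_card_filter_le (p := fun i => f i ∉ L) hp
    have e := Finset.filter_false_of_mem (s := Finset.range s)
      (p := fun i => f i ∉ L ∧ f (i + 1) ∉ L) fun i _ h => cons i h.1 h.2
    rw [e] at this
    simp only [Finset.card_empty] at this
    omega
  · obtain ⟨i, hi, hi' | hi'⟩ := exists_close_pair (p := fun i => f i ∉ L) hp (by omega)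
    · exact cons i hi hi'
    · obtain ⟨y, hy, hyn⟩ := Finset.exists_mem_notMem_of_card_lt_card
        (s := Y.filter fun y => ¬ G.Adj y (f i)) (t := Y) (by have := blue i hi; omega)
      obtain ⟨z, hz, hzn⟩ := Finset.exists_mem_notMem_of_card_lt_card
        (s := insert y (Y.filter fun y => ¬ G.Adj y (f (i + 2)))) (t := Y) (by
          have := Finset.card_insert_le y (Y.filter fun y => ¬ G.Adj y (f (i + 2)))
          have := blue _ hi'
          omega)
      simp only [Finset.mem_insert, Finset.mem_filter, hy, hz, true_and, not_or, not_not]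
        at hyn hzn
      exact h1 (hf.replace_vertex (by omega) (hne y hy) (hne z hz)
        (hred y hy z hz (Ne.symm hzn.1)) hyn hzn.2)

/-- A longest monochromatic cycle of odd length `2 * m - 1` leaves fewer than `m` vertices. -/
theorem IsCyc.false_of_odd (hf : IsCyc G s f) {m : ℕ} (hm : 3 ≤ m) (hs : s + 1 = 2 * m)
    (hG : ∀ t > s, ¬ HasCyc G t) (hB : ∀ t > s, ¬ HasCyc Gᶜ t) {Y : Finset V} (hY : m ≤ Y.card)
    (hYC : Disjoint Y (cycSet f s)) : False := by
  obtain ⟨Y', hY', hcard⟩ := Finset.exists_subset_card_eq hY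
  have hYC' := Finset.disjoint_of_subset_left hY' hYC
  refine hf.false_of_card_common hm (hG _ (by omega)) (hB _ (by omega)) hcard hYC' ?_ (.inl hs)
  intro y hy z hz hyz
  have := (hf.le_card_common (by omega) (hG _ (by omega)) (hG _ (by omega))
    (Finset.disjoint_left.1 hYC' hy) (Finset.disjoint_left.1 hYC' hz) hyz).1
  omega

/-- A longest monochromatic cycle of even length `2 * m - 2` leaves at most `m` vertices. -/
theorem IsCyc.false_of_even (hf : IsCyc G s f) {m : ℕ} (hm : 3 ≤ m) (hs : s + 2 = 2 * m)
    (hG : ∀ t > s, ¬ HasCyc G t) (hB : ∀ t > s, ¬ HasCyc Gᶜ t) {Y : Finset V}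
    (hY : m + 1 ≤ Y.card) (hYC : Disjoint Y (cycSet f s)) : False := by
  classical
  have hK : ∀ y ∈ Y, ∀ z ∈ Y, y ≠ z → m ≤ (common Gᶜ (cycSet f s) y z).card + 2 ∧
      (G.Adj y z → m ≤ (common Gᶜ (cycSet f s) y z).card + 1) := by
    intro y hy z hz hyz
    have := hf.le_card_common (by omega) (hG _ (by omega)) (hG _ (by omega))
      (Finset.disjoint_left.1 hYC hy) (Finset.disjoint_left.1 hYC hz) hyz
    exact ⟨by omega, fun h => by have := this.2 h; omega⟩
  have path : ∀ (T : Finset V) (a b : V), T ⊆ Y → T.card + 1 = m → a ∈ T → b ∈ T → a ≠ b →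
      ∃ (l : List V) (U : Finset V), IsPth Gᶜ a b l ∧ l.Nodup ∧ l.length + 1 = 2 * T.card ∧
        U ⊆ cycSet f s ∧ U.card + 1 = T.card ∧ ∀ v ∈ l, v ∈ T ∨ v ∈ U := by
    intro T a b hT hTm ha hb hab
    obtain ⟨l, U, h⟩ := exists_link_path (B := Gᶜ) ha hb hab
      (Finset.disjoint_of_subset_left hT hYC) ∅ fun u hu v hv huv => by
        have := (hK u (hT hu) v (hT hv) huv).1
        rw [Finset.sdiff_empty]
        omega
    exact ⟨l, U, by simpa using h⟩
  have mixed : ∀ y ∈ Y, ∀ z ∈ Y, ∀ w ∈ Y, y ≠ z → G.Adj y w → G.Adj y z := by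
    intro y hy z hz w hw hyz hyw
    by_contra hyz'
    have hzw : z ≠ w := fun h => hyz' (h ▸ hyw)
    obtain ⟨T, hT1, hT2, hTm⟩ := Finset.exists_subsuperset_card_eq (s := {w, z}) (t := Y.erase y)
      (n := m - 1) (by
        intro v hv
        rw [Finset.mem_insert, Finset.mem_singleton] at hv
        rw [Finset.mem_erase]
        rcases hv with rfl | rfl
        · exact ⟨hyw.ne', hw⟩
        · exact ⟨hyz.symm, hz⟩) (by rw [Finset.card_pair hzw.symm]; omega)
      (by rw [Finset.card_erase_of_mem hy]; omega)
    have hTY := hT2.trans (Finset.erase_subset _ _)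
    obtain ⟨l, U, hl, hn, hlen, hU, hUc, hmem⟩ := path T w z hTY (by omega) (hT1 (by simp))
      (hT1 (by simp)) hzw.symm
    obtain ⟨x, hx, hxU⟩ := Finset.exists_mem_notMem_of_card_lt_card (s := U)
      (t := common Gᶜ (cycSet f s) y w) (by have := (hK y hy w hw hyw.ne).2 hyw; omega)
    rw [mem_common] at hx
    have hxl : x ∉ l := fun h => (hmem x h).elim
      (fun h => Finset.disjoint_left.1 hYC (hTY h) hx.1) hxU
    have hyl : y ∉ l := fun h => (hmem y h).elim (fun h => by simpa using hT2 h)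
      (fun h => Finset.disjoint_left.1 hYC hy (hU h))
    have := ((hl.cons hx.2.2.symm).cons hx.2.1).hasCyc
      ((SimpleGraph.compl_adj _ _ _).2 ⟨hyz.symm, fun h => hyz' h.symm⟩)
      (by simp [hx.2.1.ne, hxl, hyl, hn])
    exact hB _ (by simp only [List.length_cons]; omega) this
  by_cases hred : ∀ y ∈ Y, ∀ z ∈ Y, y ≠ z → G.Adj y z
  · obtain ⟨Y', hY', hcard⟩ := Finset.exists_subset_card_eq (show m ≤ Y.card by omega)
    exact hf.false_of_card_common hm (hG _ (by omega)) (hB _ (by omega)) hcard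
      (Finset.disjoint_of_subset_left hY' hYC)
      (fun y hy z hz hyz => (hK y (hY' hy) z (hY' hz) hyz).2 (hred y (hY' hy) z (hY' hz) hyz))
      (.inr ⟨hs, fun y hy z hz => hred y (hY' hy) z (hY' hz)⟩)
  · push Not at hred
    obtain ⟨y, hy, z, hz, hyz, hnot⟩ := hred
    have blue : ∀ u ∈ Y, ∀ v ∈ Y, u ≠ v → Gᶜ.Adj u v := by
      intro u hu v hv huv
      refine (SimpleGraph.compl_adj _ _ _).2 ⟨huv, fun h => hnot ?_⟩
      by_cases hyu : y = u
      · exact mixed y hy z hz v hv hyz (hyu ▸ h)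
      · exact mixed y hy z hz u hu hyz (mixed u hu y hy v hv (Ne.symm hyu) h).symm
    obtain ⟨T, hT, hTm⟩ := Finset.exists_subset_card_eq (show m - 1 ≤ Y.card by omega)
    obtain ⟨a, ha, b, hb, hab⟩ := Finset.one_lt_card.1 (show 1 < T.card by omega)
    obtain ⟨c, hc, d, hd, hcd⟩ := Finset.one_lt_card.1 (show 1 < (Y \ T).card by
      rw [Finset.card_sdiff_of_subset hT]; omega)
    rw [Finset.mem_sdiff] at hc hd
    obtain ⟨l, U, hl, hn, hlen, hU, hUc, hmem⟩ := path T a b hT (by omega) ha hb hab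
    have notMem : ∀ v ∈ Y, v ∉ T → v ∉ l := fun v hv hvT h => (hmem v h).elim hvT
      fun h => Finset.disjoint_left.1 hYC hv (hU h)
    have hda : d ≠ a := fun h => hd.2 (h ▸ ha)
    have hbc : b ≠ c := fun h => hc.2 (h ▸ hb)
    have := ((hl.cons (blue d hd.1 a (hT ha) hda)).cons (blue c hc.1 d hd.1 hcd)).hasCyc
      (blue b (hT hb) c hc.1 hbc)
      (by simp [hcd, notMem c hc.1 hc.2, notMem d hd.1 hd.2, hn])
    exact hB _ (by simp only [List.length_cons]; omega) this

theorem hasCyc_four {a b c d : V} (hac : a ≠ c) (hbd : b ≠ d) (hab : G.Adj a b)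
    (hbc : G.Adj b c) (hcd : G.Adj c d) (hda : G.Adj d a) : HasCyc G 4 :=
  ((((IsPth.singleton G d).cons hcd).cons hbc).cons hab).hasCyc hda
    (by simp [hac, hbd, hab.ne, hbc.ne, hcd.ne, hda.ne'])

theorem exists_hasCyc_four [Fintype V] (hV : 8 ≤ Fintype.card V) (G : SimpleGraph V) :
    HasCyc G 4 ∨ HasCyc Gᶜ 4 := by
  classical
  obtain ⟨v⟩ : Nonempty V := Fintype.card_pos_iff.1 (by omega)
  wlog hdeg : 4 ≤ G.degree v generalizing G
  · have hc : 4 ≤ Gᶜ.degree v := by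
      have := G.degree_compl v
      omega
    have := this Gᶜ (by convert hc)
    rwa [compl_compl, or_comm] at this
  by_contra! hno
  obtain ⟨hG, hB⟩ := hno
  obtain ⟨N, hN, hNc⟩ := Finset.exists_subset_card_eq (s := G.neighborFinset v) hdeg
  obtain ⟨w, hw, z, hz, hwz⟩ := Finset.one_lt_card.1
    (show 1 < (Finset.univ \ insert v N).card by
      rw [Finset.card_sdiff_of_subset (Finset.subset_univ _), Finset.card_univ]
      have := Finset.card_insert_le v N
      omega)
  have adj : ∀ x ∈ N, G.Adj v x := fun x hx => (G.mem_neighborFinset _ _).1 (hN hx)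
  have red : ∀ u ∈ Finset.univ \ insert v N, (N.filter fun x => G.Adj u x).card ≤ 1 := by
    intro u hu
    refine Finset.card_le_one.2 fun x hx y hy => ?_
    rw [Finset.mem_filter] at hx hy
    by_contra hxy
    have huv : v ≠ u := by
      rintro rfl
      simp at hu
    exact hG (hasCyc_four huv hxy (adj x hx.1) hx.2.symm hy.2 (adj y hy.1).symm)
  obtain ⟨x, hx, y, hy, hxy⟩ := Finset.one_lt_card.1
    (show 1 < (N \ ((N.filter fun x => G.Adj w x) ∪ N.filter fun x => G.Adj z x)).card by
      have h1 := red w hw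
      have h2 := red z hz
      have h3 := Finset.card_union_le (N.filter fun x => G.Adj w x) (N.filter fun x => G.Adj z x)
      have h4 := Finset.le_card_sdiff
        ((N.filter fun x => G.Adj w x) ∪ N.filter fun x => G.Adj z x) N
      omega)
  simp only [Finset.mem_sdiff, Finset.mem_union, Finset.mem_filter, Finset.mem_univ, true_and,
    Finset.mem_insert, not_or] at hx hy hw hz
  have blue : ∀ u x, u ∉ N → x ∈ N → ¬ (x ∈ N ∧ G.Adj u x) → Gᶜ.Adj u x := fun u x hu hx h =>
    (SimpleGraph.compl_adj _ _ _).2 ⟨fun e => hu (e ▸ hx), fun h' => h ⟨hx, h'⟩⟩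
  exact hB (hasCyc_four hwz hxy (blue w x hw.2 hx.1 hx.2.1) (blue z x hz.2 hx.1 hx.2.2).symm
    (blue z y hz.2 hy.1 hy.2.2) (blue w y hw.2 hy.1 hy.2.1).symm)

theorem exists_hasCyc_ge [Fintype V] {n : ℕ} (hn : 3 ≤ n) (hV : 3 * n - 1 ≤ Fintype.card V)
    (G : SimpleGraph V) : ∃ s ≥ 2 * n, HasCyc G s ∨ HasCyc Gᶜ s := by
  classical
  by_contra! hno
  have key : ∀ (G : SimpleGraph V) (s : ℕ), 4 ≤ s → s < 2 * n → HasCyc G s →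
      (∀ t > s, ¬ HasCyc G t) → (∀ t > s, ¬ HasCyc Gᶜ t) → False := by
    intro G s hs4 hsn ⟨f, hf⟩ hG hB
    have hcard := Finset.card_sdiff_add_card_eq_card (Finset.subset_univ (cycSet f s))
    rw [hf.card_cycSet, Finset.card_univ] at hcard
    rcases Nat.even_or_odd' s with ⟨k, hk | hk⟩
    · exact hf.false_of_even (m := k + 1) (by omega) (by omega) hG hB
        (Y := Finset.univ \ cycSet f s) (by omega) Finset.sdiff_disjoint
    · exact hf.false_of_odd (m := k + 1) (by omega) (by omega) hG hB
        (Y := Finset.univ \ cycSet f s) (by omega) Finset.sdiff_disjoint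
  let P : ℕ → Prop := fun s => HasCyc G s ∨ HasCyc Gᶜ s
  have hlt : ∀ s, P s → s < 2 * n := fun s hs => by
    by_contra h
    exact hs.elim (hno s (by omega)).1 (hno s (by omega)).2
  have h4 : P 4 := exists_hasCyc_four (by omega) G
  obtain ⟨s, hs4, hs, hmax⟩ : ∃ s, 4 ≤ s ∧ P s ∧ ∀ t > s, ¬ P t :=
    ⟨Nat.findGreatest P (2 * n), Nat.le_findGreatest (hlt 4 h4).le h4,
      Nat.findGreatest_spec (hlt 4 h4).le h4,
      fun t ht h => ht.not_ge (Nat.le_findGreatest (hlt t h).le h)⟩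
  rcases hs with h | h
  · exact key G s hs4 (hlt s (.inl h)) h (fun t ht h => hmax t ht (.inl h))
      fun t ht h => hmax t ht (.inr h)
  · exact key Gᶜ s hs4 (hlt s (.inr h)) h (fun t ht h => hmax t ht (.inr h))
      fun t ht h => hmax t ht (.inl (by rwa [compl_compl] at h))

end Main

/-- The graph of the edges of color `0`. -/
def colorGraph {V : Type*} (c : V → V → Fin 2) (hc : ColorSymm c) : SimpleGraph V where
  Adj u v := u ≠ v ∧ c u v = 0
  symm := ⟨fun u v h => ⟨h.1.symm, (hc v u).trans h.2⟩⟩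
  loopless := ⟨fun _ h => h.1 rfl⟩

theorem monoCycle_of_hasCyc {V : Type*} {c : V → V → Fin 2} {G : SimpleGraph V} {m : ℕ}
    {i : Fin 2} (hG : ∀ u v, G.Adj u v → c u v = i) (h : HasCyc G m) : MonoCycle c m i := by
  obtain ⟨f, hf⟩ := h
  refine ⟨fun j => f j, fun j k hjk => Fin.ext (hf.inj _ j.2 _ k.2 hjk), fun j => hG _ _ ?_⟩
  have hj := j.2
  by_cases h : j.val + 1 < m
  · simpa [nextFin, Nat.mod_eq_of_lt h] using hf.adj j
  · have e : j.val + 1 = m := by omega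
    have h0 : f m = f 0 := by simpa using hf.periodic 0
    have := hf.adj j
    rw [e, h0] at this
    simpa [nextFin, e] using this

/-- The coloring whose color `0` is a clique on the first `m` vertices. -/
def cliqueColoring (N m : ℕ) (u v : Fin N) : Fin 2 := if u.val < m ∧ v.val < m then 0 else 1

theorem cliqueColoring_symm (N m : ℕ) : ColorSymm (cliqueColoring N m) := fun u v => by
  simp only [cliqueColoring, and_comm]

theorem not_monoCycle_cliqueColoring {N n : ℕ} (hn : 1 ≤ n) (hN : N ≤ 3 * n - 2) (i : Fin 2) :
    ¬ MonoCycle (cliqueColoring N (2 * n - 1)) (2 * n) i := by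
  rintro ⟨f, hf, hc⟩
  have key : ∀ j, cliqueColoring N (2 * n - 1) (f j) (f (nextFin j)) = 0 ↔
      (f j).val < 2 * n - 1 ∧ (f (nextFin j)).val < 2 * n - 1 := fun j => by
    rw [cliqueColoring]
    split_ifs with h <;> simp only [h, and_self, one_ne_zero]
  by_cases hi : i = 0
  · subst hi
    have h : Function.Injective fun j => (⟨(f j).val, ((key j).1 (hc j)).1⟩ : Fin (2 * n - 1)) :=
      fun j k hjk => hf (Fin.ext (by simpa using hjk))
    have := Fintype.card_le_of_injective _ h
    simp only [Fintype.card_fin] at this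
    omega
  · have out : ∀ k : Fin n, ∃ j : Fin (2 * n), j.val / 2 = k ∧ 2 * n - 1 ≤ (f j).val := by
      intro k
      have hk := k.2
      by_contra! hno
      set j : Fin (2 * n) := ⟨2 * k, by omega⟩ with hj
      have e : nextFin j = ⟨2 * k + 1, by omega⟩ := by
        simp [nextFin, hj, Nat.mod_eq_of_lt (show 2 * k.val + 1 < 2 * n by omega)]
      refine hi ((hc j).symm.trans ((key j).2 ⟨hno j ?_, hno _ ?_⟩))
      · simp [hj]
      · simp only [e]
        omega
    choose j hjk hj using out
    have h : Function.Injective fun k => (⟨(f (j k)).val - (2 * n - 1), by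
        have := (f (j k)).2
        have := hj k
        omega⟩ : Fin (n - 1)) := fun k k' hkk => by
      have h1 := hj k
      have h2 := hj k'
      simp only [Fin.mk.injEq] at hkk
      have h3 : j k = j k' := hf (Fin.ext (by omega))
      exact Fin.ext (by rw [← hjk k, ← hjk k', h3])
    have := Fintype.card_le_of_injective _ h
    simp only [Fintype.card_fin] at this
    omega

/-- Rosta's theorem: for all $n ≥ 3$, $R(C_{2n}, C_{2n}) = 3n - 1$. -/
theorem ramsey_even_cycle_two_colors (n : ℕ) (hn : 3 ≤ n) :
    IsLeast {N : ℕ | ∀ c : Fin N → Fin N → Fin 2,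
        ColorSymm c → ∃ i : Fin 2, MonoCycle c (2 * n) i}
      (3 * n - 1) := by
  constructor
  · intro c hc
    obtain ⟨s, hs, h⟩ := exists_hasCyc_ge hn (by simp) (colorGraph c hc)
    rcases hasCyc_of_le hn hs h with h | h
    · exact ⟨0, monoCycle_of_hasCyc (G := colorGraph c hc) (fun u v h => h.2) h⟩
    · refine ⟨1, monoCycle_of_hasCyc (G := (colorGraph c hc)ᶜ) (fun u v h => ?_) h⟩
      rw [SimpleGraph.compl_adj] at h
      have h0 : c u v ≠ 0 := fun h0 => h.2 ⟨h.1, h0⟩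
      omega
  · intro N hN
    by_contra! hlt
    obtain ⟨i, hi⟩ := hN _ (cliqueColoring_symm N (2 * n - 1))
    exact not_monoCycle_cliqueColoring (by omega) (by omega) i hi
end
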